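/- Let μ be an n-dimensional AD-regular measure on ℝ^d. Let B, B' ⊂ ℝ^d be balls with 3B ⊂ B', C⁻¹r(B)ⁿ ≤ μ(B), and C⁻¹r(B') ≤ r(B) ≤ r(B'). Then α₂(B) ≤ C'·α₂(B'), where C' depends only on n, d, C, the AD-regularity constant of μ, and the constant c₂ of the bump function φ. -/

import Mathlib

open MeasureTheory Metric Set ENNReal
open scoped NNReal

noncomputable section

/-- The `p`-th Wasserstein distance between two measures, as a value in `ℝ≥0∞`. -/
def Wp {E : Type*} [EMetricSpace E] [MeasurableSpace E] (p : ℝ) (μ ν : Measure E) : ℝ≥0∞ :=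
  ⨅ π ∈ {π : Measure (E × E) | π.map Prod.fst = μ ∧ π.map Prod.snd = ν},
    (∫⁻ z, edist z.1 z.2 ^ p ∂π) ^ (1 / p)

/-- The (closed) support of a measure: points all of whose neighbourhoods have
positive measure. -/
def msupp {E : Type*} [MeasurableSpace E] [PseudoMetricSpace E] (μ : Measure E) : Set E :=
  {x | ∀ ε : ℝ, 0 < ε → 0 < μ (ball x ε)}

/-- `μ` is an `n`-dimensional Ahlfors-David regular measure with constant `c₀`:
`c₀⁻¹ rⁿ ≤ μ(B(x,r)) ≤ c₀ rⁿ` for `x ∈ supp μ` and `0 < r ≤ diam(supp μ)`. -/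
def ADRegular {d : ℕ} (n : ℕ) (c₀ : ℝ) (μ : Measure (EuclideanSpace ℝ (Fin d))) : Prop :=
  ∀ x ∈ msupp μ, ∀ r : ℝ, 0 < r → ENNReal.ofReal r ≤ EMetric.diam (msupp μ) →
    ENNReal.ofReal (c₀⁻¹ * r ^ n) ≤ μ (closedBall x r) ∧
      μ (closedBall x r) ≤ ENNReal.ofReal (c₀ * r ^ n)

/-- `μ` is uniformly `n`-rectifiable: `μ` has big pieces of Lipschitz images of `ℝⁿ`, i.e.
there are `θ, M > 0` so that for each `x ∈ supp μ` and `0 < r ≤ diam (supp μ)` there is an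
`M`-Lipschitz map `g : ℝⁿ → ℝ^d` with `μ(B(x,r) ∩ g(Bₙ(0,r))) ≥ θ rⁿ`. -/
def UnifRectifiable {d : ℕ} (n : ℕ) (μ : Measure (EuclideanSpace ℝ (Fin d))) : Prop :=
  ∃ θ M : ℝ, 0 < θ ∧ 0 < M ∧
    ∀ x ∈ msupp μ, ∀ r : ℝ, 0 < r → ENNReal.ofReal r ≤ EMetric.diam (msupp μ) →
      ∃ g : EuclideanSpace ℝ (Fin n) → EuclideanSpace ℝ (Fin d),
        LipschitzWith (Real.toNNReal M) g ∧
        ENNReal.ofReal (θ * r ^ n) ≤ μ (closedBall x r ∩ g '' (closedBall 0 r))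

/-- `φ` is an admissible radial bump function with constant `c₂`:
`φ : ℝ^d → [0,1]` is radial, Lipschitz, `χ_{B(0,2)} ≤ φ ≤ χ_{B(0,3)}`,
`c₂⁻¹ dist(x,∂B(0,3))² ≤ φ(x) ≤ c₂ dist(x,∂B(0,3))²` and
`|∇φ(x)| ≤ c₂ dist(x,∂B(0,3))` on `B(0,3)`. -/
def IsBump {d : ℕ} (c₂ : ℝ) (φ : EuclideanSpace ℝ (Fin d) → ℝ) : Prop :=
  (∃ K : ℝ≥0, LipschitzWith K φ) ∧
  (∀ x y : EuclideanSpace ℝ (Fin d), ‖x‖ = ‖y‖ → φ x = φ y) ∧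
  (∀ x, φ x ∈ Icc (0:ℝ) 1) ∧
  (∀ x : EuclideanSpace ℝ (Fin d), ‖x‖ ≤ 2 → φ x = 1) ∧
  (∀ x : EuclideanSpace ℝ (Fin d), 3 ≤ ‖x‖ → φ x = 0) ∧
  (∀ x : EuclideanSpace ℝ (Fin d), ‖x‖ < 3 →
    c₂⁻¹ * (3 - ‖x‖) ^ 2 ≤ φ x ∧ φ x ≤ c₂ * (3 - ‖x‖) ^ 2) ∧
  (∀ x : EuclideanSpace ℝ (Fin d), ‖x‖ < 3 → DifferentiableAt ℝ φ x →
    ‖fderiv ℝ φ x‖ ≤ c₂ * (3 - ‖x‖))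

/-- The rescaled bump `φ_B` adapted to the ball `B = B(x,r)`: `φ_B(y) = φ((y-x)/r)`. -/
def phiB {d : ℕ} (φ : EuclideanSpace ℝ (Fin d) → ℝ) (x : EuclideanSpace ℝ (Fin d)) (r : ℝ)
    (y : EuclideanSpace ℝ (Fin d)) : ℝ :=
  φ (r⁻¹ • (y - x))

/-- The normalizing constant `c_{B,L} = (∫φ_B dμ)/(∫φ_B dℋⁿ⌊L)`. -/
def cBL {d : ℕ} (n : ℕ) (φ : EuclideanSpace ℝ (Fin d) → ℝ)
    (μ : Measure (EuclideanSpace ℝ (Fin d))) (x : EuclideanSpace ℝ (Fin d)) (r : ℝ)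
    (L : AffineSubspace ℝ (EuclideanSpace ℝ (Fin d))) : ℝ :=
  (∫ y, phiB φ x r y ∂μ) /
    (∫ y, phiB φ x r y ∂((μH[(n:ℝ)]).restrict (L : Set (EuclideanSpace ℝ (Fin d)))))

/-- The flat measure `c_{B,L} φ_B ℋⁿ⌊L` against which `φ_B μ` is compared. -/
def flatB {d : ℕ} (n : ℕ) (φ : EuclideanSpace ℝ (Fin d) → ℝ)
    (μ : Measure (EuclideanSpace ℝ (Fin d))) (x : EuclideanSpace ℝ (Fin d)) (r : ℝ)
    (L : AffineSubspace ℝ (EuclideanSpace ℝ (Fin d))) :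
    Measure (EuclideanSpace ℝ (Fin d)) :=
  ENNReal.ofReal (cBL n φ μ x r L) •
    ((μH[(n:ℝ)]).restrict (L : Set (EuclideanSpace ℝ (Fin d)))).withDensity
      (fun y => ENNReal.ofReal (phiB φ x r y))

/-- The coefficient `α_p(B(x,r))` of the measure `μ` (with respect to the bump `φ`):
`α_p(B) = r^{-1-n/p} inf_L W_p(φ_B μ, c_{B,L} φ_B ℋⁿ⌊L)`, the infimum over all affine
`n`-planes `L` intersecting `B`. -/
def alphaP {d : ℕ} (n : ℕ) (p : ℝ) (φ : EuclideanSpace ℝ (Fin d) → ℝ)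
    (μ : Measure (EuclideanSpace ℝ (Fin d))) (x : EuclideanSpace ℝ (Fin d)) (r : ℝ) :
    ℝ≥0∞ :=
  ENNReal.ofReal (r ^ (-(1:ℝ) - n / p)) *
    ⨅ L ∈ {L : AffineSubspace ℝ (EuclideanSpace ℝ (Fin d)) |
        Module.finrank ℝ L.direction = n ∧
          ((L : Set (EuclideanSpace ℝ (Fin d))) ∩ closedBall x r).Nonempty},
      Wp p (μ.withDensity fun y => ENNReal.ofReal (phiB φ x r y)) (flatB n φ μ x r L)

/-- The coefficient `β_p(B(x,r))` of the measure `μ` for `p = 2`: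
`β₂(B)² = inf_L r^{-n} ∫_{2B} (dist(y,L)/r)² dμ(y)`, over all affine `n`-planes `L`. -/
def beta2 {d : ℕ} (n : ℕ) (μ : Measure (EuclideanSpace ℝ (Fin d)))
    (x : EuclideanSpace ℝ (Fin d)) (r : ℝ) : ℝ≥0∞ :=
  ⨅ L ∈ {L : AffineSubspace ℝ (EuclideanSpace ℝ (Fin d)) |
      Module.finrank ℝ L.direction = n},
    ((∫⁻ y in closedBall x (2 * r),
        ENNReal.ofReal ((infDist y (L : Set (EuclideanSpace ℝ (Fin d))) / r) ^ 2) ∂μ) /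
      ENNReal.ofReal (r ^ n)) ^ (1/2 : ℝ)

/-- `dist_B(σ,ν)`: the supremum of `|∫f dσ − ∫f dν|` over `1`-Lipschitz functions `f`
supported in `B`. -/
def distB {d : ℕ} (B : Set (EuclideanSpace ℝ (Fin d)))
    (σ ν : Measure (EuclideanSpace ℝ (Fin d))) : ℝ≥0∞ :=
  ⨆ f ∈ {f : EuclideanSpace ℝ (Fin d) → ℝ | LipschitzWith 1 f ∧ ∀ x ∉ B, f x = 0},
    ENNReal.ofReal |(∫ x, f x ∂σ) - (∫ x, f x ∂ν)|

/-- The coefficient `α(B(x,r))` of `[Tolsa, PLMS]`: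
`α(B) = r^{-n-1} inf_{a ≥ 0, L} dist_{3B}(μ, a ℋⁿ⌊L)`. -/
def alphaCoef {d : ℕ} (n : ℕ) (μ : Measure (EuclideanSpace ℝ (Fin d)))
    (x : EuclideanSpace ℝ (Fin d)) (r : ℝ) : ℝ≥0∞ :=
  ENNReal.ofReal (r ^ (-(n:ℝ) - 1)) *
    ⨅ (a : ℝ≥0) (L : {L : AffineSubspace ℝ (EuclideanSpace ℝ (Fin d)) //
        Module.finrank ℝ L.direction = n}),
      distB (closedBall x (3 * r)) μ
        ((a : ℝ≥0∞) • (μH[(n:ℝ)]).restrict ((L.1 : Set (EuclideanSpace ℝ (Fin d)))))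

/-- The squared quadratic Wasserstein distance, as an infimum over couplings. -/
def sqCost {E : Type*} [EMetricSpace E] [MeasurableSpace E] (μ ν : Measure E) : ℝ≥0∞ :=
  ⨅ π : {π : Measure (E × E) // π.map Prod.fst = μ ∧ π.map Prod.snd = ν},
    ∫⁻ z, edist z.1 z.2 ^ 2 ∂π.1

section SqCost

variable {E : Type*} [EMetricSpace E] [MeasurableSpace E]

lemma sqCost_le (π : Measure (E × E)) :
    sqCost (π.map Prod.fst) (π.map Prod.snd) ≤ ∫⁻ z, edist z.1 z.2 ^ 2 ∂π :=
  iInf_le_of_le ⟨π, rfl, rfl⟩ le_rfl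

lemma sqCost_le_of_coupling {μ ν : Measure E} (π : Measure (E × E)) (h₁ : π.map Prod.fst = μ)
    (h₂ : π.map Prod.snd = ν) : sqCost μ ν ≤ ∫⁻ z, edist z.1 z.2 ^ 2 ∂π :=
  h₁ ▸ h₂ ▸ sqCost_le π

lemma Wp_two_eq (μ ν : Measure E) : Wp 2 μ ν = sqCost μ ν ^ (1 / 2 : ℝ) := by
  have h : (0 : ℝ) < 1 / 2 := by norm_num
  have e := (ENNReal.orderIsoRpow (1 / 2 : ℝ) h).map_iInf
    (fun π : {π : Measure (E × E) // π.map Prod.fst = μ ∧ π.map Prod.snd = ν} =>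
      ∫⁻ z, edist z.1 z.2 ^ 2 ∂π.1)
  simp only [ENNReal.orderIsoRpow_apply] at e
  rw [sqCost, e, Wp, iInf_subtype]
  simp only [mem_ofPred_eq, ENNReal.rpow_two]

lemma sqCost_add_le (μ₁ μ₂ ν₁ ν₂ : Measure E) :
    sqCost (μ₁ + μ₂) (ν₁ + ν₂) ≤ sqCost μ₁ ν₁ + sqCost μ₂ ν₂ := by
  rw [sqCost.eq_def μ₁ ν₁, sqCost.eq_def μ₂ ν₂, ENNReal.iInf_add]
  refine le_iInf fun π => ?_
  rw [ENNReal.add_iInf]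
  refine le_iInf fun ρ => ?_
  rw [← lintegral_add_measure]
  refine sqCost_le_of_coupling _ ?_ ?_
  · rw [Measure.map_add _ _ measurable_fst, π.2.1, ρ.2.1]
  · rw [Measure.map_add _ _ measurable_snd, π.2.2, ρ.2.2]

lemma sqCost_smul_le (c : ℝ≥0) (μ ν : Measure E) :
    sqCost (c • μ) (c • ν) ≤ c * sqCost μ ν := by
  rcases eq_or_ne c 0 with rfl | hc
  · refine (sqCost_le_of_coupling 0 (by simp) (by simp)).trans (by simp)
  rw [sqCost.eq_def μ ν, ENNReal.mul_iInf_of_ne (by simpa using hc) (by simp)]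
  refine le_iInf fun π => ?_
  refine (sqCost_le_of_coupling (c • π.1) ?_ ?_).trans ?_
  · rw [Measure.map_smul, π.2.1]
  · rw [Measure.map_smul, π.2.2]
  · rw [lintegral_smul_measure]; rfl

variable [BorelSpace E] [SecondCountableTopology E]

lemma measurable_edist_sq : Measurable fun z : E × E => edist z.1 z.2 ^ 2 :=
  (measurable_fst.edist measurable_snd).pow_const 2

lemma sqCost_map_le {X : Type*} [EMetricSpace X] [MeasurableSpace X] [BorelSpace X]
    {Φ : X → E} {L : ℝ≥0} (hL : L ≠ 0) (hΦ : LipschitzWith L Φ)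
    (μ ν : Measure X) : sqCost (μ.map Φ) (ν.map Φ) ≤ (L ^ 2 : ℝ≥0) * sqCost μ ν := by
  have hm : Measurable Φ := hΦ.continuous.measurable
  have key : ∀ π : {π : Measure (X × X) // π.map Prod.fst = μ ∧ π.map Prod.snd = ν},
      sqCost (μ.map Φ) (ν.map Φ) ≤ (L ^ 2 : ℝ≥0) * ∫⁻ z, edist z.1 z.2 ^ 2 ∂π.1 := by
    intro π
    refine (sqCost_le_of_coupling (π.1.map (Prod.map Φ Φ)) ?_ ?_).trans ?_
    · rw [Measure.map_map measurable_fst (hm.prodMap hm), Prod.map_fst',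
        ← Measure.map_map hm measurable_fst, π.2.1]
    · rw [Measure.map_map measurable_snd (hm.prodMap hm), Prod.map_snd',
        ← Measure.map_map hm measurable_snd, π.2.2]
    · rw [lintegral_map measurable_edist_sq (hm.prodMap hm), ← lintegral_const_mul' _ _ (by simp)]
      refine lintegral_mono fun z => ?_
      simp only [Prod.map_fst, Prod.map_snd]
      rw [ENNReal.coe_pow, ← mul_pow]
      gcongr
      exact hΦ _ _
  rw [sqCost.eq_def μ ν, ENNReal.mul_iInf_of_ne (by simpa using hL) (by simp)]
  exact le_iInf key

lemma sqCost_map_graph_le (μ : Measure E) {S : E → E} (hS : Measurable S) :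
    sqCost (μ.map S) μ ≤ ∫⁻ x, edist (S x) x ^ 2 ∂μ := by
  have hg : Measurable fun x => (S x, x) := hS.prodMk measurable_id
  refine (sqCost_le_of_coupling (μ.map fun x => (S x, x)) ?_ ?_).trans ?_
  · rw [Measure.map_map measurable_fst hg]; rfl
  · rw [Measure.map_map measurable_snd hg]; exact Measure.map_id
  · rw [lintegral_map measurable_edist_sq hg]

lemma sqCost_self (μ : Measure E) : sqCost μ μ = 0 := by
  have := sqCost_map_graph_le μ measurable_id
  simpa using this

lemma sqCost_le_of_bounded {μ ν : Measure E} [IsFiniteMeasure μ] (hm : μ univ = ν univ)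
    {s : Set E} (hμ : ∀ᵐ x ∂μ, x ∈ s) (hν : ∀ᵐ x ∂ν, x ∈ s) {D : ℝ≥0∞}
    (hD : ∀ x ∈ s, ∀ y ∈ s, edist x y ≤ D) : sqCost μ ν ≤ D ^ 2 * μ univ := by
  have : IsFiniteMeasure ν := ⟨hm ▸ measure_lt_top μ univ⟩
  rcases eq_or_ne (μ univ) 0 with h0 | h0
  · have h1 : μ = 0 := Measure.measure_univ_eq_zero.1 h0
    have h2 : ν = 0 := Measure.measure_univ_eq_zero.1 (hm ▸ h0)
    rw [h1, h2, sqCost_self]; simp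
  have htop := measure_ne_top μ univ
  refine (sqCost_le_of_coupling ((μ univ)⁻¹ • μ.prod ν) ?_ ?_).trans ?_
  · rw [Measure.map_smul, Measure.map_fst_prod, smul_smul, ← hm, ENNReal.inv_mul_cancel h0 htop,
      one_smul]
  · rw [Measure.map_smul, Measure.map_snd_prod, smul_smul, ENNReal.inv_mul_cancel h0 htop,
      one_smul]
  · have h : ∀ᵐ z ∂(μ.prod ν), edist z.1 z.2 ^ 2 ≤ D ^ 2 := by
      have h1 : ∀ᵐ z ∂(μ.prod ν), z.1 ∈ s := Measure.quasiMeasurePreserving_fst.ae hμ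
      have h2 : ∀ᵐ z ∂(μ.prod ν), z.2 ∈ s := Measure.quasiMeasurePreserving_snd.ae hν
      filter_upwards [h1, h2] with z hz1 hz2
      gcongr
      exact hD _ hz1 _ hz2
    rw [lintegral_smul_measure]
    calc (μ univ)⁻¹ • ∫⁻ z, edist z.1 z.2 ^ 2 ∂μ.prod ν
        ≤ (μ univ)⁻¹ * ∫⁻ z, D ^ 2 ∂μ.prod ν := by
          rw [smul_eq_mul]; exact mul_le_mul_right (lintegral_mono_ae h) _
      _ = D ^ 2 * μ univ := by
          rw [lintegral_const, ← univ_prod_univ, Measure.prod_prod, ← hm, mul_comm (_⁻¹), mul_assoc,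
            mul_assoc,
            ENNReal.mul_inv_cancel h0 htop, mul_one]

open ProbabilityTheory in
lemma sqCost_triangle [StandardBorelSpace E] [Nonempty E] {A B : ℝ≥0}
    (hA : A ≠ 0) (hB : B ≠ 0)
    (hAB : ∀ p q : ℝ≥0∞, (p + q) ^ 2 ≤ A * p ^ 2 + B * q ^ 2) (μ ν ρ : Measure E)
    [IsFiniteMeasure ν] :
    sqCost μ ρ ≤ A * sqCost μ ν + B * sqCost ν ρ := by
  rw [sqCost.eq_def μ ν, sqCost.eq_def ν ρ, ENNReal.mul_iInf_of_ne (by simpa using hA) (by simp),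
    ENNReal.mul_iInf_of_ne (by simpa using hB) (by simp), ENNReal.iInf_add]
  refine le_iInf ?_
  rintro ⟨π, hπ₁, hπ₂⟩
  rw [ENNReal.add_iInf]
  refine le_iInf ?_
  rintro ⟨σ, hσ₁, hσ₂⟩
  change sqCost μ ρ ≤ A * ∫⁻ z, edist z.1 z.2 ^ 2 ∂π + B * ∫⁻ z, edist z.1 z.2 ^ 2 ∂σ
  have : IsFiniteMeasure σ := by
    refine ⟨?_⟩
    have h := congrArg (fun m => m univ) hσ₁
    simp only [Measure.map_apply measurable_fst MeasurableSet.univ, preimage_univ] at h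
    rw [h]; exact measure_lt_top ν univ
  have : IsFiniteMeasure π := by
    refine ⟨?_⟩
    have h := congrArg (fun m => m univ) hπ₂
    simp only [Measure.map_apply measurable_snd MeasurableSet.univ, preimage_univ] at h
    rw [h]; exact measure_lt_top ν univ
  set κ := σ.condKernel
  have hσ : ν ⊗ₘ κ = σ := by
    have := σ.disintegrate σ.condKernel
    rwa [Measure.fst, hσ₁] at this
  set τ : Measure ((E × E) × E) := π ⊗ₘ (κ.comap Prod.snd measurable_snd) with hτ
  have hτ₁ : τ.map Prod.fst = π := Measure.fst_compProd _ _
  have hτ₂ : τ.map (fun z => (z.1.2, z.2)) = σ := by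
    rw [← hσ]
    refine Measure.ext_of_lintegral _ fun f hf => ?_
    rw [lintegral_map hf (by fun_prop), hτ, Measure.lintegral_compProd (by fun_prop),
      Measure.lintegral_compProd hf, ← hπ₂, lintegral_map (by fun_prop) measurable_snd]
    rfl
  refine (sqCost_le_of_coupling (τ.map fun z => (z.1.1, z.2)) ?_ ?_).trans ?_
  · rw [Measure.map_map measurable_fst (by fun_prop), ← hπ₁, ← hτ₁,
      Measure.map_map measurable_fst measurable_fst]; rfl
  · rw [Measure.map_map measurable_snd (by fun_prop), ← hσ₂, ← hτ₂,
      Measure.map_map measurable_snd (by fun_prop)]; rfl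
  · rw [lintegral_map measurable_edist_sq (by fun_prop), ← hτ₁, ← hτ₂,
      lintegral_map measurable_edist_sq (by fun_prop),
      lintegral_map measurable_edist_sq (by fun_prop), ← lintegral_const_mul _ ?_,
      ← lintegral_const_mul _ ?_, ← lintegral_add_left ?_]
    · refine lintegral_mono fun z => ?_
      refine le_trans ?_ (hAB _ _)
      gcongr
      exact edist_triangle _ _ _
    · exact (measurable_edist_sq.comp (by fun_prop : Measurable
        fun z : (E × E) × E => z.1)).const_mul _
    · exact measurable_edist_sq.comp (by fun_prop : Measurable fun z : (E × E) × E => (z.1.2, z.2))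
    · exact measurable_edist_sq.comp (by fun_prop : Measurable fun z : (E × E) × E => z.1)

end SqCost

lemma ENNReal.add_sq_le_weighted {δ : ℝ≥0} (hδ : δ ≠ 0) (p q : ℝ≥0∞) :
    (p + q) ^ 2 ≤ ((1 + δ : ℝ≥0) : ℝ≥0∞) * p ^ 2 + ((1 + δ⁻¹ : ℝ≥0) : ℝ≥0∞) * q ^ 2 := by
  rcases eq_or_ne p ⊤ with rfl | hp
  · refine le_top.trans_eq ?_
    symm
    rw [ENNReal.top_pow (by norm_num), ENNReal.mul_top (by simp), top_add]
  rcases eq_or_ne q ⊤ with rfl | hq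
  · refine le_top.trans_eq ?_
    symm
    rw [ENNReal.top_pow (by norm_num), ENNReal.mul_top (by simp), add_top]
  lift p to ℝ≥0 using hp
  lift q to ℝ≥0 using hq
  norm_cast
  rw [← NNReal.coe_le_coe]
  push_cast
  have : (0 : ℝ) ≤ (δ : ℝ)⁻¹ * ((δ : ℝ) * p - q) ^ 2 := by positivity
  have e : (δ : ℝ)⁻¹ * ((δ : ℝ) * p - q) ^ 2 = δ * p ^ 2 - 2 * p * q + (δ : ℝ)⁻¹ * q ^ 2 := by
    field_simp
    ring
  nlinarith

lemma ENNReal.add_sq_le_two_mul (p q : ℝ≥0∞) :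
    (p + q) ^ 2 ≤ ((2 : ℝ≥0) : ℝ≥0∞) * p ^ 2 + ((2 : ℝ≥0) : ℝ≥0∞) * q ^ 2 := by
  have h := ENNReal.add_sq_le_weighted one_ne_zero p q
  rw [inv_one, one_add_one_eq_two] at h
  exact h

lemma sqCost_triangle_two {E : Type*} [EMetricSpace E] [MeasurableSpace E] [BorelSpace E]
    [SecondCountableTopology E] [StandardBorelSpace E] [Nonempty E]
    (μ ν ρ : Measure E)
    [IsFiniteMeasure ν] : sqCost μ ρ ≤ 2 * sqCost μ ν + 2 * sqCost ν ρ := by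
  simpa using sqCost_triangle two_ne_zero two_ne_zero ENNReal.add_sq_le_two_mul μ ν ρ

lemma sqCost_le_mul_sqCost_midpoint {E : Type*} [EMetricSpace E] [MeasurableSpace E]
    [BorelSpace E] [SecondCountableTopology E] [StandardBorelSpace E] [Nonempty E] {a ε : ℝ≥0}
    (hε : ε ≠ 0) (haε : a + ε = 1) (μ ν : Measure E) [IsFiniteMeasure μ] [IsFiniteMeasure ν]
    (hfin : sqCost μ ν ≠ ⊤) :
    sqCost μ ν ≤ ((ε ^ 2)⁻¹ * (1 + ε⁻¹) : ℝ≥0) * sqCost (a • ν + ε • μ) ν := by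
  have h1 : sqCost μ (a • ν + ε • μ) ≤ a * sqCost μ ν := by
    calc sqCost μ (a • ν + ε • μ) = sqCost (a • μ + ε • μ) (a • ν + ε • μ) := by
          rw [← add_smul, haε, one_smul]
      _ ≤ sqCost (a • μ) (a • ν) + sqCost (ε • μ) (ε • μ) := sqCost_add_le _ _ _ _
      _ ≤ a * sqCost μ ν := by
          rw [sqCost_self, add_zero]
          exact sqCost_smul_le _ _ _
  have h2 := sqCost_triangle (by positivity) (by positivity)
    (ENNReal.add_sq_le_weighted hε) μ (a • ν + ε • μ) ν
  generalize sqCost (a • ν + ε • μ) ν = T at h2 ⊢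
  rcases eq_or_ne T ⊤ with hT | hT
  · rw [hT, ENNReal.mul_top]
    · exact le_top
    · simpa using hε
  replace h2 := h2.trans (add_le_add_left (mul_le_mul_right h1 _) _)
  generalize sqCost μ ν = S at *
  lift S to ℝ≥0 using hfin
  lift T to ℝ≥0 using hT
  norm_cast at h2 ⊢
  rw [← NNReal.coe_le_coe] at h2 ⊢
  have ha : (a : ℝ) = 1 - ε := by
    have := congrArg NNReal.toReal haε
    push_cast at this
    linarith
  push_cast at h2 ⊢
  rw [ha] at h2
  rw [mul_assoc, le_inv_mul_iff₀ (by positivity)]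
  linarith

/-- Lebesgue measure on the unit interval. -/
def unitMeasure : Measure ℝ := volume.restrict (Icc 0 1)

instance : IsProbabilityMeasure unitMeasure := ⟨by simp [unitMeasure]⟩

section Primitive

variable {F G : ℝ → ℝ} {c M : ℝ}

lemma intervalIntegrable_of_mem_Icc (hF : Measurable F) (hFc : ∀ t, c ≤ F t) (hFM : ∀ t, F t ≤ M)
    (a b : ℝ) : IntervalIntegrable F volume a b := by
  rw [intervalIntegrable_iff]
  refine Measure.integrableOn_of_bounded (M := max |c| |M|) (by simp)
    hF.aestronglyMeasurable (Filter.Eventually.of_forall fun t => ?_)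
  exact abs_le_max_abs_abs (hFc t) (hFM t)

lemma mul_sub_le_primitive_sub (hF : Measurable F) (hFc : ∀ t, c ≤ F t) (hFM : ∀ t, F t ≤ M)
    {a b : ℝ} (hab : a ≤ b) :
    c * (b - a) ≤ (∫ t in (0 : ℝ)..b, F t) - ∫ t in (0 : ℝ)..a, F t := by
  have hi := intervalIntegrable_of_mem_Icc hF hFc hFM
  rw [intervalIntegral.integral_interval_sub_left (hi _ _) (hi _ _)]
  have := intervalIntegral.integral_mono_on hab (by simp) (hi a b) (fun t _ => hFc t)
  rw [intervalIntegral.integral_const, smul_eq_mul] at this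
  linarith

lemma strictMono_primitive (hc : 0 < c) (hF : Measurable F) (hFc : ∀ t, c ≤ F t)
    (hFM : ∀ t, F t ≤ M) : StrictMono fun τ => ∫ t in (0 : ℝ)..τ, F t := by
  intro a b hab
  have := mul_sub_le_primitive_sub hF hFc hFM hab.le
  have h2 : 0 < c * (b - a) := mul_pos hc (sub_pos.2 hab)
  change (∫ t in (0 : ℝ)..a, F t) < ∫ t in (0 : ℝ)..b, F t
  linarith

lemma continuous_primitive_of_mem_Icc (hF : Measurable F) (hFc : ∀ t, c ≤ F t)
    (hFM : ∀ t, F t ≤ M) : Continuous fun τ => ∫ t in (0 : ℝ)..τ, F t :=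
  intervalIntegral.continuous_primitive (intervalIntegrable_of_mem_Icc hF hFc hFM) 0

lemma surjective_primitive (hc : 0 < c) (hF : Measurable F) (hFc : ∀ t, c ≤ F t)
    (hFM : ∀ t, F t ≤ M) : Function.Surjective fun τ => ∫ t in (0 : ℝ)..τ, F t := by
  refine (continuous_primitive_of_mem_Icc hF hFc hFM).surjective ?_ ?_
  · refine Filter.tendsto_atTop_mono' _ ?_ (Filter.tendsto_id.const_mul_atTop hc)
    filter_upwards [Filter.eventually_ge_atTop 0] with t ht
    have := mul_sub_le_primitive_sub hF hFc hFM ht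
    simpa using this
  · refine Filter.tendsto_atBot_mono' _ ?_ (Filter.tendsto_id.const_mul_atBot hc)
    filter_upwards [Filter.eventually_le_atBot 0] with t ht
    have := mul_sub_le_primitive_sub hF hFc hFM ht
    simp only [intervalIntegral.integral_same, id] at this ⊢
    linarith

lemma withDensity_Ioc_eq (hc : 0 < c) (hF : Measurable F) (hFc : ∀ t, c ≤ F t)
    (hFM : ∀ t, F t ≤ M) {a b : ℝ} (hab : a ≤ b) :
    (volume.withDensity fun t => ENNReal.ofReal (F t)) (Ioc a b) =
      ENNReal.ofReal ((∫ t in (0 : ℝ)..b, F t) - ∫ t in (0 : ℝ)..a, F t) := by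
  have hi := intervalIntegrable_of_mem_Icc hF hFc hFM
  rw [intervalIntegral.integral_interval_sub_left (hi _ _) (hi _ _),
    withDensity_apply _ measurableSet_Ioc, intervalIntegral.integral_of_le hab,
    ofReal_integral_eq_lintegral_ofReal]
  · exact (intervalIntegrable_iff_integrableOn_Ioc_of_le hab).1 (hi a b)
  · exact Filter.Eventually.of_forall fun t => hc.le.trans (hFc t)

variable (hc : 0 < c) (hF : Measurable F) (hFc : ∀ t, c ≤ F t) (hFM : ∀ t, F t ≤ M)
  (hG : Measurable G) (hGc : ∀ t, c ≤ G t) (hGM : ∀ t, G t ≤ M) {s : ℝ → ℝ}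
  (hs : ∀ t, ∫ τ in (0 : ℝ)..s t, F τ = ∫ τ in (0 : ℝ)..t, G τ)

include hc hF hFc hFM hG hGc hGM hs

lemma transport_le_iff {a b : ℝ} (hab : ∫ τ in (0 : ℝ)..a, F τ = ∫ τ in (0 : ℝ)..b, G τ) (t : ℝ) :
    s t ≤ a ↔ t ≤ b := by
  rw [← (strictMono_primitive hc hF hFc hFM).le_iff_le (a := s t),
    ← (strictMono_primitive hc hG hGc hGM).le_iff_le (a := t) (b := b)]
  simp only [hs, hab]

lemma map_transport_volume (hsm : Measurable s) :
    (volume.withDensity fun t => ENNReal.ofReal (G t)).map s =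
      volume.withDensity fun t => ENNReal.ofReal (F t) := by
  have hGb : ∀ a, ∃ b, ∫ τ in (0 : ℝ)..a, F τ = ∫ τ in (0 : ℝ)..b, G τ := fun a => by
    obtain ⟨b, hb⟩ := surjective_primitive hc hG hGc hGM (∫ τ in (0 : ℝ)..a, F τ)
    exact ⟨b, hb.symm⟩
  choose e he using hGb
  have hioc : ∀ a b, s ⁻¹' Ioc a b = Ioc (e a) (e b) := by
    intro a b
    ext t
    rw [mem_preimage, mem_Ioc, mem_Ioc, ← not_le, ← not_le,
      transport_le_iff hc hF hFc hFM hG hGc hGM hs (he a),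
      transport_le_iff hc hF hFc hFM hG hGc hGM hs (he b)]
  have hmono : ∀ a b, a ≤ b → e a ≤ e b := by
    intro a b hab
    rw [← (strictMono_primitive hc hG hGc hGM).le_iff_le]
    simp only [← he]
    exact (strictMono_primitive hc hF hFc hFM).monotone hab
  refine Measure.ext_of_Ioc' _ _ ?_ ?_
  · intro a b hab
    rw [Measure.map_apply hsm measurableSet_Ioc, hioc,
      withDensity_Ioc_eq hc hG hGc hGM (hmono a b hab.le)]
    exact ENNReal.ofReal_ne_top
  · intro a b hab
    rw [Measure.map_apply hsm measurableSet_Ioc, hioc,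
      withDensity_Ioc_eq hc hG hGc hGM (hmono a b hab.le),
      withDensity_Ioc_eq hc hF hFc hFM hab.le, he, he]

lemma map_transport (hsm : Measurable s)
    (hFG : ∫ t in (0 : ℝ)..1, F t = ∫ t in (0 : ℝ)..1, G t) :
    (unitMeasure.withDensity fun t => ENNReal.ofReal (G t)).map s =
      unitMeasure.withDensity fun t => ENNReal.ofReal (F t) := by
  have hpre : s ⁻¹' Icc 0 1 = Icc 0 1 := by
    have hmono := strictMono_primitive hc hF hFc hFM
    have hmono' := strictMono_primitive hc hG hGc hGM
    ext t
    rw [mem_preimage, mem_Icc, mem_Icc, transport_le_iff hc hF hFc hFM hG hGc hGM hs hFG,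
      ← hmono.le_iff_le, ← hmono'.le_iff_le (a := 0)]
    simp only [hs, intervalIntegral.integral_same]
  rw [unitMeasure, ← restrict_withDensity measurableSet_Icc,
    ← restrict_withDensity measurableSet_Icc,
    ← map_transport_volume hc hF hFc hFM hG hGc hGM hs hsm,
    Measure.restrict_map hsm measurableSet_Icc, hpre]

lemma transport_edist_sq_le {t : ℝ} (ht : t ∈ Icc (0 : ℝ) 1) :
    edist (s t) t ^ 2 ≤
      ENNReal.ofReal (c ^ 2)⁻¹ * ∫⁻ t, ENNReal.ofReal ((F t - G t) ^ 2) ∂unitMeasure := by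
  have hiF := intervalIntegrable_of_mem_Icc hF hFc hFM
  have hiG := intervalIntegrable_of_mem_Icc hG hGc hGM
  have hb : ∀ τ, |F τ - G τ| ≤ M - c := fun τ => by
    rw [abs_le]
    constructor <;> linarith [hFc τ, hFM τ, hGc τ, hGM τ]
  have hlip : c * |s t - t| ≤ |(∫ τ in (0 : ℝ)..s t, F τ) - ∫ τ in (0 : ℝ)..t, F τ| := by
    rcases le_total (s t) t with h | h
    · have := mul_sub_le_primitive_sub hF hFc hFM h
      rw [abs_of_nonpos (sub_nonpos.2 h), abs_sub_comm]
      exact le_trans (by linarith) (le_abs_self _)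
    · have := mul_sub_le_primitive_sub hF hFc hFM h
      rw [abs_of_nonneg (sub_nonneg.2 h)]
      exact this.trans (le_abs_self _)
  have hint : Integrable (fun τ => |F τ - G τ|) unitMeasure :=
    Integrable.of_bound (hF.sub hG).abs.aestronglyMeasurable (M - c)
      (Filter.Eventually.of_forall fun τ => by simpa using hb τ)
  have hint2 : Integrable (fun τ => |F τ - G τ| ^ 2) unitMeasure :=
    Integrable.of_bound ((hF.sub hG).abs.pow_const 2).aestronglyMeasurable ((M - c) ^ 2)
      (Filter.Eventually.of_forall fun τ => by
        rw [Real.norm_eq_abs, abs_pow, abs_abs]; gcongr; exact hb τ)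
  have h1 : |(∫ τ in (0 : ℝ)..s t, F τ) - ∫ τ in (0 : ℝ)..t, F τ| ≤
      ∫ τ, |F τ - G τ| ∂unitMeasure := by
    rw [hs, ← intervalIntegral.integral_sub (hiG _ _) (hiF _ _)]
    refine (intervalIntegral.abs_integral_le_integral_abs ht.1).trans ?_
    rw [intervalIntegral.integral_of_le ht.1]
    simp only [abs_sub_comm (G _)]
    refine setIntegral_mono_set hint (Filter.Eventually.of_forall fun τ => abs_nonneg _) ?_
    exact Filter.Eventually.of_forall fun τ hτ => ⟨hτ.1.le, hτ.2.trans ht.2⟩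
  have h2 : (∫ τ, |F τ - G τ| ∂unitMeasure) ^ 2 ≤ ∫ τ, |F τ - G τ| ^ 2 ∂unitMeasure :=
    (even_two.convexOn_pow (𝕜 := ℝ)).map_integral_le (continuous_pow 2).continuousOn
      isClosed_univ (by simp) hint hint2
  rw [← ofReal_integral_eq_lintegral_ofReal (by simpa only [sq_abs] using hint2)
    (Filter.Eventually.of_forall fun τ => sq_nonneg _), ← ENNReal.ofReal_mul (by positivity),
    edist_dist, Real.dist_eq, ← ENNReal.ofReal_pow (abs_nonneg _)]
  refine ENNReal.ofReal_le_ofReal ?_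
  rw [le_inv_mul_iff₀ (by positivity), ← mul_pow]
  simp only [sq_abs] at h2
  refine le_trans ?_ h2
  gcongr
  exact hlip.trans h1

end Primitive

section Cube

variable {ι : Type*} [Fintype ι]

/-- The product measure on the unit cube. -/
def cubeMeasure (ι : Type*) [Fintype ι] : Measure (ι → ℝ) := Measure.pi fun _ => unitMeasure

instance : IsProbabilityMeasure (cubeMeasure ι) := by
  unfold cubeMeasure; infer_instance

variable [DecidableEq ι]

lemma lintegral_lintegral_update {f : (ι → ℝ) → ℝ≥0∞} (hf : Measurable f) (i : ι) :
    ∫⁻ x, ∫⁻ t, f (Function.update x i t) ∂unitMeasure ∂cubeMeasure ι =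
      ∫⁻ x, f x ∂cubeMeasure ι := by
  have hm : Measurable fun x : ι → ℝ => ∫⁻ t, f (Function.update x i t) ∂unitMeasure :=
    (hf.comp measurable_update').lintegral_prod_right'
  refine lintegral_eq_of_lmarginal_eq {i} hm hf ?_
  rw [lmarginal_singleton, lmarginal_singleton]
  ext x
  simp [Function.update_idem]

lemma edist_update_self (x : ι → ℝ) (i : ι) (a : ℝ) :
    edist (Function.update x i a) x ≤ edist a (x i) := by
  rw [edist_pi_le_iff]
  intro j
  rcases eq_or_ne j i with rfl | h
  · simp
  · simp [Function.update_of_ne h]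

lemma sqCost_cube_step (i : ι) {F G : (ι → ℝ) → ℝ} {c M : ℝ} (hc : 0 < c) (hF : Measurable F)
    (hFc : ∀ x, c ≤ F x) (hFM : ∀ x, F x ≤ M) (hG : Measurable G) (hGc : ∀ x, c ≤ G x)
    (hGM : ∀ x, G x ≤ M)
    (hFG : ∀ x, ∫ t in (0 : ℝ)..1, F (Function.update x i t) =
      ∫ t in (0 : ℝ)..1, G (Function.update x i t)) :
    sqCost ((cubeMeasure ι).withDensity fun x => ENNReal.ofReal (F x))
      ((cubeMeasure ι).withDensity fun x => ENNReal.ofReal (G x)) ≤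
      ENNReal.ofReal (M * (c ^ 2)⁻¹) *
        ∫⁻ x, ENNReal.ofReal ((F x - G x) ^ 2) ∂cubeMeasure ι := by
  have hu : ∀ x : ι → ℝ, Measurable fun t : ℝ => Function.update x i t := fun x =>
    measurable_update x
  have hsur := fun x => surjective_primitive (F := fun t => F (Function.update x i t)) hc
    (hF.comp (hu x)) (fun t => hFc _) (fun t => hFM _)
  choose s hs using fun x (t : ℝ) =>
    hsur x (∫ τ in (0 : ℝ)..t, G (Function.update x i τ))
  have hsx : ∀ x t t', s (Function.update x i t) t' = s x t' := by
    intro x t t'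
    apply (strictMono_primitive (F := fun t => F (Function.update x i t)) hc
      (hF.comp (hu x)) (fun t => hFc _) (fun t => hFM _)).injective
    have := hs (Function.update x i t) t'
    simp only [Function.update_idem] at this
    simp only [this, hs]
  have hprim : ∀ {H : (ι → ℝ) → ℝ}, Measurable H → ∀ a b : ℝ, Measurable fun x =>
      ∫ τ in a..b, H (Function.update x i τ) := by
    intro H hH a b
    have h := (hH.comp (measurable_update' (a := i))).stronglyMeasurable
    exact ((h.integral_prod_right' (ν := volume.restrict (Ioc a b))).sub
      (h.integral_prod_right' (ν := volume.restrict (Ioc b a)))).measurable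
  have hsm : Measurable (Function.uncurry s) := by
    refine measurable_of_Iic fun a => ?_
    have e : Function.uncurry s ⁻¹' Iic a = {p : (ι → ℝ) × ℝ |
        (∫ τ in (0 : ℝ)..p.2, G (Function.update p.1 i τ)) ≤
          ∫ τ in (0 : ℝ)..a, F (Function.update p.1 i τ)} := by
      ext ⟨x, t⟩
      simp only [mem_preimage, Function.uncurry_apply_pair, mem_Iic, mem_ofPred_eq]
      rw [← (strictMono_primitive (F := fun t => F (Function.update x i t)) hc
        (hF.comp (hu x)) (fun t => hFc _) (fun t => hFM _)).le_iff_le (a := s x t)]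
      simp only [hs]
    rw [e]
    refine measurableSet_le ?_ ((hprim hF 0 a).comp measurable_fst)
    have := measurable_uncurry_of_continuous_of_measurable
      (u := fun (t : ℝ) (x : ι → ℝ) => ∫ τ in (0 : ℝ)..t, G (Function.update x i τ))
      (fun x => continuous_primitive_of_mem_Icc (F := fun t => G (Function.update x i t))
        (hG.comp (hu x)) (fun t => hGc _) (fun t => hGM _)) (fun t => hprim hG 0 t)
    exact this.comp measurable_swap
  set S : (ι → ℝ) → ι → ℝ := fun x => Function.update x i (s x (x i)) with hS
  have hSm : Measurable S :=
    measurable_update'.comp (measurable_id.prodMk (hsm.comp (measurable_id.prodMk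
      (measurable_pi_apply i))))
  have hSu : ∀ x t, S (Function.update x i t) = Function.update x i (s x t) := by
    intro x t
    simp only [hS, Function.update_self, Function.update_idem, hsx]
  have hsxm : ∀ x, Measurable (s x) := fun x => hsm.comp measurable_prodMk_left
  have hmap : ((cubeMeasure ι).withDensity fun x => ENNReal.ofReal (G x)).map S =
      (cubeMeasure ι).withDensity fun x => ENNReal.ofReal (F x) := by
    refine Measure.ext_of_lintegral _ fun H hH => ?_
    have hHS : Measurable fun x => H (S x) := hH.comp hSm
    have hHu : ∀ x, Measurable fun t => H (Function.update x i t) := fun x => hH.comp (hu x)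
    have hHs : ∀ x, Measurable fun t => H (Function.update x i (s x t)) := fun x =>
      (hHu x).comp (hsxm x)
    rw [lintegral_map hH hSm, lintegral_withDensity_eq_lintegral_mul _ hG.ennreal_ofReal
      hHS, lintegral_withDensity_eq_lintegral_mul _ hF.ennreal_ofReal hH,
      ← lintegral_lintegral_update (hG.ennreal_ofReal.mul hHS) i,
      ← lintegral_lintegral_update (hF.ennreal_ofReal.mul hH) i]
    refine lintegral_congr fun x => ?_
    have h1 := map_transport (F := fun t => F (Function.update x i t))
      (G := fun t => G (Function.update x i t)) hc (hF.comp (hu x)) (fun t => hFc _)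
      (fun t => hFM _) (hG.comp (hu x)) (fun t => hGc _) (fun t => hGM _) (hs x) (hsxm x) (hFG x)
    have h2 := congrArg (fun m => ∫⁻ t, H (Function.update x i t) ∂m) h1
    have hGu : Measurable fun t => G (Function.update x i t) := hG.comp (hu x)
    have hFu : Measurable fun t => F (Function.update x i t) := hF.comp (hu x)
    rw [lintegral_map (hHu x) (hsxm x), lintegral_withDensity_eq_lintegral_mul _
      hGu.ennreal_ofReal (hHs x),
      lintegral_withDensity_eq_lintegral_mul _ hFu.ennreal_ofReal (hHu x)] at h2
    simpa only [Pi.mul_apply, Function.comp_apply, hSu] using h2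
  rw [← hmap]
  refine (sqCost_map_graph_le _ hSm).trans ?_
  have hed : Measurable fun x => edist (S x) x ^ 2 :=
    measurable_edist_sq.comp (hSm.prodMk measurable_id)
  rw [lintegral_withDensity_eq_lintegral_mul _ hG.ennreal_ofReal hed]
  set w : (ι → ℝ) → ℝ≥0∞ := fun x => ENNReal.ofReal ((F x - G x) ^ 2) with hw
  have hwm : Measurable w := ((hF.sub hG).pow_const 2).ennreal_ofReal
  have hM : 0 ≤ M := hc.le.trans ((hFc 0).trans (hFM 0))
  calc ∫⁻ x, ((fun x => ENNReal.ofReal (G x)) * fun x => edist (S x) x ^ 2) x ∂cubeMeasure ι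
      = ∫⁻ x, ∫⁻ t, ENNReal.ofReal (G (Function.update x i t)) *
          edist (S (Function.update x i t)) (Function.update x i t) ^ 2
          ∂unitMeasure ∂cubeMeasure ι :=
        (lintegral_lintegral_update (hG.ennreal_ofReal.mul hed) i).symm
    _ ≤ ∫⁻ x, ENNReal.ofReal (M * (c ^ 2)⁻¹) *
          ∫⁻ t, w (Function.update x i t) ∂unitMeasure ∂cubeMeasure ι := by
        refine lintegral_mono fun x => ?_
        have hb : ∀ᵐ t ∂unitMeasure, ENNReal.ofReal (G (Function.update x i t)) *
            edist (S (Function.update x i t)) (Function.update x i t) ^ 2 ≤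
            ENNReal.ofReal (M * (c ^ 2)⁻¹) * ∫⁻ t, w (Function.update x i t) ∂unitMeasure := by
          filter_upwards [ae_restrict_mem measurableSet_Icc] with t ht
          have h1 := transport_edist_sq_le (F := fun t => F (Function.update x i t))
            (G := fun t => G (Function.update x i t)) hc (hF.comp (hu x)) (fun t => hFc _)
            (fun t => hFM _) (hG.comp (hu x)) (fun t => hGc _) (fun t => hGM _) (hs x) ht
          rw [ENNReal.ofReal_mul hM, mul_assoc]
          refine mul_le_mul' (ENNReal.ofReal_le_ofReal (hGM _)) (le_trans ?_ h1)
          gcongr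
          have h3 := edist_update_self (Function.update x i t) i (s x t)
          rwa [Function.update_idem, Function.update_self, ← hSu] at h3
        refine (lintegral_mono_ae hb).trans ?_
        simp
    _ = _ := by
        rw [lintegral_const_mul' _ _ ENNReal.ofReal_ne_top, lintegral_lintegral_update hwm]

end Cube

section CubeInduction

variable {ι : Type*} [Fintype ι]

lemma measurePreserving_update_cube [DecidableEq ι] (i : ι) :
    MeasurePreserving (fun p : (ι → ℝ) × ℝ => Function.update p.1 i p.2)
      ((cubeMeasure ι).prod unitMeasure) (cubeMeasure ι) := by
  refine ⟨measurable_update', Measure.ext_of_lintegral _ fun f hf => ?_⟩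
  have h : Measurable fun p : (ι → ℝ) × ℝ => f (Function.update p.1 i p.2) :=
    hf.comp measurable_update'
  rw [lintegral_map hf measurable_update', lintegral_prod _ h.aemeasurable]
  exact lintegral_lintegral_update hf i

lemma sq_integral_le_integral_sq {X : Type*} [MeasurableSpace X] {P : Measure X}
    [IsProbabilityMeasure P] {f : X → ℝ} (hf : Measurable f) {c : ℝ} (hfc : ∀ x, |f x| ≤ c) :
    ENNReal.ofReal ((∫ x, f x ∂P) ^ 2) ≤ ∫⁻ x, ENNReal.ofReal (f x ^ 2) ∂P := by
  have h1 : Integrable f P := Integrable.of_bound hf.aestronglyMeasurable c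
    (Filter.Eventually.of_forall hfc)
  have h2 : Integrable (fun x => f x ^ 2) P :=
    Integrable.of_bound (hf.pow_const 2).aestronglyMeasurable (c ^ 2)
      (Filter.Eventually.of_forall fun x => by
        rw [Real.norm_eq_abs, abs_pow]; gcongr; exact hfc x)
  rw [← ofReal_integral_eq_lintegral_ofReal h2 (Filter.Eventually.of_forall fun x => sq_nonneg _)]
  exact ENNReal.ofReal_le_ofReal ((even_two.convexOn_pow (𝕜 := ℝ)).map_integral_le
    (continuous_pow 2).continuousOn isClosed_univ (by simp) h1 h2)

lemma exists_sqCost_cube_le (s : Finset ι) {c : ℝ} (hc : 0 < c) :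
    ∃ K : ℝ≥0, ∀ g w : (ι → ℝ) → ℝ, Measurable g → Measurable w → (∀ x, c ≤ g x) →
      (∀ x, g x ≤ 1) → (∀ x, |w x| ≤ c / 2) → DependsOn w (s : Set ι) →
      ∫ x, w x ∂cubeMeasure ι = 0 →
      sqCost ((cubeMeasure ι).withDensity fun x => ENNReal.ofReal (g x + w x))
        ((cubeMeasure ι).withDensity fun x => ENNReal.ofReal (g x)) ≤
        K * ∫⁻ x, ENNReal.ofReal (w x ^ 2) ∂cubeMeasure ι := by
  classical
  induction s using Finset.induction with
  | empty =>
    refine ⟨0, fun g w hg hw hgc hg1 hwc hdep hint => ?_⟩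
    have h0 : ∀ x, w x = 0 := by
      intro x
      have hcst : ∀ y, w y = w x := fun y => hdep (by simp)
      simpa [hcst] using hint
    simp [h0, sqCost_self]
  | insert i s hi ih =>
    obtain ⟨K, hK⟩ := ih
    set K₁ : ℝ := 2 * ((c / 2) ^ 2)⁻¹ with hK₁
    refine ⟨8 * K₁.toNNReal + 2 * K, fun g w hg hw hgc hg1 hwc hdep hint => ?_⟩
    have hwu : ∀ x, Measurable fun t => w (Function.update x i t) := fun x =>
      hw.comp (measurable_update x)
    set w' : (ι → ℝ) → ℝ := fun x => ∫ t, w (Function.update x i t) ∂unitMeasure with hw'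
    have hw'm : Measurable w' :=
      (hw.comp (measurable_update' (a := i))).stronglyMeasurable.integral_prod_right'.measurable
    have hw'c : ∀ x, |w' x| ≤ c / 2 := fun x => by
      have := norm_integral_le_of_norm_le_const (μ := unitMeasure)
        (f := fun t => w (Function.update x i t)) (C := c / 2)
        (Filter.Eventually.of_forall fun t => hwc _)
      simpa using this
    have hw'u : ∀ x t, w' (Function.update x i t) = w' x := fun x t => by
      simp only [hw', Function.update_idem]
    have hw'd : DependsOn w' (s : Set ι) := by
      intro x y hxy
      simp only [hw']
      refine integral_congr_ae (Filter.Eventually.of_forall fun t => hdep fun j hj => ?_)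
      rcases eq_or_ne j i with rfl | hji
      · simp
      · rw [Function.update_of_ne hji, Function.update_of_ne hji]
        exact hxy j (by simpa [hji] using hj)
    have hw'i : ∫ x, w' x ∂cubeMeasure ι = 0 := by
      rw [← hint, ← (measurePreserving_update_cube i).map_eq,
        integral_map measurable_update'.aemeasurable hw.aestronglyMeasurable, integral_prod,
        (measurePreserving_update_cube i).map_eq]
      exact Integrable.of_bound (hw.comp measurable_update').aestronglyMeasurable (c / 2)
        (Filter.Eventually.of_forall fun p => hwc _)
    have hw'sq : ∫⁻ x, ENNReal.ofReal (w' x ^ 2) ∂cubeMeasure ι ≤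
        ∫⁻ x, ENNReal.ofReal (w x ^ 2) ∂cubeMeasure ι := by
      rw [← lintegral_lintegral_update (hw.pow_const 2).ennreal_ofReal i]
      exact lintegral_mono fun x => sq_integral_le_integral_sq (hwu x) fun t => hwc _
    have hstep := sqCost_cube_step i (F := fun x => g x + w x) (G := fun x => g x + w' x)
      (c := c / 2) (M := 2) (by positivity) (hg.add hw)
      (fun x => by linarith [hgc x, neg_le_of_abs_le (hwc x)])
      (fun x => by linarith [hg1 x, hgc x, le_of_abs_le (hwc x)])
      (hg.add hw'm) (fun x => by linarith [hgc x, neg_le_of_abs_le (hw'c x)])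
      (fun x => by linarith [hg1 x, hgc x, le_of_abs_le (hw'c x)])
      (fun x => by
        have hgi : IntervalIntegrable (fun t => g (Function.update x i t)) volume 0 1 :=
          intervalIntegrable_of_mem_Icc (hg.comp (measurable_update x)) (fun t => hgc _)
            (fun t => hg1 _) 0 1
        have hwi : IntervalIntegrable (fun t => w (Function.update x i t)) volume 0 1 :=
          intervalIntegrable_of_mem_Icc (hwu x) (fun t => neg_le_of_abs_le (hwc _))
            (fun t => le_of_abs_le (hwc _)) 0 1
        simp only [hw'u]
        rw [intervalIntegral.integral_add hgi hwi,
          intervalIntegral.integral_add hgi intervalIntegrable_const]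
        simp [hw', unitMeasure, intervalIntegral.integral_of_le, integral_Icc_eq_integral_Ioc])
    have hdiff : ∫⁻ x, ENNReal.ofReal ((g x + w x - (g x + w' x)) ^ 2) ∂cubeMeasure ι ≤
        4 * ∫⁻ x, ENNReal.ofReal (w x ^ 2) ∂cubeMeasure ι := by
      calc ∫⁻ x, ENNReal.ofReal ((g x + w x - (g x + w' x)) ^ 2) ∂cubeMeasure ι
          ≤ ∫⁻ x, (2 * ENNReal.ofReal (w x ^ 2) + 2 * ENNReal.ofReal (w' x ^ 2))
              ∂cubeMeasure ι := by
            refine lintegral_mono fun x => ?_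
            rw [← ENNReal.ofReal_ofNat 2, ← ENNReal.ofReal_mul (by norm_num),
              ← ENNReal.ofReal_mul (by norm_num), ← ENNReal.ofReal_add (by positivity)
              (by positivity)]
            refine ENNReal.ofReal_le_ofReal ?_
            nlinarith [sq_nonneg (w x + w' x)]
        _ = 2 * ∫⁻ x, ENNReal.ofReal (w x ^ 2) ∂cubeMeasure ι +
            2 * ∫⁻ x, ENNReal.ofReal (w' x ^ 2) ∂cubeMeasure ι := by
            rw [lintegral_add_left ((hw.pow_const 2).ennreal_ofReal.const_mul _),
              lintegral_const_mul' _ _ (by simp), lintegral_const_mul' _ _ (by simp)]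
        _ ≤ _ := by
            refine (add_le_add_right (mul_le_mul_right hw'sq 2) _).trans_eq ?_
            ring
    have hfin : IsFiniteMeasure
        ((cubeMeasure ι).withDensity fun x => ENNReal.ofReal (g x + w' x)) := by
      refine isFiniteMeasure_withDensity_ofReal (Integrable.of_bound
        (hg.add hw'm).aestronglyMeasurable (1 + c / 2)
        (Filter.Eventually.of_forall fun x => ?_)).2
      refine (abs_add_le _ _).trans (add_le_add ?_ (hw'c x))
      rw [abs_of_nonneg (hc.le.trans (hgc x))]
      exact hg1 x
    refine (sqCost_triangle_two _ ((cubeMeasure ι).withDensity fun x =>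
      ENNReal.ofReal (g x + w' x)) _).trans ?_
    have h2 := (hK g w' hg hw'm hgc hg1 hw'c hw'd hw'i).trans (mul_le_mul_right hw'sq _)
    have h1 := hstep.trans (mul_le_mul_right hdiff _)
    refine (add_le_add (mul_le_mul_right h1 2) (mul_le_mul_right h2 2)).trans_eq ?_
    rw [← hK₁, ENNReal.ofReal]
    push_cast
    ring

end CubeInduction

/-- Chi-square control of the transport cost: densities bounded by `M` with respect to `η` are
at squared Wasserstein distance from `η` at most `K` times their squared `L²` distance to `1`. -/
def ChiSqTransport {E : Type*} [EMetricSpace E] [MeasurableSpace E] (K : ℝ≥0) (M : ℝ)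
    (η : Measure E) : Prop :=
  ∀ u : E → ℝ, Measurable u → (∀ x, 0 ≤ u x) → (∀ x, u x ≤ M) → ∫ x, u x ∂η = η.real univ →
    sqCost (η.withDensity fun x => ENNReal.ofReal (u x)) η ≤
      K * ∫⁻ x, ENNReal.ofReal ((u x - 1) ^ 2) ∂η

/-- A finite measure all of whose multiples by densities bounded above and below satisfy
`ChiSqTransport`, uniformly in the density. -/
def StableChiSqTransport {E : Type*} [EMetricSpace E] [MeasurableSpace E] (ω : Measure E) : Prop :=
  IsFiniteMeasure ω ∧ ∀ c M : ℝ, 0 < c → ∃ K : ℝ≥0, ∀ g : E → ℝ, Measurable g → (∀ x, c ≤ g x) →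
    (∀ x, g x ≤ 1) → ChiSqTransport K M (ω.withDensity fun x => ENNReal.ofReal (g x))

lemma ae_mem_Icc_cubeMeasure {ι : Type*} [Fintype ι] :
    ∀ᵐ x ∂cubeMeasure ι, x ∈ Icc (0 : ι → ℝ) 1 := by
  have h : ∀ i, ∀ᵐ x ∂cubeMeasure ι, x i ∈ Icc (0 : ℝ) 1 := fun i =>
    (measurePreserving_eval (fun _ : ι => unitMeasure) i).quasiMeasurePreserving.ae
      (ae_restrict_mem measurableSet_Icc)
  filter_upwards [ae_all_iff.2 h] with x hx
  exact ⟨fun i => (hx i).1, fun i => (hx i).2⟩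

lemma edist_le_one_of_mem_cube {ι : Type*} [Fintype ι] {x y : ι → ℝ} (hx : x ∈ Icc (0 : ι → ℝ) 1)
    (hy : y ∈ Icc (0 : ι → ℝ) 1) : edist x y ≤ 1 := by
  rw [edist_pi_le_iff]
  intro i
  rw [edist_dist, Real.dist_eq, ENNReal.ofReal_le_one, abs_le]
  constructor <;> linarith [hx.1 i, hx.2 i, hy.1 i, hy.2 i, Pi.zero_apply (M := fun _ : ι => ℝ) i,
    Pi.one_apply (M := fun _ : ι => ℝ) i]

lemma lintegral_withDensity_ofReal_eq {X : Type*} [MeasurableSpace X] (ω : Measure X) {g f : X → ℝ}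
    (hg : Measurable g) (hf : Measurable f) (hg0 : ∀ x, 0 ≤ g x) :
    ∫⁻ x, ENNReal.ofReal (f x) ∂(ω.withDensity fun x => ENNReal.ofReal (g x)) =
      ∫⁻ x, ENNReal.ofReal (g x * f x) ∂ω := by
  rw [lintegral_withDensity_eq_lintegral_mul _ hg.ennreal_ofReal hf.ennreal_ofReal]
  refine lintegral_congr fun x => ?_
  rw [Pi.mul_apply, ENNReal.ofReal_mul (hg0 x)]

lemma stableChiSqTransport_cubeMeasure (ι : Type*) [Fintype ι] :
    StableChiSqTransport (cubeMeasure ι) := by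
  refine ⟨inferInstance, fun c M hc => ?_⟩
  obtain ⟨K, hK⟩ := exists_sqCost_cube_le (Finset.univ : Finset ι) hc
  set εr : ℝ := c / (2 * (|M| + 1)) with hεr
  have hM1 : 0 < |M| + 1 := by positivity
  have hεpos : 0 < εr := by positivity
  set ε : ℝ≥0 := εr.toNNReal with hε
  have hε0 : ε ≠ 0 := by simpa [hε] using hεpos
  have hεc : (ε : ℝ) = εr := Real.coe_toNNReal _ hεpos.le
  refine ⟨(ε ^ 2)⁻¹ * (1 + ε⁻¹) * (K * ε ^ 2), fun g hg hgc hg1 u hu hu0 huM hui => ?_⟩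
  set lam := cubeMeasure ι
  set η := lam.withDensity fun x => ENNReal.ofReal (g x) with hη
  have hc1 : c ≤ 1 := (hgc 0).trans (hg1 0)
  have hM0 : 0 ≤ M := (hu0 0).trans (huM 0)
  rw [abs_of_nonneg hM0] at hεr hM1
  have hε1 : εr ≤ 1 := by
    rw [hεr, div_le_one (by positivity)]
    linarith
  have hg0 : ∀ x, 0 ≤ g x := fun x => hc.le.trans (hgc x)
  have hgi : Integrable g lam := Integrable.of_bound hg.aestronglyMeasurable 1
    (Filter.Eventually.of_forall fun x => by
      rw [Real.norm_of_nonneg (hg0 x)]; exact hg1 x)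
  have hηfin : IsFiniteMeasure η := isFiniteMeasure_withDensity_ofReal hgi.2
  have hui' : Integrable u η := Integrable.of_bound hu.aestronglyMeasurable M
    (Filter.Eventually.of_forall fun x => by
      rw [Real.norm_of_nonneg (hu0 x)]; exact huM x)
  have hufin : IsFiniteMeasure (η.withDensity fun x => ENNReal.ofReal (u x)) :=
    isFiniteMeasure_withDensity_ofReal hui'.2
  have hac : ∀ᵐ x ∂η, x ∈ Icc (0 : ι → ℝ) 1 :=
    (withDensity_absolutelyContinuous _ _).ae_le ae_mem_Icc_cubeMeasure
  have hac' : ∀ᵐ x ∂(η.withDensity fun x => ENNReal.ofReal (u x)), x ∈ Icc (0 : ι → ℝ) 1 :=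
    (withDensity_absolutelyContinuous _ _).ae_le hac
  have hmass : (η.withDensity fun x => ENNReal.ofReal (u x)) univ = η univ := by
    rw [withDensity_apply _ MeasurableSet.univ, setLIntegral_univ,
      ← ofReal_integral_eq_lintegral_ofReal hui' (Filter.Eventually.of_forall hu0), hui,
      measureReal_def, ENNReal.ofReal_toReal (measure_ne_top _ _)]
  have hfin : sqCost (η.withDensity fun x => ENNReal.ofReal (u x)) η ≠ ⊤ := by
    refine ne_top_of_le_ne_top ?_ (sqCost_le_of_bounded hmass hac' hac
      fun x hx y hy => edist_le_one_of_mem_cube hx hy)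
    exact ENNReal.mul_ne_top (by simp) (measure_ne_top _ _)
  have hεle : ε ≤ 1 := by
    rw [← NNReal.coe_le_coe, hεc]
    exact hε1
  have haε : (1 - ε) + ε = 1 := tsub_add_cancel_of_le hεle
  refine (sqCost_le_mul_sqCost_midpoint hε0 haε _ _ hfin).trans ?_
  set w : (ι → ℝ) → ℝ := fun x => εr * ((u x - 1) * g x) with hw
  have hwm : Measurable w := ((hu.sub_const 1).mul hg).const_mul _
  have hmid : (1 - ε) • η + ε • (η.withDensity fun x => ENNReal.ofReal (u x)) =
      lam.withDensity fun x => ENNReal.ofReal (g x + w x) := by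
    change ((1 - ε : ℝ≥0) : ℝ≥0∞) • η + (ε : ℝ≥0∞) • _ = _
    rw [hη, ← withDensity_mul _ hg.ennreal_ofReal hu.ennreal_ofReal,
      ← withDensity_smul _ hg.ennreal_ofReal,
      ← withDensity_smul _ (hg.ennreal_ofReal.mul hu.ennreal_ofReal),
      ← withDensity_add_left (hg.ennreal_ofReal.const_smul _)]
    congr 1
    ext x
    have e1 : ((1 - ε : ℝ≥0) : ℝ≥0∞) = ENNReal.ofReal (1 - εr) := by
      rw [ENNReal.ofReal, ENNReal.coe_inj, ← NNReal.coe_inj, NNReal.coe_sub hεle, hεc,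
        Real.coe_toNNReal _ (by linarith), NNReal.coe_one]
    have e2 : (ε : ℝ≥0∞) = ENNReal.ofReal εr := rfl
    simp only [Pi.add_apply, Pi.smul_apply, Pi.mul_apply, smul_eq_mul]
    rw [e1, e2, ← ENNReal.ofReal_mul (hg0 x), ← ENNReal.ofReal_mul (by linarith),
      ← ENNReal.ofReal_mul hεpos.le, ← ENNReal.ofReal_add
        (mul_nonneg (by linarith) (hg0 x)) (mul_nonneg hεpos.le (mul_nonneg (hg0 x) (hu0 x)))]
    congr 1
    simp only [hw]
    ring
  have hwc : ∀ x, |w x| ≤ c / 2 := by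
    intro x
    have h1 : |u x - 1| ≤ M + 1 := by
      rw [abs_le]
      constructor <;> linarith [hu0 x, huM x]
    have h2 : εr * (M + 1) = c / 2 := by
      rw [hεr]
      field_simp
    simp only [hw]
    rw [abs_mul, abs_mul, abs_of_pos hεpos, abs_of_nonneg (hg0 x), ← h2]
    gcongr
    calc |u x - 1| * g x ≤ (M + 1) * 1 := mul_le_mul h1 (hg1 x) (hg0 x) hM1.le
      _ = M + 1 := mul_one _
  have hwi : ∫ x, w x ∂lam = 0 := by
    have h1 : ∫ x, (u x - 1) ∂η = 0 := by
      rw [integral_sub hui' (integrable_const _), hui]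
      simp
    have h2 : ∫ x, (u x - 1) ∂η = ∫ x, g x * (u x - 1) ∂lam := by
      rw [hη, integral_withDensity_eq_integral_toReal_smul hg.ennreal_ofReal
        (Filter.Eventually.of_forall fun x => ENNReal.ofReal_lt_top)]
      simp only [smul_eq_mul, ENNReal.toReal_ofReal (hg0 _)]
    simp only [hw]
    rw [integral_const_mul]
    simp only [mul_comm _ (g _)]
    rw [← h2, h1, mul_zero]
  rw [hmid]
  have hmain := hK g w hg hwm hgc hg1 hwc (by simpa using dependsOn_univ w) hwi
  have hsq : ∫⁻ x, ENNReal.ofReal (w x ^ 2) ∂lam ≤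
      ε ^ 2 * ∫⁻ x, ENNReal.ofReal ((u x - 1) ^ 2) ∂η := by
    rw [hη, lintegral_withDensity_ofReal_eq lam hg ((hu.sub_const 1).pow_const 2) hg0,
      ← lintegral_const_mul' _ _ (by simp)]
    refine lintegral_mono fun x => ?_
    rw [show (ε : ℝ≥0∞) = ENNReal.ofReal εr from rfl, ← ENNReal.ofReal_pow hεpos.le,
      ← ENNReal.ofReal_mul (by positivity)]
    refine ENNReal.ofReal_le_ofReal ?_
    simp only [hw]
    rw [mul_pow, mul_pow]
    have h1 : g x ^ 2 ≤ g x := by nlinarith [hg0 x, hg1 x]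
    have h2 := mul_le_mul_of_nonneg_left h1 (sq_nonneg (u x - 1))
    have := mul_le_mul_of_nonneg_left h2 (sq_nonneg εr)
    linarith
  calc (((ε ^ 2)⁻¹ * (1 + ε⁻¹) : ℝ≥0) : ℝ≥0∞) * sqCost _ η
      ≤ ((ε ^ 2)⁻¹ * (1 + ε⁻¹) : ℝ≥0) * (K * (ε ^ 2 * ∫⁻ x, ENNReal.ofReal ((u x - 1) ^ 2) ∂η)) :=
        mul_le_mul_right (hmain.trans (mul_le_mul_right hsq _)) _
    _ = _ := by push_cast; ring

section Closure

variable {E X : Type*} [EMetricSpace E] [MeasurableSpace E] [BorelSpace E]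
  [SecondCountableTopology E] [EMetricSpace X] [MeasurableSpace X]

lemma map_withDensity_comp {E X : Type*} [MeasurableSpace E] [MeasurableSpace X]
    {Φ : X → E} (hΦ : Measurable Φ) (η : Measure X) {f : E → ℝ≥0∞}
    (hf : Measurable f) :
    (η.withDensity fun x => f (Φ x)).map Φ = (η.map Φ).withDensity f := by
  refine Measure.ext_of_lintegral _ fun h hh => ?_
  have h1 : Measurable fun x => f (Φ x) := hf.comp hΦ
  have h2 : Measurable fun x => h (Φ x) := hh.comp hΦ
  rw [lintegral_map hh hΦ, lintegral_withDensity_eq_lintegral_mul _ h1 h2,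
    lintegral_withDensity_eq_lintegral_mul _ hf hh, lintegral_map (hf.mul hh) hΦ]
  rfl

lemma ChiSqTransport.map [BorelSpace X] {K : ℝ≥0} {M : ℝ} {η : Measure X} (h : ChiSqTransport K M η)
    {Φ : X → E} {L : ℝ≥0} (hL : L ≠ 0) (hΦ : LipschitzWith L Φ) :
    ChiSqTransport (L ^ 2 * K) M (η.map Φ) := by
  intro u hu hu0 huM hui
  have hm : Measurable Φ := hΦ.continuous.measurable
  rw [← map_withDensity_comp hm η hu.ennreal_ofReal]
  refine (sqCost_map_le hL hΦ _ _).trans ?_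
  rw [lintegral_map ((hu.sub_const 1).pow_const 2).ennreal_ofReal hm, ENNReal.coe_mul, mul_assoc]
  refine mul_le_mul_right (h _ (hu.comp hm) (fun x => hu0 _) (fun x => huM _) ?_) _
  rw [integral_map hm.aemeasurable hu.aestronglyMeasurable] at hui
  refine hui.trans ?_
  rw [measureReal_def, measureReal_def, Measure.map_apply hm MeasurableSet.univ, preimage_univ]
lemma ChiSqTransport.smul {K : ℝ≥0} {M : ℝ} {η : Measure X} (h : ChiSqTransport K M η)
    {a : ℝ≥0} (ha : a ≠ 0) : ChiSqTransport K M (a • η) := by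
  intro u hu hu0 huM hui
  have h1 : ∫ x, u x ∂η = η.real univ := by
    rw [integral_smul_nnreal_measure, measureReal_nnreal_smul_apply, NNReal.smul_def,
      smul_eq_mul] at hui
    exact mul_left_cancel₀ (by exact_mod_cast ha) hui
  have h2 : (a • η).withDensity (fun x => ENNReal.ofReal (u x)) =
      a • η.withDensity fun x => ENNReal.ofReal (u x) := withDensity_smul_measure (a : ℝ≥0∞) _
  rw [h2]
  refine (sqCost_smul_le _ _ _).trans ((mul_le_mul_right (h u hu hu0 huM h1) _).trans_eq ?_)
  rw [show ∫⁻ x, ENNReal.ofReal ((u x - 1) ^ 2) ∂(a • η) =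
    (a : ℝ≥0∞) * ∫⁻ x, ENNReal.ofReal ((u x - 1) ^ 2) ∂η from lintegral_smul_measure _ _]
  ring

lemma StableChiSqTransport.map [BorelSpace X] {ω : Measure X} (h : StableChiSqTransport ω)
    {Φ : X → E} {L : ℝ≥0} (hL : L ≠ 0) (hΦ : LipschitzWith L Φ) :
    StableChiSqTransport (ω.map Φ) := by
  have hm : Measurable Φ := hΦ.continuous.measurable
  have := h.1
  refine ⟨inferInstance, fun c M hc => ?_⟩
  obtain ⟨K, hK⟩ := h.2 c M hc
  refine ⟨L ^ 2 * K, fun g hg hgc hg1 => ?_⟩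
  rw [← map_withDensity_comp hm ω hg.ennreal_ofReal]
  exact (hK _ (hg.comp hm) (fun x => hgc _) fun x => hg1 _).map hL hΦ

lemma StableChiSqTransport.exists_forall_of_le {ω : Measure X} (h : StableChiSqTransport ω)
    {a b : ℝ≥0} (ha : a ≠ 0) (hab : a ≤ b) (M : ℝ) :
    ∃ K : ℝ≥0, ∀ ω' : Measure X, a • ω ≤ ω' → ω' ≤ b • ω → ChiSqTransport K M ω' := by
  have hb : b ≠ 0 := (lt_of_lt_of_le (pos_iff_ne_zero.2 ha) hab).ne'
  have hb' : (0 : ℝ) < b := by exact_mod_cast pos_iff_ne_zero.2 hb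
  have := h.1
  obtain ⟨K, hK⟩ := h.2 (a / b) M (by positivity)
  refine ⟨K, fun ω' h1 h2 => ?_⟩
  have hfin : IsFiniteMeasure ω' := ⟨(h2 univ).trans_lt (measure_lt_top _ _)⟩
  have hac : ω' ≪ ω := Measure.absolutelyContinuous_of_le_smul (c := (b : ℝ≥0∞)) h2
  set ρ := ω'.rnDeriv ω with hρ
  have hρm : Measurable ρ := Measure.measurable_rnDeriv _ _
  have hρω : ω.withDensity ρ = ω' := Measure.withDensity_rnDeriv_eq _ _ hac
  have hle : ∀ᵐ x ∂ω, ρ x ≤ b := by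
    refine ae_le_of_forall_setLIntegral_le_of_sigmaFinite hρm fun s hs _ => ?_
    rw [← withDensity_apply _ hs, hρω, setLIntegral_const]
    exact h2 s
  have hge : ∀ᵐ x ∂ω, (a : ℝ≥0∞) ≤ ρ x := by
    refine ae_le_of_forall_setLIntegral_le_of_sigmaFinite measurable_const fun s hs _ => ?_
    rw [← withDensity_apply ρ hs, hρω, setLIntegral_const]
    exact h1 s
  set g : X → ℝ := fun x => max (a / b) (min 1 ((ρ x).toReal / b)) with hg
  have hgm : Measurable g :=
    measurable_const.max (measurable_const.min (hρm.ennreal_toReal.div_const _))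
  have hab' : (a : ℝ) / b ≤ 1 := (div_le_one hb').2 (by exact_mod_cast hab)
  have key : ω' = b • ω.withDensity fun x => ENNReal.ofReal (g x) := by
    change ω' = (b : ℝ≥0∞) • _
    rw [← withDensity_smul _ hgm.ennreal_ofReal, ← hρω]
    refine withDensity_congr_ae ?_
    filter_upwards [hle, hge] with x hx1 hx2
    have hx : ρ x ≠ ⊤ := ne_top_of_le_ne_top (by simp) hx1
    have h1' : (ρ x).toReal ≤ b := ENNReal.toReal_le_of_le_ofReal hb'.le (by simpa using hx1)
    have h2' : (a : ℝ) ≤ (ρ x).toReal := by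
      rw [← ENNReal.coe_toReal]
      exact ENNReal.toReal_mono hx hx2
    have h3 : g x = (ρ x).toReal / b := by
      simp only [hg]
      rw [min_eq_right ((div_le_one hb').2 h1'), max_eq_right]
      gcongr
    rw [Pi.smul_apply, smul_eq_mul, h3, ← ENNReal.ofReal_coe_nnreal, ← ENNReal.ofReal_mul hb'.le,
      mul_div_cancel₀ _ hb'.ne', ENNReal.ofReal_toReal hx]
  rw [key]
  exact (hK g hgm (fun x => le_max_left _ _)
    (fun x => max_le hab' (min_le_left _ _))).smul hb

end Closure

lemma exists_lipschitzWith_gauge {E : Type*} [NormedAddCommGroup E] [NormedSpace ℝ E]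
    (p q : Seminorm ℝ E) {c m : ℝ} (hc : 0 ≤ c) (hm : 0 < m) (hp : ∀ x, p x ≤ c * ‖x‖)
    (hq : ∀ x, q x ≤ c * ‖x‖) (hqm : ∀ x, m * ‖x‖ ≤ q x) :
    ∃ K : ℝ≥0, LipschitzWith K fun x => (p x / q x) • x := by
  have hlip : ∀ s : Seminorm ℝ E, (∀ x, s x ≤ c * ‖x‖) → ∀ x y, |s x - s y| ≤ c * ‖x - y‖ :=
    fun s hs x y => (abs_sub_map_le_sub s x y).trans (hs _)
  have hpos : ∀ x, x ≠ 0 → 0 < q x := fun x hx =>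
    (mul_pos hm (norm_pos_iff.2 hx)).trans_le (hqm x)
  have hcm : 0 ≤ c / m := by positivity
  have hrat : ∀ x, p x / q x ≤ c / m := by
    intro x
    rcases eq_or_ne x 0 with rfl | hx
    · simpa using hcm
    rw [div_le_div_iff₀ (hpos x hx) hm]
    nlinarith [hp x, hqm x]
  have hrat0 : ∀ x, 0 ≤ p x / q x := fun x => div_nonneg (apply_nonneg p x) (apply_nonneg q x)
  have hsecond : ∀ x y, |p x / q x - p y / q y| * ‖y‖ ≤
      (c / m + c / m * (c / m)) * ‖x - y‖ := by
    intro x y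
    rcases eq_or_ne y 0 with rfl | hy
    · simp; positivity
    have hy' : ‖y‖ ≤ q y / m := by rw [le_div_iff₀ hm]; linarith [hqm y]
    have hqy := hpos y hy
    rcases eq_or_ne x 0 with rfl | hx
    · have : |p 0 / q 0 - p y / q y| = p y / q y := by
        simp [abs_of_nonneg (hrat0 y)]
      rw [this, zero_sub, norm_neg]
      refine mul_le_mul_of_nonneg_right ((hrat y).trans ?_) (norm_nonneg _)
      nlinarith
    have hqx := hpos x hx
    have h1 : p x / q x - p y / q y = ((p x - p y) + p x / q x * (q y - q x)) / q y := by
      field_simp; ring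
    have h2 : |(p x - p y) + p x / q x * (q y - q x)| ≤ (c + c / m * c) * ‖x - y‖ := by
      refine (abs_add_le _ _).trans ?_
      rw [abs_mul, abs_of_nonneg (hrat0 x), abs_sub_comm (q y)]
      have h3 := mul_le_mul (hrat x) (hlip q hq x y) (abs_nonneg _) hcm
      linarith [hlip p hp x y]
    rw [h1, abs_div, abs_of_pos hqy]
    calc |(p x - p y) + p x / q x * (q y - q x)| / q y * ‖y‖
        ≤ (c + c / m * c) * ‖x - y‖ / q y * (q y / m) := by gcongr
      _ = (c / m + c / m * (c / m)) * ‖x - y‖ := by field_simp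
  refine ⟨Real.toNNReal (c / m + (c / m + c / m * (c / m))),
    LipschitzWith.of_dist_le' fun x y => ?_⟩
  rw [dist_eq_norm, dist_eq_norm]
  have h1 : (p x / q x) • x - (p y / q y) • y =
      (p x / q x) • (x - y) + (p x / q x - p y / q y) • y := by
    rw [smul_sub, sub_smul]; abel
  rw [h1, add_mul]
  refine (norm_add_le _ _).trans (add_le_add ?_ ?_)
  · rw [norm_smul, Real.norm_of_nonneg (hrat0 x)]
    exact mul_le_mul_of_nonneg_right (hrat x) (norm_nonneg _)
  · rw [norm_smul, Real.norm_eq_abs]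
    exact hsecond x y

lemma exists_addHaar_preimage_le {E : Type*} [NormedAddCommGroup E] [NormedSpace ℝ E]
    [FiniteDimensional ℝ E] [MeasurableSpace E] [BorelSpace E] (μ : Measure E) [μ.IsAddHaarMeasure]
    {f g : E → E} {K : ℝ≥0} (hg : LipschitzWith K g) (hgf : ∀ x, g (f x) = x)
    (hfg : ∀ x, f (g x) = x) :
    ∃ C : ℝ≥0, C ≠ 0 ∧ ∀ s, μ (f ⁻¹' s) ≤ C * μ s := by
  obtain ⟨c, hc⟩ : ∃ c : ℝ≥0, μ = c • (μH[(Module.finrank ℝ E : ℝ)] : Measure E) :=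
    ⟨_, Measure.isAddLeftInvariant_eq_smul μ _⟩
  refine ⟨K ^ Module.finrank ℝ E + 1, by positivity, fun s => ?_⟩
  have h1 : f ⁻¹' s = g '' s := by
    ext x
    exact ⟨fun hx => ⟨f x, hx, hgf x⟩, by rintro ⟨y, hy, rfl⟩; simpa [hfg] using hy⟩
  have h2 := hg.hausdorffMeasure_image_le (d := Module.finrank ℝ E) (by positivity) s
  rw [ENNReal.rpow_natCast] at h2
  rw [h1, hc, Measure.smul_apply, Measure.smul_apply, ENNReal.smul_def, ENNReal.smul_def,
    smul_eq_mul, smul_eq_mul, mul_left_comm]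
  refine mul_le_mul_right (h2.trans ?_) _
  gcongr
  push_cast
  exact le_self_add

lemma exists_map_addHaar_comparable {E : Type*} [NormedAddCommGroup E] [NormedSpace ℝ E]
    [FiniteDimensional ℝ E] [MeasurableSpace E] [BorelSpace E] (μ : Measure E) [μ.IsAddHaarMeasure]
    {f g : E → E} {Kf Kg : ℝ≥0} (hf : LipschitzWith Kf f) (hg : LipschitzWith Kg g)
    (hgf : ∀ x, g (f x) = x) (hfg : ∀ x, f (g x) = x) :
    ∃ C : ℝ≥0, C ≠ 0 ∧ μ.map f ≤ C • μ ∧ μ ≤ C • μ.map f := by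
  obtain ⟨C₁, h₁, h₁'⟩ := exists_addHaar_preimage_le μ hg hgf hfg
  obtain ⟨C₂, h₂, h₂'⟩ := exists_addHaar_preimage_le μ hf hfg hgf
  refine ⟨C₁ + C₂, by positivity, Measure.le_iff.2 fun s hs => ?_, Measure.le_iff.2 fun s hs => ?_⟩
  · rw [Measure.map_apply hf.continuous.measurable hs]
    refine (h₁' s).trans (mul_le_mul_left ?_ _)
    push_cast; exact le_self_add
  · have := h₂' (f ⁻¹' s)
    rw [← preimage_comp, show f ∘ g = id from funext hfg, preimage_id] at this
    refine this.trans ?_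
    rw [← Measure.map_apply hf.continuous.measurable hs]
    refine mul_le_mul_left ?_ _
    push_cast; exact le_add_self
lemma gauge_gauge {E : Type*} [AddCommGroup E] [Module ℝ E] (p q : Seminorm ℝ E)
    (hp : ∀ x, x ≠ 0 → p x ≠ 0) (hq : ∀ x, x ≠ 0 → q x ≠ 0) (x : E) :
    (q ((p x / q x) • x) / p ((p x / q x) • x)) • (p x / q x) • x = x := by
  rcases eq_or_ne x 0 with rfl | hx
  · simp
  have h1 : 0 ≤ p x / q x := div_nonneg (apply_nonneg p x) (apply_nonneg q x)
  have h2 := hp x hx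
  have h3 := hq x hx
  rw [map_smul_eq_mul, map_smul_eq_mul, smul_smul, Real.norm_of_nonneg h1,
    show p x / q x * q x / (p x / q x * p x) * (p x / q x) = 1 by field_simp, one_smul]

lemma exists_map_cubeMeasure_comparable (ι : Type*) [Fintype ι] (q : Seminorm ℝ (ι → ℝ)) {c m : ℝ}
    (hc : 1 ≤ c) (hm : 0 < m) (hq : ∀ x, q x ≤ c * ‖x‖) (hqm : ∀ x, m * ‖x‖ ≤ q x) :
    ∃ (Φ : (ι → ℝ) → ι → ℝ) (K C : ℝ≥0), K ≠ 0 ∧ C ≠ 0 ∧ LipschitzWith K Φ ∧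
      (cubeMeasure ι).map Φ ≤ C • volume.restrict {x | q x ≤ 1} ∧
      volume.restrict {x | q x ≤ 1} ≤ C • (cubeMeasure ι).map Φ := by
  set p : Seminorm ℝ (ι → ℝ) := normSeminorm ℝ (ι → ℝ) with hpdef
  have hpn : ∀ x, p x = ‖x‖ := fun x => rfl
  have hc0 : 0 ≤ c := by linarith
  have hpc : ∀ x, p x ≤ c * ‖x‖ := fun x => le_mul_of_one_le_left (norm_nonneg x) hc
  have hp0 : ∀ x, x ≠ 0 → p x ≠ 0 := fun x hx => norm_ne_zero_iff.2 hx
  have hq0 : ∀ x, x ≠ 0 → q x ≠ 0 := fun x hx =>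
    ((mul_pos hm (norm_pos_iff.2 hx)).trans_le (hqm x)).ne'
  obtain ⟨K₁, h₁⟩ := exists_lipschitzWith_gauge p q hc0 hm hpc hq hqm
  obtain ⟨K₂, h₂⟩ := exists_lipschitzWith_gauge q p hc0 one_pos hq hpc fun x => (one_mul _).le
  have h₃ : LipschitzWith 2 fun x : ι → ℝ => (2 : ℝ) • x - 1 :=
    LipschitzWith.of_dist_le_mul fun x y => by
      rw [dist_sub_right, dist_smul₀]; simp
  have h₄ : LipschitzWith 1 fun x : ι → ℝ => (2⁻¹ : ℝ) • (x + 1) :=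
    LipschitzWith.of_dist_le_mul fun x y => by
      rw [dist_smul₀, dist_add_right]; norm_num
      linarith [dist_nonneg (x := x) (y := y)]
  have hf := h₁.comp h₃
  have hg := h₄.comp h₂
  obtain ⟨C, hC, hC₁, hC₂⟩ := exists_map_addHaar_comparable (volume : Measure (ι → ℝ)) hf hg
    (fun x => by
      simp only [Function.comp]
      rw [gauge_gauge p q hp0 hq0]
      simp)
    (fun x => by
      simp only [Function.comp]
      rw [smul_inv_smul₀ two_ne_zero, add_sub_cancel_right, gauge_gauge q p hq0 hp0])
  set Φ : (ι → ℝ) → ι → ℝ :=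
    (fun x => (p x / q x) • x) ∘ fun x : ι → ℝ => (2 : ℝ) • x - 1 with hΦ
  have hqc : Continuous q := (LipschitzWith.of_dist_le' (K := c) fun x y => by
    rw [Real.dist_eq, dist_eq_norm]
    exact (abs_sub_map_le_sub q x y).trans (hq _)).continuous
  have hD : MeasurableSet {x | q x ≤ 1} := measurableSet_le hqc.measurable measurable_const
  have hpre : Φ ⁻¹' {x | q x ≤ 1} = Icc 0 1 := by
    ext x
    have h5 : q (Φ x) = ‖(2 : ℝ) • x - 1‖ := by
      simp only [hΦ, Function.comp]
      rw [map_smul_eq_mul, Real.norm_of_nonneg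
        (div_nonneg (apply_nonneg p _) (apply_nonneg q _)), ← hpn]
      rcases eq_or_ne ((2 : ℝ) • x - 1) 0 with h0 | h0
      · simp [h0]
      · exact div_mul_cancel₀ _ (hq0 _ h0)
    rw [mem_preimage, mem_ofPred_eq, h5, pi_norm_le_iff_of_nonneg zero_le_one, mem_Icc,
      Pi.le_def, Pi.le_def, ← forall_and]
    refine forall_congr' fun i => ?_
    simp only [Pi.sub_apply, Pi.smul_apply, Pi.one_apply, smul_eq_mul, Real.norm_eq_abs, abs_le,
      Pi.zero_apply]
    constructor <;> rintro ⟨h, h'⟩ <;> constructor <;> linarith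
  have hcube : cubeMeasure ι = volume.restrict (Icc (0 : ι → ℝ) 1) := by
    rw [← pi_univ_Icc, volume_pi, Measure.restrict_pi_pi]
    rfl
  have hres : (cubeMeasure ι).map Φ = (volume.map Φ).restrict {x | q x ≤ 1} := by
    rw [Measure.restrict_map hf.continuous.measurable hD, hpre, hcube]
  refine ⟨Φ, K₁ * 2 + 1, C, by positivity, hC, hf.weaken le_self_add, ?_, ?_⟩
  · rw [hres, ← Measure.restrict_smul]
    exact Measure.restrict_mono le_rfl hC₁
  · rw [hres, ← Measure.restrict_smul]
    exact Measure.restrict_mono le_rfl hC₂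

/-- The weight `(1 - ‖z‖)₊²`, which models a bump vanishing quadratically at the boundary of the
unit ball. -/
def ballWeight {E : Type*} [NormedAddCommGroup E] (z : E) : ℝ := max 0 (1 - ‖z‖) ^ 2

lemma continuous_ballWeight {E : Type*} [NormedAddCommGroup E] :
    Continuous (ballWeight : E → ℝ) := by
  unfold ballWeight; fun_prop

lemma map_restrict_volume_eq_withDensity_ballWeight (n : ℕ) :
    ((volume : Measure (Fin n ⊕ Fin 2 → ℝ)).restrict
      {x | ‖WithLp.toLp 2 fun i => x (Sum.inl i)‖ + ‖fun j => x (Sum.inr j)‖ ≤ 1}).map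
        (fun x => WithLp.toLp 2 fun i => x (Sum.inl i)) =
      (volume : Measure (EuclideanSpace ℝ (Fin n))).withDensity
        fun z => 4 * ENNReal.ofReal (ballWeight z) := by
  have hT : Measurable fun x : Fin n ⊕ Fin 2 → ℝ =>
      (WithLp.toLp 2 fun i => x (Sum.inl i) : EuclideanSpace ℝ (Fin n)) := by fun_prop
  ext s hs
  rw [Measure.map_apply hT hs, Measure.restrict_apply (hT hs), withDensity_apply _ hs]
  set D' : Set ((Fin n → ℝ) × (Fin 2 → ℝ)) :=
    {z | (WithLp.toLp 2 z.1 : EuclideanSpace ℝ (Fin n)) ∈ s ∧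
      ‖(WithLp.toLp 2 z.1 : EuclideanSpace ℝ (Fin n))‖ + ‖z.2‖ ≤ 1} with hD'
  have hT' : Measurable fun z : (Fin n → ℝ) × (Fin 2 → ℝ) =>
      (WithLp.toLp 2 z.1 : EuclideanSpace ℝ (Fin n)) := by fun_prop
  have hD'm : MeasurableSet D' :=
    (hT' hs).inter (measurableSet_le (hT'.norm.add measurable_snd.norm) measurable_const)
  have h1 := (volume_measurePreserving_sumPiEquivProdPi
    (fun _ : Fin n ⊕ Fin 2 => ℝ)).measure_preimage hD'm.nullMeasurableSet
  have h2 : (MeasurableEquiv.sumPiEquivProdPi fun _ : Fin n ⊕ Fin 2 => ℝ) ⁻¹' D' =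
      (fun x => WithLp.toLp 2 fun i => x (Sum.inl i)) ⁻¹' s ∩
        {x | ‖(WithLp.toLp 2 fun i => x (Sum.inl i) : EuclideanSpace ℝ (Fin n))‖ +
        ‖fun j => x (Sum.inr j)‖ ≤ 1} := rfl
  have hw : Measurable fun z : EuclideanSpace ℝ (Fin n) => 4 * ENNReal.ofReal (ballWeight z) :=
    measurable_const.mul continuous_ballWeight.measurable.ennreal_ofReal
  rw [← h2, h1, Measure.volume_eq_prod, Measure.prod_apply hD'm, ← lintegral_indicator hs,
    ← (PiLp.volume_preserving_toLp (Fin n)).lintegral_comp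
      (hw.indicator hs)]
  refine lintegral_congr fun x => ?_
  by_cases hx : (WithLp.toLp 2 x : EuclideanSpace ℝ (Fin n)) ∈ s
  · rw [indicator_of_mem hx]
    have h3 : Prod.mk x ⁻¹' D' =
        closedBall 0 (1 - ‖(WithLp.toLp 2 x : EuclideanSpace ℝ (Fin n))‖) := by
      ext y
      simp only [hD', mem_preimage, mem_ofPred_eq, hx, true_and, mem_closedBall, dist_zero_right]
      constructor <;> intro h <;> linarith
    rw [h3]
    unfold ballWeight
    rcases le_total 0 (1 - ‖(WithLp.toLp 2 x : EuclideanSpace ℝ (Fin n))‖) with h | h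
    · rw [Real.volume_pi_closedBall _ h, max_eq_right h, Fintype.card_fin, mul_pow,
        ENNReal.ofReal_mul (by norm_num)]
      norm_num
    · rw [max_eq_left h]
      simp only [ne_eq, OfNat.ofNat_ne_zero, not_false_eq_true, zero_pow, ofReal_zero, mul_zero]
      refine measure_mono_null (closedBall_subset_closedBall h) ?_
      rw [Real.volume_pi_closedBall _ le_rfl]
      simp
  · rw [indicator_of_notMem hx]
    have h3 : Prod.mk x ⁻¹' D' = ∅ := by
      ext y
      simp [hD', hx]
    rw [h3, measure_empty]

lemma exists_stableChiSqTransport_ballWeight (n : ℕ) :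
    ∃ (ω : Measure (EuclideanSpace ℝ (Fin n))) (C : ℝ≥0), StableChiSqTransport ω ∧ C ≠ 0 ∧
      ω ≤ C • (volume.withDensity fun z => 4 * ENNReal.ofReal (ballWeight z)) ∧
      (volume.withDensity fun z => 4 * ENNReal.ofReal (ballWeight z)) ≤ C • ω := by
  set T : (Fin n ⊕ Fin 2 → ℝ) →ₗ[ℝ] EuclideanSpace ℝ (Fin n) :=
    (WithLp.linearEquiv 2 ℝ (Fin n → ℝ)).symm.toLinearMap ∘ₗ LinearMap.funLeft ℝ ℝ Sum.inl with hT
  set S : (Fin n ⊕ Fin 2 → ℝ) →ₗ[ℝ] (Fin 2 → ℝ) := LinearMap.funLeft ℝ ℝ Sum.inr with hS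
  have hTx : ∀ x, T x = WithLp.toLp 2 fun i => x (Sum.inl i) := fun x => rfl
  set q : Seminorm ℝ (Fin n ⊕ Fin 2 → ℝ) := (normSeminorm ℝ _).comp T + (normSeminorm ℝ _).comp S
  have hqx : ∀ x, q x = ‖T x‖ + ‖S x‖ := fun x => rfl
  obtain ⟨K, hK⟩ : ∃ K : ℝ≥0, ∀ x, ‖T x‖ ≤ K * ‖x‖ := by
    refine ⟨(Fintype.card (Fin n) : ℝ≥0) ^ (1 / (2 : ℝ≥0∞)).toReal, fun x => ?_⟩
    have h1 := (PiLp.lipschitzWith_toLp 2 fun _ : Fin n => ℝ).dist_le_mul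
      (fun i => x (Sum.inl i)) 0
    rw [WithLp.toLp_zero, dist_zero_right, dist_zero_right] at h1
    refine (hTx x ▸ h1).trans (mul_le_mul_of_nonneg_left ?_ (NNReal.coe_nonneg _))
    exact (pi_norm_le_iff_of_nonneg (norm_nonneg x)).2 fun i => norm_le_pi_norm x _
  have hSn : ∀ x, ‖S x‖ ≤ ‖x‖ := fun x =>
    (pi_norm_le_iff_of_nonneg (norm_nonneg x)).2 fun i => norm_le_pi_norm x _
  have hq : ∀ x, q x ≤ (K + 1) * ‖x‖ := fun x => by
    rw [hqx, add_mul, one_mul]; exact add_le_add (hK x) (hSn x)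
  have hqm : ∀ x, 1 * ‖x‖ ≤ q x := fun x => by
    rw [hqx, one_mul, pi_norm_le_iff_of_nonneg (by positivity)]
    rintro (i | j)
    · have := PiLp.norm_apply_le (T x) i
      exact this.trans (le_add_of_nonneg_right (norm_nonneg _))
    · have := norm_le_pi_norm (S x) j
      exact this.trans (le_add_of_nonneg_left (norm_nonneg _))
  obtain ⟨Φ, KΦ, C, hKΦ, hC, hΦ, h1, h2⟩ := exists_map_cubeMeasure_comparable (Fin n ⊕ Fin 2) q
    (c := K + 1) (by simp) one_pos hq hqm
  have hTL : LipschitzWith (K + 1) T := LipschitzWith.of_dist_le_mul fun x y => by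
    rw [dist_eq_norm, dist_eq_norm, ← map_sub]
    refine (hK _).trans (mul_le_mul_of_nonneg_right ?_ (norm_nonneg _))
    simp
  have h3 := map_restrict_volume_eq_withDensity_ballWeight n
  have hTm : Measurable T := hTL.continuous.measurable
  refine ⟨((cubeMeasure (Fin n ⊕ Fin 2)).map Φ).map T, C,
    ((stableChiSqTransport_cubeMeasure _).map hKΦ hΦ).map (by positivity) hTL, hC, ?_, ?_⟩
  · rw [← h3, ← Measure.map_smul]
    exact Measure.map_mono h1 hTm
  · rw [← h3, ← Measure.map_smul]
    exact Measure.map_mono h2 hTm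

lemma exists_forall_chiSqTransport_ball (n : ℕ) {a b : ℝ} (ha : 0 < a) (M : ℝ) :
    ∃ K : ℝ≥0, ∀ h : EuclideanSpace ℝ (Fin n) → ℝ,
      (∀ z, a * ballWeight z ≤ h z) → (∀ z, h z ≤ b * ballWeight z) →
      ChiSqTransport K M (volume.withDensity fun z => ENNReal.ofReal (h z)) := by
  obtain ⟨ω, C, hω, hC, h1, h2⟩ := exists_stableChiSqTransport_ballWeight n
  lift a to ℝ≥0 using ha.le
  have ha' : a ≠ 0 := by simpa using ha.ne'
  have hw : Measurable fun z : EuclideanSpace ℝ (Fin n) => 4 * ENNReal.ofReal (ballWeight z) :=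
    measurable_const.mul continuous_ballWeight.measurable.ennreal_ofReal
  obtain ⟨K, hK⟩ := hω.exists_forall_of_le (a := C⁻¹ * (a / 4))
    (b := C⁻¹ * (a / 4) + b.toNNReal / 4 * C) (by positivity) le_self_add M
  have h4 : ∀ (c : ℝ≥0) (x : ℝ≥0∞), ((c / 4 : ℝ≥0) : ℝ≥0∞) * (4 * x) = c * x := fun c x => by
    rw [← mul_assoc]
    congr 1
    exact_mod_cast div_mul_cancel₀ c (four_ne_zero)
  refine ⟨K, fun h hah hhb => hK _ ?_ ?_⟩
  · calc (C⁻¹ * (a / 4)) • ω ≤ (C⁻¹ * (a / 4)) •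
        (C • (volume.withDensity fun z => 4 * ENNReal.ofReal (ballWeight z))) := by gcongr
      _ = (a / 4) • (volume.withDensity fun z => 4 * ENNReal.ofReal (ballWeight z)) := by
        rw [smul_smul]; congr 1; field_simp
      _ ≤ _ := by
        rw [show ((a / 4) • (volume.withDensity fun z : EuclideanSpace ℝ (Fin n) =>
            4 * ENNReal.ofReal (ballWeight z))) = volume.withDensity
            (((a / 4 : ℝ≥0) : ℝ≥0∞) • fun z => 4 * ENNReal.ofReal (ballWeight z)) from
          (withDensity_smul _ hw).symm]
        refine withDensity_mono (ae_of_all _ fun z => ?_)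
        rw [Pi.smul_apply, smul_eq_mul, h4, ← ENNReal.ofReal_coe_nnreal,
          ← ENNReal.ofReal_mul (NNReal.coe_nonneg a)]
        exact ENNReal.ofReal_le_ofReal (hah z)
  · calc volume.withDensity (fun z => ENNReal.ofReal (h z)) ≤
        (b.toNNReal / 4) • (volume.withDensity fun z => 4 * ENNReal.ofReal (ballWeight z)) := by
          rw [show ((b.toNNReal / 4) • (volume.withDensity fun z : EuclideanSpace ℝ (Fin n) =>
              4 * ENNReal.ofReal (ballWeight z))) = volume.withDensity
              (((b.toNNReal / 4 : ℝ≥0) : ℝ≥0∞) • fun z => 4 * ENNReal.ofReal (ballWeight z)) from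
            (withDensity_smul _ hw).symm]
          refine withDensity_mono (ae_of_all _ fun z => ?_)
          rw [Pi.smul_apply, smul_eq_mul, h4, ← ENNReal.ofReal_coe_nnreal,
            ← ENNReal.ofReal_mul (NNReal.coe_nonneg _)]
          refine ENNReal.ofReal_le_ofReal ((hhb z).trans ?_)
          exact mul_le_mul_of_nonneg_right (Real.le_coe_toNNReal b) (sq_nonneg _)
      _ ≤ (b.toNNReal / 4) • (C • ω) := by gcongr
      _ = (b.toNNReal / 4 * C) • ω := smul_smul _ _ _
      _ ≤ _ := by gcongr; exact le_add_self

namespace IsBump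

variable {d : ℕ} {c₂ : ℝ} {φ : EuclideanSpace ℝ (Fin d) → ℝ}

lemma continuous (h : IsBump c₂ φ) : Continuous φ := h.1.choose_spec.continuous

lemma nonneg (h : IsBump c₂ φ) (x) : 0 ≤ φ x := (h.2.2.1 x).1

lemma le_one (h : IsBump c₂ φ) (x) : φ x ≤ 1 := (h.2.2.1 x).2

lemma eq_one (h : IsBump c₂ φ) {x} (hx : ‖x‖ ≤ 2) : φ x = 1 := h.2.2.2.1 x hx

lemma eq_zero (h : IsBump c₂ φ) {x} (hx : 3 ≤ ‖x‖) : φ x = 0 := h.2.2.2.2.1 x hx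

lemma le_mul_sq (h : IsBump c₂ φ) (hc : 0 < c₂) (x) : φ x ≤ c₂ * max 0 (3 - ‖x‖) ^ 2 := by
  rcases lt_or_ge ‖x‖ 3 with hx | hx
  · rw [max_eq_right (by linarith)]
    exact (h.2.2.2.2.2.1 x hx).2
  · rw [h.eq_zero hx]; positivity

lemma mul_sq_le (h : IsBump c₂ φ) (x) : c₂⁻¹ * max 0 (3 - ‖x‖) ^ 2 ≤ φ x := by
  rcases lt_or_ge ‖x‖ 3 with hx | hx
  · rw [max_eq_right (by linarith)]
    exact (h.2.2.2.2.2.1 x hx).1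
  · rw [h.eq_zero hx, max_eq_left (by linarith)]; simp

lemma abs_deriv_profile_le (h : IsBump c₂ φ) (hc : 0 < c₂) {e : EuclideanSpace ℝ (Fin d)}
    (he : ‖e‖ = 1) {t : ℝ} (ht0 : 0 < t) (ht : t < 3) :
    |deriv (fun s : ℝ => φ (s • e)) t| ≤ c₂ * (3 - t) := by
  by_cases hd : DifferentiableAt ℝ (fun s : ℝ => φ (s • e)) t
  swap
  · rw [deriv_zero_of_not_differentiableAt hd, abs_zero]
    exact mul_nonneg hc.le (by linarith)
  have hnorm : ‖t • e‖ = t := by rw [norm_smul, he, mul_one, Real.norm_of_nonneg ht0.le]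
  have hne : t • e ≠ 0 := by rw [← norm_pos_iff, hnorm]; exact ht0
  have hφ : φ = (fun s : ℝ => φ (s • e)) ∘ fun x => ‖x‖ := by
    funext x
    exact h.2.1 _ _ (by rw [norm_smul, he, mul_one, norm_norm])
  have hdφ : DifferentiableAt ℝ φ (t • e) := by
    rw [hφ]
    refine DifferentiableAt.comp _ ?_ (differentiableAt_id.norm ℝ hne)
    simpa only [id, hnorm] using hd
  have h1 : deriv (fun s : ℝ => φ (s • e)) t = fderiv ℝ φ (t • e) e := by
    have h2 : HasDerivAt (fun s : ℝ => s • e) e t := by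
      simpa using (hasDerivAt_id t).smul_const e
    exact (hdφ.hasFDerivAt.comp_hasDerivAt t h2).deriv
  have h3 := h.2.2.2.2.2.2 (t • e) (by rw [hnorm]; exact ht) hdφ
  rw [hnorm] at h3
  rw [h1, ← Real.norm_eq_abs]
  refine ((fderiv ℝ φ (t • e)).le_opNorm e).trans ?_
  rwa [he, mul_one]

lemma abs_profile_sub_le (h : IsBump c₂ φ) (hc : 0 < c₂) {e : EuclideanSpace ℝ (Fin d)}
    (he : ‖e‖ = 1) {s t : ℝ} (hs : 0 ≤ s) (hst : s ≤ t) (ht : t ≤ 3) :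
    |φ (t • e) - φ (s • e)| ≤ c₂ * (3 - s) * (t - s) := by
  obtain ⟨K, hK⟩ := h.1
  have hlip : LipschitzWith (K * 1) fun s : ℝ => φ (s • e) := hK.comp
    (LipschitzWith.of_dist_le_mul fun a b => by
      rw [dist_eq_norm, ← sub_smul, norm_smul, he, Real.dist_eq, Real.norm_eq_abs]; simp)
  have h1 :=
    (hlip.lipschitzOnWith (s := uIcc s t)).absolutelyContinuousOnInterval.integral_deriv_eq_sub
  rw [← h1, ← Real.norm_eq_abs, ← abs_of_nonneg (sub_nonneg.2 hst)]
  refine intervalIntegral.norm_integral_le_of_norm_le_const_ae ?_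
  filter_upwards [Measure.ae_ne volume t] with x hx hx'
  rw [uIoc_of_le hst] at hx'
  have hxt : x < t := lt_of_le_of_ne hx'.2 hx
  refine (h.abs_deriv_profile_le hc he (by linarith [hx'.1]) (by linarith)).trans ?_
  gcongr
  exact hx'.1.le

lemma abs_sub_le_of_norm_le (h : IsBump c₂ φ) (hc : 0 < c₂) {x y : EuclideanSpace ℝ (Fin d)}
    (hxy : ‖x‖ ≤ ‖y‖) : |φ y - φ x| ≤ c₂ * max 0 (3 - ‖x‖) * (‖y‖ - ‖x‖) := by
  rcases eq_or_ne y 0 with rfl | hy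
  · have : x = 0 := by simpa using hxy
    simp [this]
  rcases le_total 3 ‖x‖ with hx | hx
  · rw [h.eq_zero hx, h.eq_zero (hx.trans hxy), max_eq_left (by linarith)]; simp
  set e : EuclideanSpace ℝ (Fin d) := ‖y‖⁻¹ • y with hedef
  have he : ‖e‖ = 1 := by
    rw [hedef, norm_smul, norm_inv, norm_norm, inv_mul_cancel₀ (norm_ne_zero_iff.2 hy)]
  have hx' : φ x = φ (‖x‖ • e) := h.2.1 _ _ (by rw [norm_smul, he, mul_one, norm_norm])
  have hy' : φ y = φ (min ‖y‖ 3 • e) := by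
    rcases le_total ‖y‖ 3 with h3 | h3
    · rw [min_eq_left h3]
      exact h.2.1 _ _ (by rw [norm_smul, he, mul_one, norm_norm])
    · rw [min_eq_right h3, h.eq_zero h3, h.eq_zero]
      rw [norm_smul, he]; norm_num
  rw [hx', hy', max_eq_right (by linarith)]
  refine (h.abs_profile_sub_le hc he (norm_nonneg x) (le_min hxy hx) (min_le_right _ _)).trans ?_
  have : 0 ≤ c₂ * (3 - ‖x‖) := mul_nonneg hc.le (by linarith)
  gcongr
  exact min_le_left _ _

lemma abs_sub_le (h : IsBump c₂ φ) (hc : 0 < c₂) (x y : EuclideanSpace ℝ (Fin d)) :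
    |φ x - φ y| ≤ c₂ * max 0 (3 - min ‖x‖ ‖y‖) * ‖x - y‖ := by
  have h0 : ∀ a : ℝ, 0 ≤ c₂ * max 0 a := fun a => mul_nonneg hc.le (le_max_left _ _)
  rcases le_total ‖x‖ ‖y‖ with hxy | hxy
  · rw [min_eq_left hxy, abs_sub_comm, norm_sub_rev]
    exact (h.abs_sub_le_of_norm_le hc hxy).trans
      (mul_le_mul_of_nonneg_left (norm_sub_norm_le _ _) (h0 _))
  · rw [min_eq_right hxy]
    exact (h.abs_sub_le_of_norm_le hc hxy).trans
      (mul_le_mul_of_nonneg_left (norm_sub_norm_le _ _) (h0 _))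

end IsBump

lemma AffineSubspace.exists_mem_forall_norm_add_sub_sq {V : Type*} [NormedAddCommGroup V]
    [InnerProductSpace ℝ V] [FiniteDimensional ℝ V] {L : AffineSubspace ℝ V}
    (hL : (L : Set V).Nonempty) (x : V) :
    ∃ p ∈ L, ∀ w ∈ L.direction, ‖p + w - x‖ ^ 2 = ‖w‖ ^ 2 + ‖p - x‖ ^ 2 := by
  obtain ⟨y, hy⟩ := hL
  refine ⟨L.direction.starProjection (x - y) + y, ?_, fun w hw => ?_⟩
  · exact AffineSubspace.vadd_mem_of_mem_direction (Submodule.starProjection_apply_mem _ _) hy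
  · have h1 : inner ℝ w (L.direction.starProjection (x - y) + y - x) = 0 := by
      have h2 := Submodule.starProjection_inner_eq_zero (K := L.direction) (x - y) w hw
      rw [real_inner_comm, ← neg_inj, neg_zero, ← inner_neg_left]
      rw [← h2]; congr 1; abel
    rw [show L.direction.starProjection (x - y) + y + w - x =
      w + (L.direction.starProjection (x - y) + y - x) by abel, norm_add_sq_real, h1]
    ring

lemma sub_sqrt_comparable {δ t : ℝ} (hδ : δ ^ 2 ≤ 1) (ht : 0 ≤ t) :
    max 0 (1 - t) ≤ max 0 (3 - √((9 - δ ^ 2) * t ^ 2 + δ ^ 2)) ∧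
      max 0 (3 - √((9 - δ ^ 2) * t ^ 2 + δ ^ 2)) ≤ 6 * max 0 (1 - t) := by
  set N := √((9 - δ ^ 2) * t ^ 2 + δ ^ 2) with hN
  have hN0 : 0 ≤ N := Real.sqrt_nonneg _
  have hN2 : N ^ 2 = (9 - δ ^ 2) * t ^ 2 + δ ^ 2 :=
    Real.sq_sqrt (by nlinarith [sq_nonneg t, sq_nonneg δ])
  have hδ0 := sq_nonneg δ
  rcases le_total t 1 with h | h
  · have h1 : 0 ≤ (9 - δ ^ 2) * (1 - t) := mul_nonneg (by linarith) (by linarith)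
    have hN3 : N ≤ 3 := by
      by_contra! h3
      nlinarith [mul_nonneg h1 (by linarith : 0 ≤ 1 + t)]
    rw [max_eq_right (by linarith), max_eq_right (by linarith)]
    constructor
    · nlinarith [mul_nonneg h1 ht, mul_nonneg (sub_nonneg.2 h) hδ0]
    · nlinarith [mul_nonneg h1 (sub_nonneg.2 h), mul_nonneg (sub_nonneg.2 h) hδ0,
        mul_nonneg (sub_nonneg.2 hN3) hN0]
  · have hN3 : 3 ≤ N := by
      by_contra! h3
      nlinarith [mul_nonneg (mul_nonneg (by linarith : 0 ≤ 9 - δ ^ 2) (sub_nonneg.2 h))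
        (by linarith : 0 ≤ 1 + t)]
    rw [max_eq_left (by linarith), max_eq_left (by linarith)]
    simp

lemma exists_flat_param {d n : ℕ} {L : AffineSubspace ℝ (EuclideanSpace ℝ (Fin d))}
    (hLn : Module.finrank ℝ L.direction = n) {p : EuclideanSpace ℝ (Fin d)} (hp : p ∈ L)
    {ρ : ℝ} (hρ : 0 < ρ) :
    ∃ (A : EuclideanSpace ℝ (Fin n) →ₗᵢ[ℝ] EuclideanSpace ℝ (Fin d)) (a : ℝ≥0), a ≠ 0 ∧
      (∀ z, A z ∈ L.direction) ∧
      (μH[(n : ℝ)]).restrict (L : Set (EuclideanSpace ℝ (Fin d))) =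
        a • (volume : Measure (EuclideanSpace ℝ (Fin n))).map fun z => p + ρ • A z := by
  set A₀ := ((stdOrthonormalBasis ℝ L.direction).reindex (finCongr hLn)).repr.symm with hA₀
  set A : EuclideanSpace ℝ (Fin n) →ₗᵢ[ℝ] EuclideanSpace ℝ (Fin d) :=
    L.direction.subtypeₗᵢ.comp A₀.toLinearIsometry with hA
  have hAx : ∀ z, A z = (A₀ z : EuclideanSpace ℝ (Fin d)) := fun z => rfl
  have hmem : ∀ z, A z ∈ L.direction := fun z => (A₀ z).2
  have hI : Isometry fun z => p + A z := (IsometryEquiv.addLeft p).isometry.comp A.isometry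
  have hrange : range (fun z => p + A z) = L := by
    ext y
    constructor
    · rintro ⟨z, rfl⟩
      rw [show (fun z => p + A z) z = A z + p from add_comm _ _]
      exact AffineSubspace.vadd_mem_of_mem_direction (hmem z) hp
    · intro hy
      have hd : y - p ∈ L.direction := AffineSubspace.vsub_mem_direction hy hp
      refine ⟨A₀.symm ⟨y - p, hd⟩, ?_⟩
      simp only [hAx, LinearIsometryEquiv.apply_symm_apply]
      abel
  have h1 := hI.map_hausdorffMeasure (d := (n : ℝ)) (Or.inl (by positivity))
  rw [hrange] at h1
  obtain ⟨c, hc0, hc⟩ : ∃ c : ℝ≥0, c ≠ 0 ∧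
      (μH[(n : ℝ)] : Measure (EuclideanSpace ℝ (Fin n))) = c • volume := by
    refine ⟨_, ?_, Measure.isAddLeftInvariant_eq_smul _ volume⟩
    exact (Measure.addHaarScalarFactor_pos_of_isAddHaarMeasure _ _).ne'
  have h2 := Measure.map_addHaar_smul (volume : Measure (EuclideanSpace ℝ (Fin n))) hρ.ne'
  set b : ℝ := |(ρ ^ Module.finrank ℝ (EuclideanSpace ℝ (Fin n)))⁻¹| with hb
  have hb0 : 0 < b := by positivity
  have hbn : (Real.toNNReal b) ≠ 0 := by simpa using hb0
  have h3 : (volume : Measure (EuclideanSpace ℝ (Fin n))).map (fun z => p + ρ • A z) =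
      Real.toNNReal b • volume.map fun z => p + A z := by
    have h4 : (fun z => p + ρ • A z) = (fun z => p + A z) ∘ (ρ • ·) := by
      funext z; simp
    rw [h4, ← Measure.map_map hI.continuous.measurable (measurable_const_smul ρ), h2,
      Measure.map_smul]
    rfl
  refine ⟨A, c * (Real.toNNReal b)⁻¹, mul_ne_zero hc0 (inv_ne_zero hbn), hmem, ?_⟩
  rw [← h1, hc, h3, smul_smul, mul_assoc, inv_mul_cancel₀ hbn, mul_one, Measure.map_smul]

/-- The bump `φ_B` restricted to the `n`-plane `L`, as a measure. -/
def flatBump {d : ℕ} (n : ℕ) (φ : EuclideanSpace ℝ (Fin d) → ℝ) (x : EuclideanSpace ℝ (Fin d))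
    (r : ℝ) (L : AffineSubspace ℝ (EuclideanSpace ℝ (Fin d))) :
    Measure (EuclideanSpace ℝ (Fin d)) :=
  ((μH[(n : ℝ)]).restrict (L : Set (EuclideanSpace ℝ (Fin d)))).withDensity
    fun y => ENNReal.ofReal (phiB φ x r y)

lemma continuous_phiB {d : ℕ} {c₂ : ℝ} {φ : EuclideanSpace ℝ (Fin d) → ℝ} (hφ : IsBump c₂ φ)
    (x : EuclideanSpace ℝ (Fin d)) (r : ℝ) : Continuous (phiB φ x r) := by
  have := hφ.continuous
  unfold phiB; fun_prop

lemma exists_flatBump_eq {d n : ℕ} {c₂ : ℝ} (hc₂ : 0 < c₂) {φ : EuclideanSpace ℝ (Fin d) → ℝ}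
    (hφ : IsBump c₂ φ) (x : EuclideanSpace ℝ (Fin d)) {r : ℝ} (hr : 0 < r)
    {L : AffineSubspace ℝ (EuclideanSpace ℝ (Fin d))}
    (hLn : Module.finrank ℝ L.direction = n)
    (hL : ((L : Set (EuclideanSpace ℝ (Fin d))) ∩ closedBall x r).Nonempty) :
    ∃ (Φ : EuclideanSpace ℝ (Fin n) → EuclideanSpace ℝ (Fin d)) (a : ℝ≥0)
      (h : EuclideanSpace ℝ (Fin n) → ℝ), a ≠ 0 ∧ LipschitzWith (Real.toNNReal (3 * r)) Φ ∧
      (∀ z, c₂⁻¹ * ballWeight z ≤ h z) ∧ (∀ z, h z ≤ 36 * c₂ * ballWeight z) ∧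
      flatBump n φ x r L = a • (volume.withDensity fun z => ENNReal.ofReal (h z)).map Φ := by
  obtain ⟨y, hyL, hyr⟩ := hL
  obtain ⟨p, hp, hpL⟩ := AffineSubspace.exists_mem_forall_norm_add_sub_sq ⟨y, hyL⟩ x
  set δ := ‖p - x‖ / r with hδ
  have hδ1 : δ ^ 2 ≤ 1 := by
    have h1 := hpL (y - p) (AffineSubspace.vsub_mem_direction hyL hp)
    rw [add_sub_cancel, ← dist_eq_norm y x] at h1
    have h2 : ‖p - x‖ ^ 2 ≤ r ^ 2 := by
      nlinarith [sq_nonneg ‖y - p‖, mem_closedBall.1 hyr, dist_nonneg (x := y) (y := x)]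
    rw [hδ, div_pow, div_le_one (by positivity)]
    exact h2
  have hR0 : 0 < 9 - δ ^ 2 := by linarith
  have hR : 0 < √(9 - δ ^ 2) := Real.sqrt_pos.2 hR0
  have hR2 : √(9 - δ ^ 2) ^ 2 = 9 - δ ^ 2 := Real.sq_sqrt hR0.le
  obtain ⟨A, a, ha, hA, hσ⟩ := exists_flat_param hLn hp (mul_pos hr hR)
  set Φ := fun z => p + (r * √(9 - δ ^ 2)) • A z with hΦ
  have hΦL : LipschitzWith (Real.toNNReal (3 * r)) Φ := LipschitzWith.of_dist_le' fun z w => by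
    rw [hΦ, dist_add_left, dist_smul₀, A.dist_map, Real.norm_of_nonneg (by positivity)]
    have : r * √(9 - δ ^ 2) ≤ 3 * r := by nlinarith
    gcongr
  have hnorm : ∀ z, ‖r⁻¹ • (Φ z - x)‖ = √((9 - δ ^ 2) * ‖z‖ ^ 2 + δ ^ 2) := fun z => by
    rw [eq_comm, Real.sqrt_eq_iff_eq_sq (by positivity) (norm_nonneg _), norm_smul, mul_pow, hΦ,
      hpL _ (Submodule.smul_mem _ _ (hA z)), norm_smul, A.norm_map,
      Real.norm_of_nonneg (by positivity : (0 : ℝ) ≤ r⁻¹),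
      Real.norm_of_nonneg (by positivity : 0 ≤ r * √(9 - δ ^ 2)), mul_pow, mul_pow, hR2, hδ]
    field_simp
  have hsq : ∀ z : EuclideanSpace ℝ (Fin n), _ := fun z => sub_sqrt_comparable hδ1 (norm_nonneg z)
  refine ⟨Φ, a, fun z => phiB φ x r (Φ z), ha, hΦL, fun z => ?_, fun z => ?_, ?_⟩
  · refine le_trans ?_ (hφ.mul_sq_le _)
    rw [hnorm]
    unfold ballWeight
    exact mul_le_mul_of_nonneg_left (pow_le_pow_left₀ (le_max_left _ _) (hsq z).1 2)
      (inv_nonneg.2 hc₂.le)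
  · refine (hφ.le_mul_sq hc₂ _).trans ?_
    rw [hnorm]
    unfold ballWeight
    calc c₂ * max 0 (3 - √((9 - δ ^ 2) * ‖z‖ ^ 2 + δ ^ 2)) ^ 2
        ≤ c₂ * (6 * max 0 (1 - ‖z‖)) ^ 2 := by gcongr; exact (hsq z).2
      _ = _ := by ring
  · have h1 : Measurable fun y => ENNReal.ofReal (phiB φ x r y) :=
      (continuous_phiB hφ x r).measurable.ennreal_ofReal
    rw [map_withDensity_comp hΦL.continuous.measurable _ h1, flatBump, hσ]
    exact withDensity_smul_measure (a : ℝ≥0∞) _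

lemma isFiniteMeasure_withDensity_of_le_ballWeight {n : ℕ} {b : ℝ}
    {h : EuclideanSpace ℝ (Fin n) → ℝ} (hb : ∀ z, h z ≤ b * ballWeight z) :
    IsFiniteMeasure (volume.withDensity fun z => ENNReal.ofReal (h z)) := by
  refine isFiniteMeasure_withDensity (ne_top_of_le_ne_top (b := ∫⁻ z,
    (closedBall (0 : EuclideanSpace ℝ (Fin n)) 1).indicator (fun _ => ENNReal.ofReal |b|) z)
    ?_ (lintegral_mono fun z => ?_))
  · rw [lintegral_indicator_const measurableSet_closedBall]
    exact ENNReal.mul_ne_top ENNReal.ofReal_ne_top measure_closedBall_lt_top.ne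
  · by_cases hz : z ∈ closedBall (0 : EuclideanSpace ℝ (Fin n)) 1
    · rw [indicator_of_mem hz]
      refine ENNReal.ofReal_le_ofReal ((hb z).trans ((le_abs_self _).trans ?_))
      rw [abs_mul]
      refine mul_le_of_le_one_right (abs_nonneg b) ?_
      have h1 := norm_nonneg z
      rw [mem_closedBall, dist_zero_right] at hz
      rw [ballWeight, max_eq_right (by linarith), abs_of_nonneg (by positivity)]
      nlinarith
    · rw [indicator_of_notMem hz]
      refine (ENNReal.ofReal_of_nonpos ((hb z).trans ?_)).le
      rw [mem_closedBall, dist_zero_right] at hz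
      rw [ballWeight, max_eq_left (by linarith)]
      simp

lemma withDensity_ne_zero_of_ballWeight_le {n : ℕ} {a : ℝ} (ha : 0 < a)
    {h : EuclideanSpace ℝ (Fin n) → ℝ} (hah : ∀ z, a * ballWeight z ≤ h z) :
    (volume.withDensity fun z => ENNReal.ofReal (h z)) ≠ 0 := by
  intro h0
  have h1 : (volume.withDensity fun z : EuclideanSpace ℝ (Fin n) =>
      ENNReal.ofReal (a * ballWeight z)) (ball 0 1) = 0 := by
    refine le_antisymm ?_ zero_le
    refine (withDensity_mono (ae_of_all _ fun z => ENNReal.ofReal_le_ofReal (hah z)) _).trans ?_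
    rw [h0]; simp
  have hm : Measurable fun z : EuclideanSpace ℝ (Fin n) => ENNReal.ofReal (a * ballWeight z) :=
    (continuous_const.mul continuous_ballWeight).measurable.ennreal_ofReal
  rw [withDensity_apply_eq_zero hm] at h1
  have h2 : (ball (0 : EuclideanSpace ℝ (Fin n)) 1) ⊆
      {z | ENNReal.ofReal (a * ballWeight z) ≠ 0} ∩ ball 0 1 := by
    intro z hz
    refine ⟨?_, hz⟩
    rw [mem_ball, dist_zero_right] at hz
    have h3 : 0 < a * ballWeight z := by
      rw [ballWeight, max_eq_right (by linarith)]
      have : 0 < 1 - ‖z‖ := by linarith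
      positivity
    exact (ENNReal.ofReal_pos.2 h3).ne'
  exact (measure_ball_pos volume (0 : EuclideanSpace ℝ (Fin n)) one_pos).ne'
    (measure_mono_null h2 h1)

lemma exists_forall_chiSqTransport_flatBump (n : ℕ) {c₂ : ℝ} (hc₂ : 0 < c₂) (M : ℝ) :
    ∃ K : ℝ≥0, ∀ (d : ℕ) (φ : EuclideanSpace ℝ (Fin d) → ℝ), IsBump c₂ φ →
      ∀ (x : EuclideanSpace ℝ (Fin d)) (r : ℝ), 0 < r →
      ∀ L : AffineSubspace ℝ (EuclideanSpace ℝ (Fin d)), Module.finrank ℝ L.direction = n →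
      ((L : Set (EuclideanSpace ℝ (Fin d))) ∩ closedBall x r).Nonempty →
      IsFiniteMeasure (flatBump n φ x r L) ∧ flatBump n φ x r L ≠ 0 ∧
        ChiSqTransport (Real.toNNReal r ^ 2 * K) M (flatBump n φ x r L) := by
  obtain ⟨K, hK⟩ := exists_forall_chiSqTransport_ball n (b := 36 * c₂) (inv_pos.2 hc₂) M
  refine ⟨9 * K, fun d φ hφ x r hr L hLn hL => ?_⟩
  obtain ⟨Φ, a, h, ha, hΦ, h1, h2, h3⟩ := exists_flatBump_eq hc₂ hφ x hr hLn hL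
  have := isFiniteMeasure_withDensity_of_le_ballWeight h2
  have h0 := withDensity_ne_zero_of_ballWeight_le (inv_pos.2 hc₂) h1
  have hr3 : Real.toNNReal (3 * r) ≠ 0 := by simpa using hr
  rw [h3]
  refine ⟨inferInstance, ?_, ?_⟩
  · rw [Ne, ← Measure.measure_univ_eq_zero, Measure.smul_apply,
      Measure.map_apply hΦ.continuous.measurable MeasurableSet.univ, preimage_univ,
      ENNReal.smul_def, smul_eq_mul]
    exact mul_ne_zero (ENNReal.coe_ne_zero.2 ha) (Measure.measure_univ_ne_zero.2 h0)
  · have h4 := ((hK h h1 h2).map hr3 hΦ).smul ha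
    convert h4 using 1
    rw [Real.toNNReal_mul (by norm_num), mul_pow, Real.toNNReal_ofNat]
    ring

lemma exists_condDensity {E F : Type*} [MeasurableSpace E] [MeasurableSpace F]
    [StandardBorelSpace F] [Nonempty F] (ρ : Measure (E × F)) [IsFiniteMeasure ρ] {χ : E × F → ℝ}
    {M : ℝ} (hχ : Measurable χ) (hχ0 : ∀ z, 0 ≤ χ z) (hχM : ∀ z, χ z ≤ M) :
    ∃ u : E → ℝ, Measurable u ∧ (∀ x, 0 ≤ u x) ∧ (∀ x, u x ≤ M) ∧
      (ρ.withDensity fun z => ENNReal.ofReal (χ z)).map Prod.fst =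
        (ρ.map Prod.fst).withDensity (fun x => ENNReal.ofReal (u x)) ∧
      ∫⁻ x, ENNReal.ofReal ((u x - 1) ^ 2) ∂(ρ.map Prod.fst) ≤
        ∫⁻ z, ENNReal.ofReal ((χ z - 1) ^ 2) ∂ρ := by
  have hsec : ∀ x, Measurable fun y => χ (x, y) := fun x => hχ.comp measurable_prodMk_left
  have hbd : ∀ x y, ‖χ (x, y)‖ ≤ M := fun x y => by
    rw [Real.norm_of_nonneg (hχ0 _)]; exact hχM _
  have hint : ∀ x, Integrable (fun y => χ (x, y)) (ρ.condKernel x) := fun x =>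
    Integrable.of_bound (hsec x).aestronglyMeasurable M (ae_of_all _ (hbd x))
  have hu : Measurable fun x => ∫ y, χ (x, y) ∂ρ.condKernel x :=
    (hχ.stronglyMeasurable.integral_kernel_prod_right' (κ := ρ.condKernel)).measurable
  refine ⟨fun x => ∫ y, χ (x, y) ∂ρ.condKernel x, hu, fun x => integral_nonneg fun y => hχ0 _,
    fun x => ?_, ?_, ?_⟩
  · have h1 := norm_integral_le_of_norm_le_const (μ := ρ.condKernel x) (ae_of_all _ (hbd x))
    rw [probReal_univ, mul_one] at h1
    exact (le_abs_self _).trans h1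
  · refine Measure.ext_of_lintegral _ fun f hf => ?_
    have hf' : Measurable fun z : E × F => f z.1 := hf.comp measurable_fst
    rw [lintegral_map hf measurable_fst,
      lintegral_withDensity_eq_lintegral_mul _ hχ.ennreal_ofReal hf',
      lintegral_withDensity_eq_lintegral_mul _ hu.ennreal_ofReal hf]
    conv_lhs => rw [← ρ.disintegrate ρ.condKernel]
    rw [Measure.lintegral_compProd (hχ.ennreal_ofReal.mul hf')]
    refine lintegral_congr fun x => ?_
    simp only [Pi.mul_apply]
    rw [lintegral_mul_const _ (hsec x).ennreal_ofReal,
      ofReal_integral_eq_lintegral_ofReal (hint x) (ae_of_all _ fun y => hχ0 _)]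
  · have hm : Measurable fun z => ENNReal.ofReal ((χ z - 1) ^ 2) :=
      ((hχ.sub_const 1).pow_const 2).ennreal_ofReal
    conv_rhs => rw [← ρ.disintegrate ρ.condKernel]
    rw [Measure.lintegral_compProd hm]
    refine lintegral_mono fun x => ?_
    have h1 := sq_integral_le_integral_sq (P := ρ.condKernel x) (f := fun y => χ (x, y) - 1)
      (c := M + 1) ((hsec x).sub_const 1) fun y => by
        have := hχ0 (x, y); have := hχM (x, y)
        rw [abs_le]; constructor <;> linarith
    rwa [integral_sub (hint x) (integrable_const 1), integral_const, probReal_univ,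
      one_smul] at h1

lemma ChiSqTransport.exists_sqCost_smul_le {E : Type*} [EMetricSpace E] [MeasurableSpace E]
    [BorelSpace E] [SecondCountableTopology E] {η : Measure E} [IsFiniteMeasure η] (hη : η ≠ 0)
    {K : ℝ≥0} {M : ℝ} (hK : ChiSqTransport K (2 * M) η) {s : Set E} (hs : ∀ᵐ x ∂η, x ∈ s)
    {D : ℝ≥0} (hD : ∀ x ∈ s, ∀ y ∈ s, edist x y ≤ D) {u : E → ℝ} (hu : Measurable u)
    (hu0 : ∀ x, 0 ≤ u x) (huM : ∀ x, u x ≤ M) :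
    ∃ a : ℝ≥0, a * η univ = η.withDensity (fun x => ENNReal.ofReal (u x)) univ ∧
      sqCost (η.withDensity fun x => ENNReal.ofReal (u x)) (a • η) ≤
        ((2 * K + 2 * D ^ 2 : ℝ≥0) : ℝ≥0∞) * ∫⁻ x, ENNReal.ofReal ((u x - 1) ^ 2) ∂η := by
  have hui : Integrable u η := Integrable.of_bound hu.aestronglyMeasurable M
    (ae_of_all _ fun x => by rw [Real.norm_of_nonneg (hu0 x)]; exact huM x)
  have hu2i : Integrable (fun x => u x ^ 2) η :=
    Integrable.of_bound (hu.pow_const 2).aestronglyMeasurable (M ^ 2)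
    (ae_of_all _ fun x => by
      rw [Real.norm_of_nonneg (sq_nonneg _)]
      exact pow_le_pow_left₀ (hu0 x) (huM x) 2)
  set m := η.real univ with hm
  have hm0 : 0 < m := ENNReal.toReal_pos (Measure.measure_univ_ne_zero.2 hη) (measure_ne_top η univ)
  have hsq : ∀ t : ℝ,
      ∫ x, (u x - t) ^ 2 ∂η = ∫ x, u x ^ 2 ∂η - 2 * t * ∫ x, u x ∂η + t ^ 2 * m := by
    intro t
    have h1 : ∀ x, (u x - t) ^ 2 = u x ^ 2 - (2 * t) * u x + t ^ 2 := fun x => by ring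
    simp_rw [h1]
    have h2 : Integrable (fun x => u x ^ 2 - (2 * t) * u x) η := hu2i.sub (hui.const_mul _)
    rw [integral_add h2 (integrable_const _),
      integral_sub hu2i (hui.const_mul _), integral_const_mul, integral_const, smul_eq_mul,
        mul_comm m]
  have hsqi : ∀ t : ℝ, Integrable (fun x => (u x - t) ^ 2) η := fun t => by
    have h1 : ∀ x, (u x - t) ^ 2 = u x ^ 2 - (2 * t) * u x + t ^ 2 := fun x => by ring
    simp_rw [h1]
    exact (hu2i.sub (hui.const_mul _)).add (integrable_const _)
  set a : ℝ := (∫ x, u x ∂η) / m with ha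
  have ha0 : 0 ≤ a := div_nonneg (integral_nonneg hu0) hm0.le
  have ham : ∫ x, u x ∂η = a * m := (div_mul_cancel₀ _ hm0.ne').symm
  have hlint : ∀ t : ℝ, ∫⁻ x, ENNReal.ofReal ((u x - t) ^ 2) ∂η =
      ENNReal.ofReal (∫ x, (u x - t) ^ 2 ∂η) := fun t =>
    (ofReal_integral_eq_lintegral_ofReal (hsqi t) (ae_of_all _ fun x => sq_nonneg _)).symm
  have hvar : 0 ≤ ∫ x, (u x - a) ^ 2 ∂η := integral_nonneg fun x => sq_nonneg _
  have h1a : ∫ x, (u x - 1) ^ 2 ∂η = ∫ x, (u x - a) ^ 2 ∂η + (1 - a) ^ 2 * m := by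
    rw [hsq, hsq, ham]; ring
  have hmeq : η univ = ENNReal.ofReal m := (ofReal_measureReal (measure_ne_top η univ)).symm
  have huniv : η.withDensity (fun x => ENNReal.ofReal (u x)) univ = ENNReal.ofReal (a * m) := by
    rw [withDensity_apply _ MeasurableSet.univ, Measure.restrict_univ,
      ← ofReal_integral_eq_lintegral_ofReal hui (ae_of_all _ hu0), ham]
  have hmass : (a.toNNReal : ℝ≥0∞) * η univ =
      η.withDensity (fun x => ENNReal.ofReal (u x)) univ := by
    rw [huniv, ENNReal.ofReal_mul ha0, hmeq]; rfl
  refine ⟨a.toNNReal, hmass, ?_⟩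
  rcases lt_or_ge a (1 / 2) with hlt | hge
  · have hfin : IsFiniteMeasure (η.withDensity fun x => ENNReal.ofReal (u x)) :=
      ⟨by rw [huniv]; exact ENNReal.ofReal_lt_top⟩
    refine (sqCost_le_of_bounded (D := D) ?_ ((withDensity_absolutelyContinuous _ _).ae_le hs)
      ?_ hD).trans ?_
    · rw [← hmass]; rfl
    · exact Measure.ae_smul_measure hs _
    · rw [huniv, hlint, ← ENNReal.ofReal_coe_nnreal, ← ENNReal.ofReal_coe_nnreal,
        ← ENNReal.ofReal_pow (NNReal.coe_nonneg D), ← ENNReal.ofReal_mul (sq_nonneg _),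
        ← ENNReal.ofReal_mul (NNReal.coe_nonneg _)]
      refine ENNReal.ofReal_le_ofReal ?_
      have h2 : a * m ≤ 2 * ∫ x, (u x - 1) ^ 2 ∂η := by
        have h3 : a ≤ 2 * (1 - a) ^ 2 := by nlinarith
        rw [h1a]
        nlinarith [mul_le_mul_of_nonneg_right h3 hm0.le]
      push_cast
      have h3 : 0 ≤ ∫ x, (u x - 1) ^ 2 ∂η := integral_nonneg fun x => sq_nonneg _
      nlinarith [mul_le_mul_of_nonneg_left h2 (sq_nonneg (D : ℝ)), mul_nonneg K.2 h3]
  · have ha' : 0 < a := by linarith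
    have h2 := hK (fun x => u x / a) (hu.div_const a) (fun x => div_nonneg (hu0 x) ha0)
      (fun x => by
        have := hu0 x; have := huM x
        rw [div_le_iff₀ ha']; nlinarith) (by rw [integral_div, ham,
          mul_div_cancel_left₀ _ ha'.ne', hm])
    have h3 : η.withDensity (fun x => ENNReal.ofReal (u x)) =
        a.toNNReal • η.withDensity fun x => ENNReal.ofReal (u x / a) := by
      rw [show (a.toNNReal • η.withDensity fun x => ENNReal.ofReal (u x / a)) =
        η.withDensity ((a.toNNReal : ℝ≥0∞) • fun x => ENNReal.ofReal (u x / a)) from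
          (withDensity_smul _ (hu.div_const a).ennreal_ofReal).symm]
      congr 1
      funext x
      rw [Pi.smul_apply, smul_eq_mul, show (a.toNNReal : ℝ≥0∞) = ENNReal.ofReal a from rfl,
        ← ENNReal.ofReal_mul ha0, mul_div_cancel₀ _ ha'.ne']
    rw [h3]
    refine (sqCost_smul_le _ _ _).trans ((mul_le_mul_right h2 _).trans ?_)
    have h4 : ∀ x, (u x / a - 1) ^ 2 = (u x - a) ^ 2 * (a ^ 2)⁻¹ := fun x => by field_simp
    simp_rw [h4]
    rw [← ofReal_integral_eq_lintegral_ofReal ((hsqi a).mul_const _)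
      (ae_of_all _ fun x => by positivity), integral_mul_const, hlint,
      show (a.toNNReal : ℝ≥0∞) = ENNReal.ofReal a from rfl, ← ENNReal.ofReal_coe_nnreal,
      ← ENNReal.ofReal_coe_nnreal, ← ENNReal.ofReal_mul (NNReal.coe_nonneg K),
      ← ENNReal.ofReal_mul ha0,
      ← ENNReal.ofReal_mul (NNReal.coe_nonneg _)]
    refine ENNReal.ofReal_le_ofReal ?_
    push_cast
    have h5 : a * (K * ((∫ x, (u x - a) ^ 2 ∂η) * (a ^ 2)⁻¹)) =
        K * (∫ x, (u x - a) ^ 2 ∂η) * a⁻¹ := by field_simp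
    have h6 : a⁻¹ ≤ 2 := by rw [inv_le_comm₀ ha' two_pos]; linarith
    have h7 : ∫ x, (u x - a) ^ 2 ∂η ≤ ∫ x, (u x - 1) ^ 2 ∂η := by
      rw [h1a]; nlinarith [sq_nonneg (1 - a)]
    rw [h5]
    calc K * (∫ x, (u x - a) ^ 2 ∂η) * a⁻¹ ≤ K * (∫ x, (u x - 1) ^ 2 ∂η) * 2 := by
          gcongr
      _ ≤ _ := by
          nlinarith [mul_nonneg (sq_nonneg (D : ℝ)) (hvar.trans h7)]

lemma sqCost_withDensity_smul_le {E : Type*} [EMetricSpace E] [MeasurableSpace E]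
    [BorelSpace E] [SecondCountableTopology E] [StandardBorelSpace E] [Nonempty E]
    (π : Measure (E × E)) [IsFiniteMeasure π] {η : Measure E} [IsFiniteMeasure η] (hη : η ≠ 0)
    {K : ℝ≥0} {M : ℝ} (hK : ChiSqTransport K (2 * M) η) {h : E → ℝ} (hh : Measurable h)
    (hh0 : ∀ x, 0 ≤ h x) (hh1 : ∀ x, h x ≤ 1) {c : ℝ≥0}
    (hc : (π.map Prod.snd).withDensity (fun x => ENNReal.ofReal (h x)) = c • η)
    {χ : E × E → ℝ} (hχ : Measurable χ) (hχ0 : ∀ z, 0 ≤ χ z) (hχM : ∀ z, χ z ≤ M) {A : ℝ≥0}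
    (hχA : ∀ z, ENNReal.ofReal (h z.2 * (χ z - 1) ^ 2) ≤ A * edist z.1 z.2 ^ 2)
    (hχh : ∀ z, h z.2 * χ z ≤ h z.1)
    (hfar : ∀ z, ENNReal.ofReal (h z.1 - h z.2 * χ z) ≤ A * edist z.1 z.2 ^ 2)
    {s : Set E} (hsm : MeasurableSet s) (hs : ∀ x ∉ s, h x = 0) (hηs : ∀ᵐ x ∂η, x ∈ s)
    {D : ℝ≥0} (hD : ∀ x ∈ s, ∀ y ∈ s, edist x y ≤ D) {b : ℝ≥0}
    (hb : b * η univ = (π.map Prod.fst).withDensity (fun x => ENNReal.ofReal (h x)) univ) :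
    sqCost ((π.map Prod.fst).withDensity fun x => ENNReal.ofReal (h x)) (b • η) ≤
      ((2 * M.toNNReal + 2 * ((2 * K + 2 * D ^ 2) * A) + D ^ 2 * A : ℝ≥0) : ℝ≥0∞) *
        ∫⁻ z, edist z.1 z.2 ^ 2 ∂π := by
  set J := ∫⁻ z, edist z.1 z.2 ^ 2 ∂π with hJ
  have hm2 : Measurable fun z : E × E => ENNReal.ofReal (h z.2) :=
    (hh.comp measurable_snd).ennreal_ofReal
  have hmχ : Measurable fun z : E × E => ENNReal.ofReal (χ z) := hχ.ennreal_ofReal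
  have hmf : Measurable fun z : E × E => ENNReal.ofReal (h z.1 - h z.2 * χ z) :=
    ((hh.comp measurable_fst).sub ((hh.comp measurable_snd).mul hχ)).ennreal_ofReal
  set τ := π.withDensity fun z => ENNReal.ofReal (h z.2) with hτ
  set near := τ.withDensity fun z => ENNReal.ofReal (χ z) with hnear
  set far := π.withDensity fun z => ENNReal.ofReal (h z.1 - h z.2 * χ z) with hfardef
  have hsplit : near + far = π.withDensity fun z => ENNReal.ofReal (h z.1) := by
    rw [hnear, hτ, ← withDensity_mul _ hm2 hmχ, hfardef, ← withDensity_add_right _ hmf]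
    congr 1
    funext z
    simp only [Pi.add_apply, Pi.mul_apply]
    rw [← ENNReal.ofReal_mul (hh0 _), ← ENNReal.ofReal_add (mul_nonneg (hh0 _) (hχ0 _))
      (sub_nonneg.2 (hχh z)), add_sub_cancel]
  have hfst : (π.map Prod.fst).withDensity (fun x => ENNReal.ofReal (h x)) =
      near.map Prod.fst + far.map Prod.fst := by
    rw [← Measure.map_add _ _ measurable_fst, hsplit,
      ← map_withDensity_comp measurable_fst π hh.ennreal_ofReal]
  have hfin1 : IsFiniteMeasure (π.withDensity fun z => ENNReal.ofReal (h z.1)) := by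
    refine isFiniteMeasure_of_le π ((withDensity_mono (g := 1) (ae_of_all _ fun z => ?_)).trans_eq
      withDensity_one)
    simpa using hh1 z.1
  have hτfin : IsFiniteMeasure τ := by
    refine isFiniteMeasure_of_le π ((withDensity_mono (g := 1) (ae_of_all _ fun z => ?_)).trans_eq
      withDensity_one)
    simpa using hh1 z.2
  have hnfin : IsFiniteMeasure near :=
    isFiniteMeasure_of_le (π.withDensity fun z => ENNReal.ofReal (h z.1))
      (hsplit ▸ Measure.le_add_right le_rfl)
  have hffin : IsFiniteMeasure far :=
    isFiniteMeasure_of_le (π.withDensity fun z => ENNReal.ofReal (h z.1))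
      (hsplit ▸ Measure.le_add_left le_rfl)
  have hτsnd : (τ.map Prod.swap).map Prod.fst = c • η := by
    rw [Measure.map_map measurable_fst measurable_swap, ← hc,
      ← map_withDensity_comp measurable_snd π hh.ennreal_ofReal]
    rfl
  have : IsFiniteMeasure (τ.map Prod.swap) := Measure.isFiniteMeasure_map _ _
  obtain ⟨u, hu, hu0, huM, hu1, hu2⟩ := exists_condDensity (τ.map Prod.swap)
    (χ := fun z => χ z.swap) (hχ.comp measurable_swap) (fun z => hχ0 _) (fun z => hχM _)
  rw [hτsnd] at hu1 hu2
  have hcu : (c • η).withDensity (fun x => ENNReal.ofReal (u x)) =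
      c • η.withDensity fun x => ENNReal.ofReal (u x) :=
    withDensity_smul_measure (c : ℝ≥0∞) _
  have hnsnd : near.map Prod.snd = c • η.withDensity fun x => ENNReal.ofReal (u x) := by
    rw [← hcu, ← hu1, ← map_withDensity_comp measurable_swap τ
      (f := fun z => ENNReal.ofReal (χ z.swap)) (hχ.comp measurable_swap).ennreal_ofReal,
      Measure.map_map measurable_fst measurable_swap]
    rfl
  obtain ⟨a, ha, hacost⟩ := hK.exists_sqCost_smul_le hη hηs hD hu hu0 huM
  have hχJ : ∫⁻ x, ENNReal.ofReal ((u x - 1) ^ 2) ∂(c • η) ≤ A * J := by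
    refine hu2.trans ?_
    have hm : Measurable fun z => ENNReal.ofReal ((χ z - 1) ^ 2) :=
      ((hχ.sub_const 1).pow_const 2).ennreal_ofReal
    have hm' : Measurable fun z : E × E => ENNReal.ofReal ((χ z.swap - 1) ^ 2) :=
      hm.comp measurable_swap
    rw [lintegral_map hm' measurable_swap, hτ]
    simp only [Prod.swap_swap]
    rw [lintegral_withDensity_eq_lintegral_mul _ hm2 hm, hJ,
      ← lintegral_const_mul _ measurable_edist_sq]
    refine lintegral_mono fun z => ?_
    simp only [Pi.mul_apply]
    rw [← ENNReal.ofReal_mul (hh0 _)]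
    exact hχA z
  have hmid : sqCost (near.map Prod.snd) (c • a • η) ≤
      ((2 * K + 2 * D ^ 2 : ℝ≥0) : ℝ≥0∞) * (A * J) := by
    rw [hnsnd]
    refine (sqCost_smul_le _ _ _).trans ((mul_le_mul_right hacost _).trans ?_)
    rw [mul_left_comm]
    refine mul_le_mul_right (le_trans ?_ hχJ) _
    rw [lintegral_smul_measure]; rfl
  have hnearJ : ∫⁻ z, edist z.1 z.2 ^ 2 ∂near ≤ M.toNNReal * J := by
    rw [hnear, lintegral_withDensity_eq_lintegral_mul _ hmχ measurable_edist_sq, hτ,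
      lintegral_withDensity_eq_lintegral_mul _ hm2 (hmχ.mul measurable_edist_sq), hJ,
      ← lintegral_const_mul _ measurable_edist_sq]
    refine lintegral_mono fun z => ?_
    simp only [Pi.mul_apply]
    calc ENNReal.ofReal (h z.2) * (ENNReal.ofReal (χ z) * edist z.1 z.2 ^ 2)
        ≤ 1 * (ENNReal.ofReal M * edist z.1 z.2 ^ 2) := by
          gcongr
          · simpa using hh1 z.2
          · exact hχM z
      _ = _ := by rw [one_mul]; rfl
  have hn : sqCost (near.map Prod.fst) (c • a • η) ≤
      2 * (M.toNNReal * J) + 2 * (((2 * K + 2 * D ^ 2 : ℝ≥0) : ℝ≥0∞) * (A * J)) := by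
    have : IsFiniteMeasure (near.map Prod.snd) := Measure.isFiniteMeasure_map _ _
    refine (sqCost_triangle_two _ (near.map Prod.snd) _).trans ?_
    gcongr
    exact (sqCost_le near).trans hnearJ
  have hfarm : far univ ≤ A * J := by
    rw [hfardef, withDensity_apply _ MeasurableSet.univ, Measure.restrict_univ, hJ,
      ← lintegral_const_mul _ measurable_edist_sq]
    exact lintegral_mono hfar
  have hηu : η univ ≠ 0 := Measure.measure_univ_ne_zero.2 hη
  have hηt : η univ ≠ ⊤ := measure_ne_top η univ
  have hnm : near univ = (c * a : ℝ≥0) * η univ := by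
    have h1 : near univ = near.map Prod.snd univ := by
      rw [Measure.map_apply measurable_snd MeasurableSet.univ]; rfl
    rw [h1, hnsnd, Measure.smul_apply, ENNReal.smul_def, smul_eq_mul, ← ha, ENNReal.coe_mul,
      mul_assoc]
  have hbm : b * η univ = (c * a : ℝ≥0) * η univ + far univ := by
    rw [hb, hfst, Measure.add_apply, Measure.map_apply measurable_fst MeasurableSet.univ,
      Measure.map_apply measurable_fst MeasurableSet.univ, preimage_univ, hnm]
  have hcab : c * a ≤ b := by
    have h1 : ((c * a : ℝ≥0) : ℝ≥0∞) * η univ ≤ b * η univ := hbm ▸ le_self_add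
    exact_mod_cast (ENNReal.mul_le_mul_iff_left hηu hηt).1 h1
  obtain ⟨e, rfl⟩ := exists_add_of_le hcab
  have hem : far univ = e * η univ := by
    rw [ENNReal.coe_add, add_mul] at hbm
    exact ((ENNReal.add_right_inj (ENNReal.mul_ne_top ENNReal.coe_ne_top hηt)).1 hbm).symm
  have hf : sqCost (far.map Prod.fst) (e • η) ≤ (D : ℝ≥0∞) ^ 2 * (A * J) := by
    have : IsFiniteMeasure (far.map Prod.fst) := Measure.isFiniteMeasure_map _ _
    have hmu : far.map Prod.fst univ = far univ := by
      rw [Measure.map_apply measurable_fst MeasurableSet.univ]; rfl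
    refine (sqCost_le_of_bounded (D := D) (s := s) ?_ ?_ ?_ hD).trans ?_
    · rw [hmu, hem]; rfl
    · refine (ae_map_iff measurable_fst.aemeasurable hsm).2 ?_
      rw [hfardef, ae_withDensity_iff hmf]
      refine ae_of_all _ fun z hz => ?_
      by_contra hzs
      refine hz (ENNReal.ofReal_eq_zero.2 ?_)
      rw [hs _ hzs]
      linarith [mul_nonneg (hh0 z.2) (hχ0 z)]
    · exact Measure.ae_smul_measure hηs _
    · rw [hmu]; exact mul_le_mul_right hfarm _
  rw [hfst, show (c * a + e) • η = c • a • η + e • η by rw [add_smul, mul_smul]]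
  refine (sqCost_add_le _ _ _ _).trans ((add_le_add hn hf).trans_eq ?_)
  push_cast
  ring

namespace IsBump

lemma exists_transport_weight {d : ℕ} {c₂ : ℝ} {φ : EuclideanSpace ℝ (Fin d) → ℝ}
    (h : IsBump c₂ φ) (hc : 0 < c₂) :
    ∃ χ : EuclideanSpace ℝ (Fin d) × EuclideanSpace ℝ (Fin d) → ℝ, Measurable χ ∧
      (∀ z, 0 ≤ χ z) ∧ (∀ z, χ z ≤ 4 * c₂ ^ 2) ∧
      (∀ z, φ z.2 * (χ z - 1) ^ 2 ≤ (4 * c₂ ^ 3 + 4 * c₂) * ‖z.1 - z.2‖ ^ 2) ∧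
      (∀ z, φ z.2 * χ z ≤ φ z.1) ∧
      (∀ z, φ z.1 - φ z.2 * χ z ≤ (4 * c₂ ^ 3 + 4 * c₂) * ‖z.1 - z.2‖ ^ 2) := by
  classical
  have hφ : Measurable φ := h.continuous.measurable
  have hS : MeasurableSet {z : EuclideanSpace ℝ (Fin d) × EuclideanSpace ℝ (Fin d) |
      ‖z.1 - z.2‖ ≤ max 0 (3 - ‖z.2‖)} :=
    measurableSet_le (measurable_fst.sub measurable_snd).norm
      (measurable_const.max (measurable_const.sub measurable_snd.norm))
  refine ⟨fun z => if ‖z.1 - z.2‖ ≤ max 0 (3 - ‖z.2‖) then φ z.1 / φ z.2 else 0,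
    Measurable.ite hS ((hφ.comp measurable_fst).div (hφ.comp measurable_snd)) measurable_const, ?_⟩
  have key : ∀ y w : EuclideanSpace ℝ (Fin d), ∀ q : ℝ,
      q = (if ‖y - w‖ ≤ max 0 (3 - ‖w‖) then φ y / φ w else 0) →
      0 ≤ q ∧ q ≤ 4 * c₂ ^ 2 ∧
      φ w * (q - 1) ^ 2 ≤ (4 * c₂ ^ 3 + 4 * c₂) * ‖y - w‖ ^ 2 ∧
      φ w * q ≤ φ y ∧ φ y - φ w * q ≤ (4 * c₂ ^ 3 + 4 * c₂) * ‖y - w‖ ^ 2 := by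
    intro y w q hq
    have hy0 := h.nonneg y
    have hw0 := h.nonneg w
    have ht0 := norm_nonneg (y - w)
    have hyw : ‖w‖ ≤ ‖y‖ + ‖y - w‖ := by
      have := norm_sub_norm_le w y; rw [norm_sub_rev] at this; linarith
    have h1 := h.le_mul_sq hc y
    have h2 := h.le_mul_sq hc w
    have h3 := h.mul_sq_le w
    have h4 := h.abs_sub_le hc y w
    set t := ‖y - w‖ with ht
    set s := max 0 (3 - ‖w‖) with hs
    have hya : max 0 (3 - ‖y‖) ≤ s + t :=
      max_le (by positivity) (by have := le_max_right 0 (3 - ‖w‖); linarith)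
    have hym : max 0 (3 - min ‖y‖ ‖w‖) ≤ s + t := by
      refine max_le (by positivity) ?_
      have := le_max_right 0 (3 - ‖w‖)
      rcases min_choice ‖y‖ ‖w‖ with e | e <;> rw [e] <;> linarith
    have hy1 : φ y ≤ c₂ * (s + t) ^ 2 :=
      h1.trans (mul_le_mul_of_nonneg_left (pow_le_pow_left₀ (le_max_left _ _) hya 2) hc.le)
    have hc3 : 0 ≤ c₂ ^ 3 * t ^ 2 := by positivity
    rcases hw0.eq_or_lt with hw | hw
    · have hs2 : s = 0 := by
        rw [← hw] at h3
        have : s ^ 2 ≤ 0 := by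
          by_contra! hlt
          exact absurd h3 (not_le.2 (mul_pos (inv_pos.2 hc) hlt))
        exact pow_eq_zero_iff (two_ne_zero) |>.1 (le_antisymm this (sq_nonneg s))
      have hq0 : q = 0 := by rw [hq, ← hw]; simp
      rw [hs2, zero_add] at hy1
      rw [hq0, ← hw]
      have : 0 ≤ c₂ * t ^ 2 := by positivity
      refine ⟨le_rfl, by positivity, by simp; positivity, by simpa using hy0, by linarith⟩
    split_ifs at hq with hts
    · have hqw : φ w * q = φ y := by rw [hq]; field_simp
      have hsw : s ^ 2 ≤ c₂ * φ w := by
        rwa [inv_mul_le_iff₀ hc] at h3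
      have hy4 : φ y ≤ c₂ * (4 * s ^ 2) := hy1.trans (by gcongr; nlinarith)
      refine ⟨hq ▸ div_nonneg hy0 hw0, ?_, ?_, hqw.le, by rw [hqw, sub_self]; positivity⟩
      · rw [hq, div_le_iff₀ hw]; nlinarith
      · have h5 : |φ w * (q - 1)| ≤ 2 * c₂ * s * t := by
          rw [mul_sub, hqw, mul_one]
          refine h4.trans ?_
          have : c₂ * max 0 (3 - min ‖y‖ ‖w‖) * t ≤ c₂ * (s + s) * t := by gcongr; linarith
          linarith
        have h6 : (φ w * (q - 1)) ^ 2 ≤ (2 * c₂ * s * t) ^ 2 :=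
          sq_le_sq' (by linarith [neg_le_of_abs_le h5]) (le_of_abs_le h5)
        have h7 : φ w * (φ w * (q - 1) ^ 2) ≤ φ w * (4 * c₂ ^ 3 * t ^ 2) := by
          have : s ^ 2 * (4 * c₂ ^ 2 * t ^ 2) ≤ c₂ * φ w * (4 * c₂ ^ 2 * t ^ 2) := by gcongr
          linarith
        have h8 := le_of_mul_le_mul_left h7 hw
        have : 0 ≤ c₂ * t ^ 2 := by positivity
        linarith
    · push Not at hts
      subst hq
      have h5 : c₂ * s ^ 2 ≤ c₂ * t ^ 2 := by gcongr
      have h6 : c₂ * (s + t) ^ 2 ≤ c₂ * (t + t) ^ 2 := by gcongr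
      have : 0 ≤ c₂ * t ^ 2 := by positivity
      refine ⟨le_rfl, by positivity, by linarith, by simpa using hy0, by linarith⟩
  exact ⟨fun z => (key _ _ _ rfl).1, fun z => (key _ _ _ rfl).2.1, fun z => (key _ _ _ rfl).2.2.1,
    fun z => (key _ _ _ rfl).2.2.2.1, fun z => (key _ _ _ rfl).2.2.2.2⟩

end IsBump

lemma IsBump.phiB_nonneg {d : ℕ} {c₂ : ℝ} {φ : EuclideanSpace ℝ (Fin d) → ℝ} (h : IsBump c₂ φ)
    (x : EuclideanSpace ℝ (Fin d)) (r : ℝ) (y : EuclideanSpace ℝ (Fin d)) : 0 ≤ phiB φ x r y :=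
  h.nonneg _

lemma IsBump.phiB_le_one {d : ℕ} {c₂ : ℝ} {φ : EuclideanSpace ℝ (Fin d) → ℝ} (h : IsBump c₂ φ)
    (x : EuclideanSpace ℝ (Fin d)) (r : ℝ) (y : EuclideanSpace ℝ (Fin d)) : phiB φ x r y ≤ 1 :=
  h.le_one _

lemma IsBump.phiB_eq_zero {d : ℕ} {c₂ : ℝ} {φ : EuclideanSpace ℝ (Fin d) → ℝ} (h : IsBump c₂ φ)
    {x y : EuclideanSpace ℝ (Fin d)} {r : ℝ} (hr : 0 < r) (hy : 3 * r ≤ dist y x) :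
    phiB φ x r y = 0 := by
  refine h.eq_zero ?_
  rw [norm_smul, Real.norm_of_nonneg (inv_nonneg.2 hr.le), ← dist_eq_norm, ← div_eq_inv_mul,
    le_div_iff₀ hr]
  exact hy

lemma IsBump.phiB_eq_one {d : ℕ} {c₂ : ℝ} {φ : EuclideanSpace ℝ (Fin d) → ℝ} (h : IsBump c₂ φ)
    {x y : EuclideanSpace ℝ (Fin d)} {r : ℝ} (hr : 0 < r) (hy : dist y x ≤ 2 * r) :
    phiB φ x r y = 1 := by
  refine h.eq_one ?_
  rw [norm_smul, Real.norm_of_nonneg (inv_nonneg.2 hr.le), ← dist_eq_norm, ← div_eq_inv_mul,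
    div_le_iff₀ hr]
  exact hy

lemma integral_phiB_eq {d : ℕ} {c₂ : ℝ} {φ : EuclideanSpace ℝ (Fin d) → ℝ} (h : IsBump c₂ φ)
    (x : EuclideanSpace ℝ (Fin d)) (r : ℝ) (ν : Measure (EuclideanSpace ℝ (Fin d))) :
    ∫ y, phiB φ x r y ∂ν =
      (ν.withDensity (fun y => ENNReal.ofReal (phiB φ x r y)) univ).toReal := by
  rw [integral_eq_lintegral_of_nonneg_ae (ae_of_all _ (h.phiB_nonneg x r))
    (continuous_phiB h x r).aestronglyMeasurable, withDensity_apply _ MeasurableSet.univ,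
    Measure.restrict_univ]

lemma ofReal_cBL_mul {d n : ℕ} {c₂ : ℝ} {φ : EuclideanSpace ℝ (Fin d) → ℝ} (h : IsBump c₂ φ)
    {x : EuclideanSpace ℝ (Fin d)} {r : ℝ} {μ : Measure (EuclideanSpace ℝ (Fin d))}
    {L : AffineSubspace ℝ (EuclideanSpace ℝ (Fin d))} [IsFiniteMeasure (flatBump n φ x r L)]
    (hη : flatBump n φ x r L ≠ 0)
    (hμ : μ.withDensity (fun y => ENNReal.ofReal (phiB φ x r y)) univ ≠ ⊤) :
    ENNReal.ofReal (cBL n φ μ x r L) * flatBump n φ x r L univ =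
      μ.withDensity (fun y => ENNReal.ofReal (phiB φ x r y)) univ := by
  have hpos : 0 < (flatBump n φ x r L univ).toReal :=
    ENNReal.toReal_pos (Measure.measure_univ_ne_zero.2 hη) (measure_ne_top _ _)
  rw [cBL, integral_phiB_eq h, integral_phiB_eq h, ← flatBump, ENNReal.ofReal_div_of_pos hpos,
    ENNReal.ofReal_toReal hμ, ENNReal.ofReal_toReal (measure_ne_top _ _),
    ENNReal.div_mul_cancel (Measure.measure_univ_ne_zero.2 hη) (measure_ne_top _ _)]

lemma ae_phiB_mem_closedBall {d : ℕ} {c₂ : ℝ} {φ : EuclideanSpace ℝ (Fin d) → ℝ}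
    (h : IsBump c₂ φ) (x : EuclideanSpace ℝ (Fin d)) {r : ℝ} (hr : 0 < r)
    (ν : Measure (EuclideanSpace ℝ (Fin d))) :
    ∀ᵐ y ∂ν.withDensity (fun y => ENNReal.ofReal (phiB φ x r y)), y ∈ closedBall x (3 * r) := by
  rw [ae_withDensity_iff (continuous_phiB h x r).measurable.ennreal_ofReal]
  refine ae_of_all _ fun y hy => ?_
  by_contra hyx
  rw [mem_closedBall, not_le] at hyx
  exact hy (by rw [h.phiB_eq_zero hr hyx.le, ENNReal.ofReal_zero])

lemma edist_le_of_mem_closedBall {d : ℕ} {x : EuclideanSpace ℝ (Fin d)} {r : ℝ}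
    {y z : EuclideanSpace ℝ (Fin d)} (hy : y ∈ closedBall x (3 * r))
    (hz : z ∈ closedBall x (3 * r)) : edist y z ≤ (6 * r.toNNReal : ℝ≥0) := by
  rw [edist_dist, ENNReal.ofReal, ENNReal.coe_le_coe, ← NNReal.coe_le_coe]
  have hyx := mem_closedBall.1 hy
  have hzx := mem_closedBall'.1 hz
  have h1 := dist_triangle y x z
  have hr : 0 ≤ r := by linarith [dist_nonneg (x := y) (y := x)]
  rw [Real.coe_toNNReal _ dist_nonneg, NNReal.coe_mul, Real.coe_toNNReal _ hr]
  push_cast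
  linarith

lemma exists_forall_sqCost_flatB_le (n : ℕ) {c₂ : ℝ} (hc₂ : 0 < c₂) :
    ∃ T : ℝ≥0, ∀ (d : ℕ) (φ : EuclideanSpace ℝ (Fin d) → ℝ), IsBump c₂ φ →
      ∀ (x : EuclideanSpace ℝ (Fin d)) (r : ℝ), 0 < r →
      ∀ L : AffineSubspace ℝ (EuclideanSpace ℝ (Fin d)), Module.finrank ℝ L.direction = n →
      ((L : Set (EuclideanSpace ℝ (Fin d))) ∩ closedBall x r).Nonempty →
      ∀ (μ : Measure (EuclideanSpace ℝ (Fin d)))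
        (π : Measure (EuclideanSpace ℝ (Fin d) × EuclideanSpace ℝ (Fin d))),
      IsFiniteMeasure π →
      (π.map Prod.fst).withDensity (fun y => ENNReal.ofReal (phiB φ x r y)) =
        μ.withDensity (fun y => ENNReal.ofReal (phiB φ x r y)) →
      ∀ c : ℝ≥0, (π.map Prod.snd).withDensity (fun y => ENNReal.ofReal (phiB φ x r y)) =
        c • flatBump n φ x r L →
      sqCost (μ.withDensity fun y => ENNReal.ofReal (phiB φ x r y)) (flatB n φ μ x r L) ≤
        T * ∫⁻ z, edist z.1 z.2 ^ 2 ∂π := by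
  obtain ⟨K, hK⟩ := exists_forall_chiSqTransport_flatBump n hc₂ (2 * (4 * c₂ ^ 2))
  set A : ℝ := 4 * c₂ ^ 3 + 4 * c₂ with hA
  refine ⟨2 * (4 * c₂ ^ 2).toNNReal + 2 * ((2 * K + 72) * A.toNNReal) + 36 * A.toNNReal, ?_⟩
  intro d φ hφ x r hr L hL hLx μ π hπ hfst c hc
  obtain ⟨hfin, hη, hchi⟩ := hK d φ hφ x r hr L hL hLx
  obtain ⟨χ, hχ, hχ0, hχM, hχA, hχh, hfar⟩ := hφ.exists_transport_weight hc₂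
  have hmφ : Measurable (phiB φ x r) := (continuous_phiB hφ x r).measurable
  have hbd : IsFiniteMeasure (μ.withDensity fun y => ENNReal.ofReal (phiB φ x r y)) := by
    rw [← hfst]
    have : IsFiniteMeasure (π.map Prod.fst) := Measure.isFiniteMeasure_map _ _
    refine isFiniteMeasure_of_le (π.map Prod.fst) ((withDensity_mono (g := 1)
      (ae_of_all _ fun z => ?_)).trans_eq withDensity_one)
    simpa using hφ.phiB_le_one x r z
  have hb := ofReal_cBL_mul hφ hη (measure_ne_top
    (μ.withDensity fun y => ENNReal.ofReal (phiB φ x r y)) univ)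
  rw [← hfst] at hb
  have hscale : ∀ z w : EuclideanSpace ℝ (Fin d),
      ENNReal.ofReal (A * ‖r⁻¹ • (z - x) - r⁻¹ • (w - x)‖ ^ 2) =
        ((A.toNNReal / r.toNNReal ^ 2 : ℝ≥0) : ℝ≥0∞) * edist z w ^ 2 := by
    intro z w
    have hA0 : 0 ≤ A := by positivity
    rw [← smul_sub, sub_sub_sub_cancel_right, norm_smul, ← dist_eq_norm, edist_dist,
      ← ENNReal.ofReal_pow dist_nonneg, ← ENNReal.ofReal_coe_nnreal,
      ← ENNReal.ofReal_mul (NNReal.coe_nonneg _), Real.norm_of_nonneg (inv_nonneg.2 hr.le)]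
    congr 1
    push_cast
    rw [Real.coe_toNNReal _ hA0, Real.coe_toNNReal _ hr.le]
    field_simp
  have hΦ : Measurable fun z : EuclideanSpace ℝ (Fin d) × EuclideanSpace ℝ (Fin d) =>
      χ (r⁻¹ • (z.1 - x), r⁻¹ • (z.2 - x)) :=
    hχ.comp (((measurable_fst.sub_const x).const_smul r⁻¹).prodMk
      ((measurable_snd.sub_const x).const_smul r⁻¹))
  have hχA' : ∀ z : EuclideanSpace ℝ (Fin d) × EuclideanSpace ℝ (Fin d),
      ENNReal.ofReal (phiB φ x r z.2 * (χ (r⁻¹ • (z.1 - x), r⁻¹ • (z.2 - x)) - 1) ^ 2) ≤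
        ((A.toNNReal / r.toNNReal ^ 2 : ℝ≥0) : ℝ≥0∞) * edist z.1 z.2 ^ 2 :=
    fun z => (ENNReal.ofReal_le_ofReal (hχA (r⁻¹ • (z.1 - x), r⁻¹ • (z.2 - x)))).trans_eq
      (hscale z.1 z.2)
  have hfar' : ∀ z : EuclideanSpace ℝ (Fin d) × EuclideanSpace ℝ (Fin d),
      ENNReal.ofReal (phiB φ x r z.1 -
        phiB φ x r z.2 * χ (r⁻¹ • (z.1 - x), r⁻¹ • (z.2 - x))) ≤
        ((A.toNNReal / r.toNNReal ^ 2 : ℝ≥0) : ℝ≥0∞) * edist z.1 z.2 ^ 2 :=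
    fun z => (ENNReal.ofReal_le_ofReal (hfar (r⁻¹ • (z.1 - x), r⁻¹ • (z.2 - x)))).trans_eq
      (hscale z.1 z.2)
  have hχh' : ∀ z : EuclideanSpace ℝ (Fin d) × EuclideanSpace ℝ (Fin d),
      phiB φ x r z.2 * χ (r⁻¹ • (z.1 - x), r⁻¹ • (z.2 - x)) ≤ phiB φ x r z.1 :=
    fun z => hχh (r⁻¹ • (z.1 - x), r⁻¹ • (z.2 - x))
  have main := sqCost_withDensity_smul_le π hη hchi hmφ (hφ.phiB_nonneg x r)
    (hφ.phiB_le_one x r) hc hΦ (fun z => hχ0 _) (fun z => hχM _) hχA' hχh' hfar'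
    (measurableSet_closedBall (x := x) (ε := 3 * r))
    (fun y hy => hφ.phiB_eq_zero hr (not_le.1 hy).le)
    (ae_phiB_mem_closedBall hφ x hr _)
    (fun y hy z hz => edist_le_of_mem_closedBall hy hz) hb
  rw [hfst] at main
  refine main.trans_eq ?_
  congr 2
  field_simp
  ring

lemma measure_compl_msupp {E : Type*} [MeasurableSpace E] [PseudoMetricSpace E]
    [SecondCountableTopology E] (μ : Measure E) : μ (msupp μ)ᶜ = 0 := by
  refine measure_null_of_locally_null _ fun x hx => ?_
  simp only [msupp, mem_compl_iff, mem_ofPred_eq, not_forall, not_lt, nonpos_iff_eq_zero] at hx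
  obtain ⟨ε, hε, h⟩ := hx
  exact ⟨ball x ε, mem_nhdsWithin_of_mem_nhds (ball_mem_nhds x hε), h⟩

lemma measure_le_of_inter_msupp_subset {E : Type*} [MeasurableSpace E] [PseudoMetricSpace E]
    [SecondCountableTopology E] {μ : Measure E} {s t : Set E} (h : s ∩ msupp μ ⊆ t) :
    μ s ≤ μ t := by
  have hst : s ⊆ t ∪ (msupp μ)ᶜ := fun x hx => by
    by_cases hxs : x ∈ msupp μ
    · exact Or.inl (h ⟨hx, hxs⟩)
    · exact Or.inr hxs
  refine (measure_mono hst).trans ((measure_union_le _ _).trans ?_)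
  rw [measure_compl_msupp, add_zero]

lemma ADRegular.measure_closedBall_le {d n : ℕ} {c₀ : ℝ} (hc₀ : 0 < c₀)
    {μ : Measure (EuclideanSpace ℝ (Fin d))} (hμ : ADRegular n c₀ μ)
    {p : EuclideanSpace ℝ (Fin d)} (hp : p ∈ msupp μ) (hd : Metric.ediam (msupp μ) ≠ 0) {ρ : ℝ}
    (hρ : 0 < ρ) : μ (closedBall p ρ) ≤ ENNReal.ofReal (c₀ * ρ ^ n) := by
  rcases le_or_gt (ENNReal.ofReal ρ) (Metric.ediam (msupp μ)) with h | h
  · exact (hμ p hp ρ hρ h).2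
  have htop : Metric.ediam (msupp μ) ≠ ⊤ := ne_top_of_lt h
  set δ := (Metric.ediam (msupp μ)).toReal with hδ
  have hδ0 : 0 < δ := ENNReal.toReal_pos hd htop
  have hδe : ENNReal.ofReal δ = Metric.ediam (msupp μ) := ENNReal.ofReal_toReal htop
  have hδρ : δ ≤ ρ := by
    rw [← hδe] at h
    exact (ENNReal.ofReal_lt_ofReal_iff hρ).1 h |>.le
  have hsub : closedBall p ρ ∩ msupp μ ⊆ closedBall p δ := fun y hy => by
    rw [mem_closedBall, ← ENNReal.ofReal_le_ofReal_iff hδ0.le, hδe, ← edist_dist]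
    exact Metric.edist_le_ediam_of_mem hy.2 hp
  refine (measure_le_of_inter_msupp_subset hsub).trans ((hμ p hp δ hδ0 hδe.le).2.trans ?_)
  exact ENNReal.ofReal_le_ofReal (by gcongr)

lemma exists_forall_measure_closedBall_le_mul (n : ℕ) {C c₀ : ℝ} (hC : 0 < C) (hc₀ : 0 < c₀) :
    ∃ K : ℝ≥0, ∀ (d : ℕ) (μ : Measure (EuclideanSpace ℝ (Fin d))), ADRegular n c₀ μ →
      ∀ (x : EuclideanSpace ℝ (Fin d)) (r : ℝ) (x' : EuclideanSpace ℝ (Fin d)) (r' : ℝ), 0 < r →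
        closedBall x (3 * r) ⊆ closedBall x' r' → C⁻¹ * r' ≤ r → r ≤ r' →
        ENNReal.ofReal (C⁻¹ * r ^ n) ≤ μ (closedBall x r) →
        μ (closedBall x' (3 * r')) ≤ K * μ (closedBall x r) := by
  refine ⟨1 + (c₀ * 4 ^ n * C ^ (n + 1)).toNNReal, fun d μ hμ x r x' r' hr hB hCr hrr hm => ?_⟩
  have hpos : 0 < μ (closedBall x r) :=
    lt_of_lt_of_le (ENNReal.ofReal_pos.2 (by positivity)) hm
  have hne : (closedBall x r ∩ msupp μ).Nonempty := by
    by_contra hempty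
    rw [not_nonempty_iff_eq_empty] at hempty
    exact hpos.ne' (le_antisymm ((measure_le_of_inter_msupp_subset hempty.le).trans_eq
      measure_empty) zero_le)
  obtain ⟨p, hpx, hp⟩ := hne
  rw [ENNReal.coe_add, add_mul, ENNReal.coe_one, one_mul]
  by_cases hd : Metric.ediam (msupp μ) = 0
  · refine le_add_right (measure_le_of_inter_msupp_subset fun y hy => ?_)
    rwa [Metric.ediam_eq_zero_iff.1 hd hy.2 hp]
  · refine le_add_left ?_
    have hr' : 0 < r' := hr.trans_le hrr
    have hpx' : dist p x' ≤ r' :=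
      hB (closedBall_subset_closedBall (by linarith) hpx)
    have hsub : closedBall x' (3 * r') ⊆ closedBall p (4 * r') :=
      closedBall_subset_closedBall' (by rw [dist_comm]; linarith)
    have hle : r' ≤ C * r := by rwa [inv_mul_le_iff₀ hC] at hCr
    calc μ (closedBall x' (3 * r')) ≤ ENNReal.ofReal (c₀ * (4 * r') ^ n) :=
          (measure_mono hsub).trans (hμ.measure_closedBall_le hc₀ hp hd (by positivity))
      _ ≤ ENNReal.ofReal (c₀ * (4 * (C * r)) ^ n) := by gcongr
      _ = ENNReal.ofReal (c₀ * 4 ^ n * C ^ (n + 1)) * ENNReal.ofReal (C⁻¹ * r ^ n) := by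
          rw [← ENNReal.ofReal_mul (by positivity)]
          congr 1
          rw [mul_pow, mul_pow, pow_succ]
          field_simp
      _ ≤ _ := mul_le_mul_right hm _

section Translation

open scoped Pointwise

lemma map_add_left_hausdorffMeasure_restrict {d : ℕ} (n : ℝ) (v : EuclideanSpace ℝ (Fin d))
    (L : AffineSubspace ℝ (EuclideanSpace ℝ (Fin d))) :
    ((μH[n]).restrict (L : Set (EuclideanSpace ℝ (Fin d)))).map (fun z => v + z) =
      (μH[n]).restrict ((v +ᵥ L : AffineSubspace ℝ (EuclideanSpace ℝ (Fin d))) :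
        Set (EuclideanSpace ℝ (Fin d))) := by
  have h1 := (IsometryEquiv.addLeft v).map_hausdorffMeasure n
  have h2 : (IsometryEquiv.addLeft v) ⁻¹' ((v +ᵥ L : AffineSubspace ℝ _) :
      Set (EuclideanSpace ℝ (Fin d))) = L := by
    ext z
    exact AffineSubspace.vadd_mem_pointwise_vadd_iff
  have h3 := ((IsometryEquiv.addLeft v).toHomeomorph.measurableEmbedding).restrict_map (μH[n])
    ((v +ᵥ L : AffineSubspace ℝ _) : Set (EuclideanSpace ℝ (Fin d)))
  change ((μH[n]).map (IsometryEquiv.addLeft v)).restrict _ = ((μH[n]).restrict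
    ((IsometryEquiv.addLeft v) ⁻¹' _)).map (IsometryEquiv.addLeft v) at h3
  rw [h1, h2] at h3
  exact h3.symm

lemma AffineSubspace.exists_vadd_inter_closedBall_nonempty {V : Type*} [NormedAddCommGroup V]
    [InnerProductSpace ℝ V] [FiniteDimensional ℝ V] {L : AffineSubspace ℝ V}
    (hL : (L : Set V).Nonempty) (x : V) {r : ℝ} (hr : 0 < r) :
    ∃ v : V, (((v +ᵥ L : AffineSubspace ℝ V) : Set V) ∩ closedBall x r).Nonempty ∧
      ∀ y ∈ closedBall x r, ∀ z ∈ L, ‖v‖ ≤ dist y z := by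
  obtain ⟨p, hp, hpL⟩ := AffineSubspace.exists_mem_forall_norm_add_sub_sq hL x
  have hmin : ∀ z ∈ L, ‖x - p‖ ≤ dist x z := fun z hz => by
    have h1 := hpL (z - p) (AffineSubspace.vsub_mem_direction hz hp)
    rw [add_sub_cancel] at h1
    rw [dist_comm, dist_eq_norm, norm_sub_rev]
    refine le_of_sq_le_sq ?_ (norm_nonneg _)
    nlinarith [sq_nonneg ‖z - p‖]
  rcases le_or_gt ‖x - p‖ r with h | h
  · refine ⟨0, ⟨p, by simpa using hp, ?_⟩, fun y _ z _ => by simp⟩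
    rwa [mem_closedBall, dist_comm, dist_eq_norm]
  · have hl : 0 < ‖x - p‖ := hr.trans h
    have hc : 0 ≤ 1 - r / ‖x - p‖ := by
      rw [sub_nonneg, div_le_one hl]; exact h.le
    refine ⟨(1 - r / ‖x - p‖) • (x - p),
      ⟨(1 - r / ‖x - p‖) • (x - p) + p, AffineSubspace.vadd_mem_pointwise_vadd_iff.2 hp, ?_⟩,
      fun y hy z hz => ?_⟩
    · rw [mem_closedBall, dist_eq_norm, show (1 - r / ‖x - p‖) • (x - p) + p - x =
        -((r / ‖x - p‖) • (x - p)) by rw [sub_smul, one_smul]; abel, norm_neg, norm_smul,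
        Real.norm_of_nonneg (by positivity), div_mul_cancel₀ _ hl.ne']
    · rw [norm_smul, Real.norm_of_nonneg hc, sub_mul, one_mul, div_mul_cancel₀ _ hl.ne']
      have h1 := hmin z hz
      have h2 := dist_triangle x y z
      have h3 := mem_closedBall'.1 hy
      linarith

lemma withDensity_withDensity_phiB {d : ℕ} {c₂ : ℝ} {φ : EuclideanSpace ℝ (Fin d) → ℝ}
    (h : IsBump c₂ φ) {x' : EuclideanSpace ℝ (Fin d)} {r' : ℝ} (hr' : 0 < r')
    {f : EuclideanSpace ℝ (Fin d) → ℝ≥0∞} (hf : Measurable f)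
    (hfB : ∀ y, 2 * r' < dist y x' → f y = 0) (ν : Measure (EuclideanSpace ℝ (Fin d))) :
    (ν.withDensity fun y => ENNReal.ofReal (phiB φ x' r' y)).withDensity f = ν.withDensity f := by
  rw [← withDensity_mul _ (continuous_phiB h x' r').measurable.ennreal_ofReal hf]
  congr 1
  funext y
  rw [Pi.mul_apply]
  rcases le_or_gt (dist y x') (2 * r') with hy | hy
  · rw [h.phiB_eq_one hr' hy, ENNReal.ofReal_one, one_mul]
  · rw [hfB y hy, mul_zero]

lemma withDensity_phiB_univ_le {d : ℕ} {c₂ : ℝ} {φ : EuclideanSpace ℝ (Fin d) → ℝ}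
    (h : IsBump c₂ φ) (x : EuclideanSpace ℝ (Fin d)) {r : ℝ} (hr : 0 < r)
    (ν : Measure (EuclideanSpace ℝ (Fin d))) :
    ν.withDensity (fun y => ENNReal.ofReal (phiB φ x r y)) univ ≤ ν (closedBall x (3 * r)) := by
  rw [withDensity_apply _ MeasurableSet.univ, Measure.restrict_univ,
    ← lintegral_indicator_one measurableSet_closedBall]
  refine lintegral_mono fun y => ?_
  by_cases hy : y ∈ closedBall x (3 * r)
  · rw [indicator_of_mem hy]
    simpa using h.phiB_le_one x r y
  · rw [h.phiB_eq_zero hr (not_le.1 hy).le, ENNReal.ofReal_zero]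
    exact zero_le

lemma withDensity_phiB_apply_of_subset {d : ℕ} {c₂ : ℝ} {φ : EuclideanSpace ℝ (Fin d) → ℝ}
    (h : IsBump c₂ φ) {x : EuclideanSpace ℝ (Fin d)} {r : ℝ} (hr : 0 < r)
    (ν : Measure (EuclideanSpace ℝ (Fin d))) {s : Set (EuclideanSpace ℝ (Fin d))}
    (hs : MeasurableSet s) (hsub : s ⊆ closedBall x (2 * r)) :
    ν.withDensity (fun y => ENNReal.ofReal (phiB φ x r y)) s = ν s := by
  rw [withDensity_apply _ hs, ← setLIntegral_one]
  refine setLIntegral_congr_fun hs fun y hy => ?_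
  rw [h.phiB_eq_one hr (hsub hy), ENNReal.ofReal_one]

lemma exists_sqCost_flatB_le_of_coupling (n : ℕ) {C c₀ c₂ : ℝ} (hC : 0 < C) (hc₀ : 0 < c₀)
    (hc₂ : 0 < c₂) :
    ∃ T : ℝ≥0, ∀ (d : ℕ) (μ : Measure (EuclideanSpace ℝ (Fin d))), ADRegular n c₀ μ →
      ∀ φ : EuclideanSpace ℝ (Fin d) → ℝ, IsBump c₂ φ →
      ∀ (x : EuclideanSpace ℝ (Fin d)) (r : ℝ) (x' : EuclideanSpace ℝ (Fin d)) (r' : ℝ), 0 < r →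
        closedBall x (3 * r) ⊆ closedBall x' r' → C⁻¹ * r' ≤ r → r ≤ r' →
        ENNReal.ofReal (C⁻¹ * r ^ n) ≤ μ (closedBall x r) →
      ∀ L' : AffineSubspace ℝ (EuclideanSpace ℝ (Fin d)), Module.finrank ℝ L'.direction = n →
        ((L' : Set (EuclideanSpace ℝ (Fin d))) ∩ closedBall x' r').Nonempty →
      ∀ π : Measure (EuclideanSpace ℝ (Fin d) × EuclideanSpace ℝ (Fin d)),
        π.map Prod.fst = μ.withDensity (fun y => ENNReal.ofReal (phiB φ x' r' y)) →
        π.map Prod.snd = flatB n φ μ x' r' L' →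
      ∃ L : AffineSubspace ℝ (EuclideanSpace ℝ (Fin d)), Module.finrank ℝ L.direction = n ∧
        ((L : Set (EuclideanSpace ℝ (Fin d))) ∩ closedBall x r).Nonempty ∧
        sqCost (μ.withDensity fun y => ENNReal.ofReal (phiB φ x r y)) (flatB n φ μ x r L) ≤
          T * ∫⁻ z, edist z.1 z.2 ^ 2 ∂π := by
  obtain ⟨K, hK⟩ := exists_forall_measure_closedBall_le_mul n hC hc₀
  obtain ⟨T₀, hT₀⟩ := exists_forall_sqCost_flatB_le n hc₂
  obtain ⟨_, hchi⟩ := exists_forall_chiSqTransport_flatBump n hc₂ 0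
  refine ⟨3600 * K + T₀ * (2 + 2 * K), ?_⟩
  intro d μ hμ φ hφ x r x' r' hr hB hCr hrr hm L' hL'n hL' π hfst hsnd
  set J := ∫⁻ z, edist z.1 z.2 ^ 2 ∂π with hJ
  have hr' : 0 < r' := hr.trans_le hrr
  have hdoub := hK d μ hμ x r x' r' hr hB hCr hrr hm
  have hfin' := (hchi d φ hφ x' r' hr' L' hL'n hL').1
  have hmφ : Measurable fun y => ENNReal.ofReal (phiB φ x r y) :=
    (continuous_phiB hφ x r).measurable.ennreal_ofReal
  have hflat : flatB n φ μ x' r' L' = (cBL n φ μ x' r' L').toNNReal • flatBump n φ x' r' L' := rfl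
  have hπuniv : π univ = μ.withDensity (fun y => ENNReal.ofReal (phiB φ x' r' y)) univ := by
    rw [← hfst, Measure.map_apply measurable_fst MeasurableSet.univ, preimage_univ]
  have hπ : IsFiniteMeasure π := by
    refine ⟨?_⟩
    have h1 : π univ = π.map Prod.snd univ := by
      rw [Measure.map_apply measurable_snd MeasurableSet.univ, preimage_univ]
    rw [h1, hsnd, hflat]
    exact measure_lt_top _ _
  have hπK : π univ ≤ K * μ (closedBall x r) :=
    hπuniv.le.trans ((withDensity_phiB_univ_le hφ x' hr' μ).trans hdoub)
  have hsub : closedBall x r ⊆ closedBall x' (2 * r') :=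
    (closedBall_subset_closedBall (by linarith)).trans
      (hB.trans (closedBall_subset_closedBall (by linarith)))
  have hsub3 : closedBall x (3 * r) ⊆ closedBall x' (2 * r') :=
    hB.trans (closedBall_subset_closedBall (by linarith))
  have hfin3 : μ (closedBall x (3 * r)) ≠ ⊤ := by
    rw [← withDensity_phiB_apply_of_subset hφ hr' μ measurableSet_closedBall hsub3]
    exact ne_top_of_le_ne_top (hπuniv ▸ measure_ne_top π univ) (measure_mono (subset_univ _))
  obtain ⟨v, hvL, hv⟩ := AffineSubspace.exists_vadd_inter_closedBall_nonempty
    (hL'.mono inter_subset_left) x hr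
  have hLn : Module.finrank ℝ (v +ᵥ L').direction = n := by
    rw [AffineSubspace.pointwise_vadd_direction, hL'n]
  obtain ⟨hfin, hη, -⟩ := hchi d φ hφ x r hr (v +ᵥ L') hLn hvL
  refine ⟨v +ᵥ L', hLn, hvL, ?_⟩
  have hvJ : ENNReal.ofReal (‖v‖ ^ 2) * μ (closedBall x r) ≤ J := by
    have hL'm : MeasurableSet (L' : Set (EuclideanSpace ℝ (Fin d))) :=
      L'.closed_of_finiteDimensional.measurableSet
    have hae : ∀ᵐ z ∂π, z.2 ∈ L' := by
      have h1 : ∀ᵐ z ∂(π.map Prod.snd), z ∈ (L' : Set (EuclideanSpace ℝ (Fin d))) := by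
        rw [hsnd, hflat]
        exact Measure.ae_smul_measure ((withDensity_absolutelyContinuous _ _).ae_le
          (ae_restrict_mem hL'm)) _
      exact ae_of_ae_map measurable_snd.aemeasurable h1
    rw [← withDensity_phiB_apply_of_subset hφ hr' μ measurableSet_closedBall hsub, ← hfst,
      Measure.map_apply measurable_fst measurableSet_closedBall, ← setLIntegral_const]
    refine (lintegral_mono_ae ?_).trans (setLIntegral_le_lintegral _ _)
    filter_upwards [ae_restrict_of_ae hae,
      ae_restrict_mem (measurable_fst measurableSet_closedBall)] with z hz hzx
    rw [ENNReal.ofReal_pow (norm_nonneg _), edist_dist]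
    exact pow_le_pow_left₀ (zero_le) (ENNReal.ofReal_le_ofReal (hv _ hzx _ hz)) 2
  rcases lt_or_ge (r / 10) ‖v‖ with hvr | hvr
  · have hmu := withDensity_phiB_univ_le hφ x hr μ
    have hne : μ.withDensity (fun y => ENNReal.ofReal (phiB φ x r y)) univ ≠ ⊤ :=
      ne_top_of_le_ne_top hfin3 hmu
    have : IsFiniteMeasure (μ.withDensity fun y => ENNReal.ofReal (phiB φ x r y)) :=
      ⟨hne.lt_top⟩
    refine (sqCost_le_of_bounded (D := (6 * r.toNNReal : ℝ≥0)) ?_ (ae_phiB_mem_closedBall hφ x hr μ)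
      ?_ (fun y hy z hz => edist_le_of_mem_closedBall hy hz)).trans ?_
    · exact (ofReal_cBL_mul hφ hη hne).symm
    · exact Measure.ae_smul_measure (ae_phiB_mem_closedBall hφ x hr _) _
    · have h6 : ((6 * r.toNNReal : ℝ≥0) : ℝ≥0∞) ^ 2 ≤ 3600 * ENNReal.ofReal (‖v‖ ^ 2) := by
        have h1 : ((6 * r.toNNReal : ℝ≥0) : ℝ≥0∞) = ENNReal.ofReal (6 * r) := by
          rw [ENNReal.ofReal_mul (by norm_num), ENNReal.coe_mul]; simp [ENNReal.ofReal]
        have h2 : (3600 : ℝ≥0∞) = ENNReal.ofReal 3600 := by simp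
        rw [h1, h2, ← ENNReal.ofReal_pow (by positivity), ← ENNReal.ofReal_mul (by norm_num)]
        refine ENNReal.ofReal_le_ofReal ?_
        nlinarith [norm_nonneg v]
      calc _ ≤ 3600 * ENNReal.ofReal (‖v‖ ^ 2) * (K * μ (closedBall x r)) := by
            refine mul_le_mul' h6 (hmu.trans ((measure_mono ?_).trans hdoub))
            exact hsub3.trans (closedBall_subset_closedBall (by linarith))
        _ = 3600 * K * (ENNReal.ofReal (‖v‖ ^ 2) * μ (closedBall x r)) := by ring
        _ ≤ 3600 * K * J := mul_le_mul_right hvJ _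
        _ ≤ _ := by
            refine mul_le_mul_left ?_ _
            push_cast
            exact le_self_add
  · have hadd : Measurable fun z : EuclideanSpace ℝ (Fin d) => v + z := measurable_const_add v
    have hΦ : Measurable fun z : EuclideanSpace ℝ (Fin d) × EuclideanSpace ℝ (Fin d) =>
        (z.1, v + z.2) := measurable_fst.prodMk (hadd.comp measurable_snd)
    set π' := π.map fun z => (z.1, v + z.2) with hπ'
    have hfin' : IsFiniteMeasure π' := Measure.isFiniteMeasure_map _ _
    have hfst' : π'.map Prod.fst = π.map Prod.fst := by
      rw [hπ', Measure.map_map measurable_fst hΦ]; rfl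
    have hsnd' : π'.map Prod.snd = (π.map Prod.snd).map fun z => v + z := by
      rw [hπ', Measure.map_map measurable_snd hΦ, Measure.map_map hadd measurable_snd]; rfl
    have h1 := hT₀ d φ hφ x r hr (v +ᵥ L') hLn hvL μ π' hfin' (by
      rw [hfst', hfst, withDensity_withDensity_phiB hφ hr' hmφ]
      intro y hy
      rw [hφ.phiB_eq_zero hr, ENNReal.ofReal_zero]
      by_contra! hlt
      exact (mem_closedBall.1 (hsub3 (mem_closedBall.2 hlt.le))).not_gt hy)
      (cBL n φ μ x' r' L').toNNReal (by
      have hmφv : Measurable fun z => ENNReal.ofReal (phiB φ x r (v + z)) := hmφ.comp hadd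
      have h2 : (flatB n φ μ x' r' L').withDensity
          (fun z => ENNReal.ofReal (phiB φ x r (v + z))) =
          (cBL n φ μ x' r' L').toNNReal •
            ((flatBump n φ x' r' L').withDensity fun z => ENNReal.ofReal (phiB φ x r (v + z))) :=
        withDensity_smul_measure _ _
      rw [hsnd', hsnd, ← map_withDensity_comp hadd _ hmφ, h2, Measure.map_smul, flatBump, flatBump,
        withDensity_withDensity_phiB hφ hr' hmφv, map_withDensity_comp hadd _ hmφ,
        map_add_left_hausdorffMeasure_restrict]
      intro y hy
      rw [hφ.phiB_eq_zero hr, ENNReal.ofReal_zero]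
      by_contra! hlt
      have h3 := mem_closedBall.1 (hB (mem_closedBall.2 hlt.le))
      have h4 := dist_triangle y (v + y) x'
      have h5 : dist y (v + y) = ‖v‖ := by simp [dist_eq_norm]
      linarith)
    refine h1.trans ?_
    have hJ' : ∫⁻ z, edist z.1 z.2 ^ 2 ∂π' ≤ (2 + 2 * K : ℝ≥0) * J := by
      rw [hπ', lintegral_map measurable_edist_sq hΦ]
      have h2 : ∀ z : EuclideanSpace ℝ (Fin d) × EuclideanSpace ℝ (Fin d),
          edist z.1 (v + z.2) ^ 2 ≤
            ((2 : ℝ≥0) : ℝ≥0∞) * edist z.1 z.2 ^ 2 +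
              ((2 : ℝ≥0) : ℝ≥0∞) * ENNReal.ofReal (‖v‖ ^ 2) := by
        intro z
        have h3 : edist z.2 (v + z.2) = ENNReal.ofReal ‖v‖ := by simp [edist_dist, dist_eq_norm]
        rw [ENNReal.ofReal_pow (norm_nonneg _), ← h3]
        exact (pow_le_pow_left₀ zero_le (edist_triangle _ _ _) 2).trans
          (ENNReal.add_sq_le_two_mul _ _)
      refine (lintegral_mono h2).trans ?_
      rw [lintegral_add_right _ measurable_const, lintegral_const_mul _ measurable_edist_sq,
        lintegral_const, ENNReal.coe_add, add_mul]
      refine add_le_add_right ?_ _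
      calc _ ≤ ((2 : ℝ≥0) : ℝ≥0∞) * ENNReal.ofReal (‖v‖ ^ 2) * (K * μ (closedBall x r)) :=
            mul_le_mul_right hπK _
        _ = (2 * K : ℝ≥0) * (ENNReal.ofReal (‖v‖ ^ 2) * μ (closedBall x r)) := by push_cast; ring
        _ ≤ _ := mul_le_mul_right hvJ _
    refine (mul_le_mul_right hJ' _).trans ?_
    rw [← mul_assoc]
    refine mul_le_mul_left ?_ _
    push_cast
    exact le_add_self

end Translation

/-- Lemma 5.4.
If `μ` is `n`-dimensional AD-regular, `B, B'` are balls with `3B ⊆ B'`, comparable radii,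
and `μ(B) ≳ r(B)ⁿ`, then `α₂(B) ≤ C' α₂(B')`. -/
theorem statement15 (n d : ℕ) (hnd : n ≤ d) (C c₀ c₂ : ℝ)
    (hC : 0 < C) (hc₀ : 0 < c₀) (hc₂ : 0 < c₂) :
    ∃ C' : ℝ, 0 < C' ∧
      ∀ μ : Measure (EuclideanSpace ℝ (Fin d)), ADRegular n c₀ μ →
      ∀ φ : EuclideanSpace ℝ (Fin d) → ℝ, IsBump c₂ φ →
      ∀ (x : EuclideanSpace ℝ (Fin d)) (r : ℝ) (x' : EuclideanSpace ℝ (Fin d)) (r' : ℝ),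
        0 < r →
        closedBall x (3 * r) ⊆ closedBall x' r' →
        C⁻¹ * r' ≤ r → r ≤ r' →
        ENNReal.ofReal (C⁻¹ * r ^ n) ≤ μ (closedBall x r) →
        alphaP n 2 φ μ x r ≤ ENNReal.ofReal C' * alphaP n 2 φ μ x' r' := by
  obtain ⟨T, hT⟩ := exists_sqCost_flatB_le_of_coupling n hC hc₀ hc₂
  have he : -(1 : ℝ) - n / 2 ≤ 0 := by
    have : (0 : ℝ) ≤ n / 2 := by positivity
    linarith
  refine ⟨(C⁻¹) ^ (-(1 : ℝ) - n / 2) * (T + 1 : ℝ) ^ (1 / 2 : ℝ), by positivity, ?_⟩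
  intro μ hμ φ hφ x r x' r' hr hB hCr hrr hm
  have hr' : 0 < r' := hr.trans_le hrr
  have hconst : ENNReal.ofReal (r ^ (-(1 : ℝ) - n / 2)) * (T : ℝ≥0∞) ^ (1 / 2 : ℝ) ≤
      ENNReal.ofReal ((C⁻¹) ^ (-(1 : ℝ) - n / 2) * (T + 1 : ℝ) ^ (1 / 2 : ℝ)) *
        ENNReal.ofReal (r' ^ (-(1 : ℝ) - n / 2)) := by
    rw [← ENNReal.ofReal_coe_nnreal, ENNReal.ofReal_rpow_of_nonneg (NNReal.coe_nonneg T)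
      (by norm_num), ← ENNReal.ofReal_mul (by positivity), ← ENNReal.ofReal_mul (by positivity)]
    refine ENNReal.ofReal_le_ofReal ?_
    rw [mul_right_comm, ← Real.mul_rpow (by positivity) hr'.le]
    refine mul_le_mul (Real.rpow_le_rpow_of_nonpos (by positivity) hCr he)
      (Real.rpow_le_rpow (NNReal.coe_nonneg T) (by linarith) (by norm_num)) (by positivity)
      (by positivity)
  have hk0 : ENNReal.ofReal ((C⁻¹) ^ (-(1 : ℝ) - n / 2) * (T + 1 : ℝ) ^ (1 / 2 : ℝ)) *
      ENNReal.ofReal (r' ^ (-(1 : ℝ) - n / 2)) ≠ 0 :=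
    mul_ne_zero (ENNReal.ofReal_pos.2 (by positivity)).ne'
      (ENNReal.ofReal_pos.2 (by positivity)).ne'
  have hkt : ENNReal.ofReal ((C⁻¹) ^ (-(1 : ℝ) - n / 2) * (T + 1 : ℝ) ^ (1 / 2 : ℝ)) *
      ENNReal.ofReal (r' ^ (-(1 : ℝ) - n / 2)) ≠ ⊤ :=
    ENNReal.mul_ne_top ENNReal.ofReal_ne_top ENNReal.ofReal_ne_top
  rw [alphaP, alphaP, ← mul_assoc, ENNReal.mul_iInf_of_ne hk0 hkt]
  refine le_iInf fun L' => ?_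
  rw [ENNReal.mul_iInf_of_ne hk0 hkt]
  refine le_iInf fun hL' => ?_
  rw [Wp, ENNReal.mul_iInf_of_ne hk0 hkt]
  refine le_iInf fun π => ?_
  rw [ENNReal.mul_iInf_of_ne hk0 hkt]
  refine le_iInf fun hπ => ?_
  obtain ⟨L, hLn, hLx, hL⟩ := hT d μ hμ φ hφ x r x' r' hr hB hCr hrr hm L' hL'.1 hL'.2 π hπ.1 hπ.2
  refine (mul_le_mul_right (iInf₂_le L ⟨hLn, hLx⟩) _).trans ?_
  rw [Wp_two_eq]
  simp only [ENNReal.rpow_two]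
  calc _ ≤ ENNReal.ofReal (r ^ (-(1 : ℝ) - n / 2)) *
        ((T : ℝ≥0∞) * ∫⁻ z, edist z.1 z.2 ^ 2 ∂π) ^ (1 / 2 : ℝ) :=
        mul_le_mul_right (ENNReal.rpow_le_rpow hL (by norm_num)) _
    _ = ENNReal.ofReal (r ^ (-(1 : ℝ) - n / 2)) * (T : ℝ≥0∞) ^ (1 / 2 : ℝ) *
        (∫⁻ z, edist z.1 z.2 ^ 2 ∂π) ^ (1 / 2 : ℝ) := by
        rw [ENNReal.mul_rpow_of_nonneg _ _ (by norm_num), mul_assoc]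
    _ ≤ _ := mul_le_mul_left hconst _
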